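/- Let 1<p,q<∞, 1/r := 1/q − 1/p, α/d := 1/p − 1/q. Let μ, λ be weights with μ' := μ^{−p'/p}, ν^{1/p+1/q'} = μ^{1/p} λ^{−1/q}, and [μ',λ,ν]_{B_{p',q}} := sup_Q ⟨μ'⟩_Q^{1/p'} ⟨λ⟩_Q^{1/q} ⟨ν⟩_Q^{1/p+1/q'} < ∞. Let 𝒟 be a dyadic lattice and b ∈ L^1_loc. If b ∈ BMO_ν^α (when p ≤ q), respectively M_ν^# b ∈ L^r(ν) (when p > q), then for every f ∈ L^p(μ) the paraproduct Π_b f := Σ_{Q∈𝒟} D_Q b ⟨f⟩_Q converges unconditionally in L^q(λ), and ‖Π_b‖_{L^p(μ)→L^q(λ)} ≲ [μ',λ,ν]_{B_{p',q}} [μ']_{A_∞}^{1/p} [λ]_{A_∞}^{1/q'} ‖b‖_{BMO_ν^α} when p ≤ q, while ‖Π_b‖_{L^p(μ)→L^q(λ)} ≲ [μ',λ,ν]_{B_{p',q}} [μ']_{A_∞}^{1/p} [λ]_{A_∞}^{1/q'} [ν]_{A_∞}^{1/r} ‖M_ν^# b‖_{L^r(ν)} when p > q. -/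

import Mathlib

open MeasureTheory ENNReal Set Filter

noncomputable section

/-- `ℝ^d` with the Euclidean structure. -/
abbrev Rd (d : ℕ) := EuclideanSpace ℝ (Fin d)

variable {d : ℕ}

/-- An axis-parallel cube in `ℝ^d`, given by a corner and a (positive) side length. -/
structure Cube (d : ℕ) where
  corner : Fin d → ℝ
  side : ℝ
  side_pos : 0 < side

namespace Cube

/-- The set of points of the cube. -/
def carrier (Q : Cube d) : Set (Rd d) :=
  {x | ∀ i, Q.corner i ≤ x i ∧ x i < Q.corner i + Q.side}

/-- The volume `|Q| = ℓ(Q)^d` of the cube. -/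
def vol (Q : Cube d) : ℝ := Q.side ^ d

/-- The concentric cube with twice the side length. -/
def double (Q : Cube d) : Cube d :=
  ⟨fun i => Q.corner i - Q.side / 2, 2 * Q.side, by have := Q.side_pos; linarith⟩

end Cube

/-- `∫_Q f`. -/
def intC (Q : Cube d) (f : Rd d → ℝ) : ℝ := ∫ x in Q.carrier, f x

/-- `w(Q) = ∫_Q w`. -/
def wInt (Q : Cube d) (w : Rd d → ℝ) : ℝ := intC Q w

/-- The average `⟨f⟩_Q = |Q|⁻¹ ∫_Q f`. -/
def avg (Q : Cube d) (f : Rd d → ℝ) : ℝ := Q.vol⁻¹ * intC Q f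

/-- The mean oscillation `∫_Q |f - ⟨f⟩_Q|`. -/
def osc (Q : Cube d) (b : Rd d → ℝ) : ℝ := ∫ x in Q.carrier, |b x - avg Q b|

/-- The conjugate (dual) exponent `p' = p/(p-1)`. -/
def conj (p : ℝ) : ℝ := p / (p - 1)

/-- The weighted Lebesgue norm `‖f‖_{L^p(w)} = (∫ |f|^p w dx)^{1/p}`. -/
def wnorm (p : ℝ) (w : Rd d → ℝ) (f : Rd d → ℝ) : ℝ≥0∞ :=
  (∫⁻ x, ENNReal.ofReal (|f x| ^ p * w x)) ^ (1 / p)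

/-- The weighted Lebesgue norm of an `ℝ≥0∞`-valued function. -/
def wnormE (p : ℝ) (w : Rd d → ℝ) (f : Rd d → ℝ≥0∞) : ℝ≥0∞ :=
  (∫⁻ x, f x ^ p * ENNReal.ofReal (w x)) ^ (1 / p)

/-- A weight: a positive, measurable, locally integrable function. -/
def IsWeight (w : Rd d → ℝ) : Prop :=
  (∀ x, 0 < w x) ∧ Measurable w ∧ LocallyIntegrable w volume

/-- `b ∈ L¹_loc`. -/
def L1loc (b : Rd d → ℝ) : Prop := Measurable b ∧ LocallyIntegrable b volume

/-- Bounded measurable functions with compact support (the class `L^∞_c`). -/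
def BddCompactSupp (f : Rd d → ℝ) : Prop :=
  Measurable f ∧ HasCompactSupport f ∧ ∃ M : ℝ, ∀ x, |f x| ≤ M

/-- `‖U‖_{L^p(μ) → L^q(λ)} ≤ N`, tested on all measurable functions. -/
def OpBound (p q : ℝ) (μ lam : Rd d → ℝ) (U : (Rd d → ℝ) → Rd d → ℝ) (N : ℝ) : Prop :=
  ∀ f : Rd d → ℝ, Measurable f → wnorm q lam (U f) ≤ ENNReal.ofReal N * wnorm p μ f

/-- `‖U‖_{L^p(μ) → L^q(λ)} ≤ N`, tested on the dense class `L^∞_c`. -/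
def OpBoundCS (p q : ℝ) (μ lam : Rd d → ℝ) (U : (Rd d → ℝ) → Rd d → ℝ) (N : ℝ) : Prop :=
  ∀ f : Rd d → ℝ, BddCompactSupp f → wnorm q lam (U f) ≤ ENNReal.ofReal N * wnorm p μ f

/-- The weighted sharp maximal function, with cubes restricted to the family `𝒟`. -/
def sharpMaxOn (𝒟 : Set (Cube d)) (ν b : Rd d → ℝ) (x : Rd d) : ℝ≥0∞ :=
  ⨆ (Q : Cube d) (_ : Q ∈ 𝒟) (_ : x ∈ Q.carrier), ENNReal.ofReal (osc Q b / wInt Q ν)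

/-- `‖M^♯_ν b‖_{L^r(ν)}`. -/
def sharpNormOn (𝒟 : Set (Cube d)) (r : ℝ) (ν b : Rd d → ℝ) : ℝ≥0∞ :=
  wnormE r ν (sharpMaxOn 𝒟 ν b)

/-- `‖b‖_{BMO_ν^α} = sup_Q ν(Q)^{-e} ∫_Q |b - ⟨b⟩_Q|` with `e = 1 + α/d`. -/
def bmoNormOn (𝒟 : Set (Cube d)) (e : ℝ) (ν b : Rd d → ℝ) : ℝ≥0∞ :=
  ⨆ (Q : Cube d) (_ : Q ∈ 𝒟), ENNReal.ofReal (osc Q b / wInt Q ν ^ e)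

/-- The Muckenhoupt `A_p` characteristic over the family `𝒟`. -/
def ApCharOn (𝒟 : Set (Cube d)) (p : ℝ) (w : Rd d → ℝ) : ℝ≥0∞ :=
  ⨆ (Q : Cube d) (_ : Q ∈ 𝒟),
    ENNReal.ofReal (avg Q w * avg Q (fun x => w x ^ (-(conj p / p))) ^ (p / conj p))

/-- `w ∈ A_p` (over the family `𝒟`). -/
def IsApOn (𝒟 : Set (Cube d)) (p : ℝ) (w : Rd d → ℝ) : Prop :=
  IsWeight w ∧ LocallyIntegrable (fun x => w x ^ (-(conj p / p))) volume ∧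
    ApCharOn 𝒟 p w < ⊤

/-- The Fujii–Wilson `A_∞` characteristic over the family `𝒟`. -/
def AinfCharOn (𝒟 : Set (Cube d)) (w : Rd d → ℝ) : ℝ≥0∞ :=
  ⨆ (Q : Cube d) (_ : Q ∈ 𝒟),
    (∫⁻ x in Q.carrier,
        ⨆ (R : Cube d) (_ : R ∈ 𝒟) (_ : x ∈ R.carrier),
          ENNReal.ofReal ((∫ y in Q.carrier ∩ R.carrier, w y) / R.vol)) /
      ENNReal.ofReal (wInt Q w)

/-- The relative Fujii–Wilson characteristic `[w]_{A_∞(ν)}` over the family `𝒟`. -/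
def relAinfOn (𝒟 : Set (Cube d)) (w ν : Rd d → ℝ) : ℝ≥0∞ :=
  ⨆ (Q : Cube d) (_ : Q ∈ 𝒟),
    (∫⁻ x in Q.carrier,
        (⨆ (R : Cube d) (_ : R ∈ 𝒟) (_ : R.carrier ⊆ Q.carrier) (_ : x ∈ R.carrier),
          ENNReal.ofReal (wInt R w / wInt R ν)) * ENNReal.ofReal (ν x)) /
      ENNReal.ofReal (wInt Q w)

/-- The joint Bloom–Muckenhoupt characteristic `[μ',λ,ν]_{B_{p',q}}` (for upper bounds). -/
def BupperOn (𝒟 : Set (Cube d)) (p q : ℝ) (μ' lam ν : Rd d → ℝ) : ℝ≥0∞ :=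
  ⨆ (Q : Cube d) (_ : Q ∈ 𝒟),
    ENNReal.ofReal (avg Q μ' ^ (1 / conj p) * avg Q lam ^ (1 / q) *
      avg Q ν ^ (1 / p + 1 / conj q))

/-- The joint Bloom–Muckenhoupt characteristic `[μ,λ']_{B_{p,q'}(ν)}` (for lower bounds). -/
def BlowerOn (𝒟 : Set (Cube d)) (p q : ℝ) (μ lam' ν : Rd d → ℝ) : ℝ≥0∞ :=
  ⨆ (Q : Cube d) (_ : Q ∈ 𝒟),
    ENNReal.ofReal ((wInt Q μ / wInt Q ν) ^ (1 / p) * (wInt Q lam' / wInt Q ν) ^ (1 / conj q))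

/-- A doubling weight. -/
def DoublingWeight (w : Rd d → ℝ) : Prop :=
  ∃ C : ℝ, 0 < C ∧ ∀ Q : Cube d, wInt Q.double w ≤ C * wInt Q w

/-- A `(γ, ν)`-sparse collection of cubes (with respect to a weight `ν`). -/
def SparseFamily (γ : ℝ) (ν : Rd d → ℝ) (S : Set (Cube d)) : Prop :=
  ∃ E : Cube d → Set (Rd d),
    (∀ Q ∈ S, E Q ⊆ Q.carrier ∧ MeasurableSet (E Q) ∧ γ * wInt Q ν ≤ ∫ x in E Q, ν x) ∧
    S.Pairwise fun Q R => Disjoint (E Q) (E R)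

/-- A `(γ, ν)`-sparse collection of cubes (with respect to a measure `ν`). -/
def MSparseFamily (γ : ℝ) (ν : Measure (Rd d)) (S : Set (Cube d)) : Prop :=
  ∃ E : Cube d → Set (Rd d),
    (∀ Q ∈ S, E Q ⊆ Q.carrier ∧ ENNReal.ofReal γ * ν Q.carrier ≤ ν (E Q)) ∧
    S.Pairwise fun Q R => Disjoint (E Q) (E R)

/-- The weighted sharp maximal function with respect to a measure `ν`. -/
def mSharpMaxOn (𝒟 : Set (Cube d)) (ν : Measure (Rd d)) (b : Rd d → ℝ) (x : Rd d) : ℝ≥0∞ :=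
  ⨆ (Q : Cube d) (_ : Q ∈ 𝒟) (_ : x ∈ Q.carrier), ENNReal.ofReal (osc Q b) / ν Q.carrier

/-- The distance between two sets in `ℝ^d`. -/
def setDist (s t : Set (Rd d)) : ℝ := sInf {r | ∃ x ∈ s, ∃ y ∈ t, r = dist x y}

/-- Supports separated by a positive distance. -/
def SeparatedSupports (f g : Rd d → ℝ) : Prop :=
  ∃ ε : ℝ, 0 < ε ∧ ∀ x ∈ tsupport f, ∀ y ∈ tsupport g, ε ≤ dist x y

/-- A dyadic lattice on `ℝ^d`: for every `k ∈ ℤ` a partition of `ℝ^d` into cubes of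
side length `2^{-k}`, each refining the previous one. -/
structure DyadicLattice (d : ℕ) where
  layer : ℤ → Set (Cube d)
  side_eq : ∀ k : ℤ, ∀ Q ∈ layer k, Q.side = (2 : ℝ) ^ (-k)
  covers : ∀ k : ℤ, ∀ x : Rd d, ∃ Q ∈ layer k, x ∈ Q.carrier
  pairwiseDisjoint : ∀ k : ℤ, ∀ Q ∈ layer k, ∀ R ∈ layer k,
    Q ≠ R → Q.carrier ∩ R.carrier = ∅
  refines : ∀ k : ℤ, ∀ Q ∈ layer (k + 1), ∃ R ∈ layer k, Q.carrier ⊆ R.carrier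

/-- The cubes of a dyadic lattice. -/
def DyadicLattice.cubes (D : DyadicLattice d) : Set (Cube d) := {Q | ∃ k, Q ∈ D.layer k}

/-- `𝒟(Q₀)`: the dyadic cubes contained in `Q₀`. -/
def DyadicLattice.below (D : DyadicLattice d) (Q₀ : Cube d) : Set (Cube d) :=
  {Q ∈ D.cubes | Q.carrier ⊆ Q₀.carrier}

open Classical in
/-- The martingale difference `D_Q b = Σ_{R : R̂ = Q} ⟨b⟩_R 1_R − ⟨b⟩_Q 1_Q`. -/
def DyadicLattice.DQ (D : DyadicLattice d) (Q : Cube d) (b : Rd d → ℝ) (x : Rd d) : ℝ :=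
  if h : x ∈ Q.carrier ∧
      ∃ R, R ∈ D.cubes ∧ R.side = Q.side / 2 ∧ x ∈ R.carrier ∧ R.carrier ⊆ Q.carrier
  then avg h.2.choose b - avg Q b
  else 0

/-- Finite partial sums `Σ_{Q ∈ F} D_Q b ⟨f⟩_Q` of the paraproduct. -/
def parasum (D : DyadicLattice d) (b f : Rd d → ℝ) (F : Finset (Cube d)) (x : Rd d) : ℝ :=
  ∑ Q ∈ F, D.DQ Q b x * avg Q f

/-- Unconditional convergence of the paraproduct sum in `L¹_loc` to the function `S`. -/
def UncondConvL1loc (D : DyadicLattice d) (b f S : Rd d → ℝ) : Prop :=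
  ∀ K : Set (Rd d), IsCompact K → ∀ ε : ℝ, 0 < ε →
    ∃ F₀ : Finset (Cube d), ↑F₀ ⊆ D.cubes ∧
      ∀ F : Finset (Cube d), ↑F ⊆ D.cubes → F₀ ⊆ F →
        ∫ x in K, |parasum D b f F x - S x| < ε

/-- `P` is the dyadic paraproduct `Π_b` associated to `b` and the lattice `D`. -/
def IsParaproduct (D : DyadicLattice d) (b : Rd d → ℝ) (P : (Rd d → ℝ) → Rd d → ℝ) : Prop :=
  ∀ f : Rd d → ℝ, BddCompactSupp f → UncondConvL1loc D b f (P f)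

/-- Unconditional convergence of the paraproduct sum in `L^q(λ)` to the function `S`. -/
def UncondConvLq (D : DyadicLattice d) (q : ℝ) (lam : Rd d → ℝ) (b f S : Rd d → ℝ) : Prop :=
  ∀ ε : ℝ, 0 < ε →
    ∃ F₀ : Finset (Cube d), ↑F₀ ⊆ D.cubes ∧
      ∀ F : Finset (Cube d), ↑F ⊆ D.cubes → F₀ ⊆ F →
        wnorm q lam (fun x => parasum D b f F x - S x) < ENNReal.ofReal ε

/-- A modulus of continuity: increasing with `ω(t) → 0` as `t → 0`. -/
def ModulusOfContinuity (ω : ℝ → ℝ) : Prop :=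
  Monotone ω ∧ (∀ t, 0 ≤ ω t) ∧ Tendsto ω (nhdsWithin 0 (Ioi 0)) (nhds 0)

/-- The Dini condition `∫₀¹ ω(t)/t dt < ∞`. -/
def DiniCondition (ω : ℝ → ℝ) : Prop :=
  IntegrableOn (fun t => ω t / t) (Ioc (0 : ℝ) 1) volume

/-- An `ω`-Calderón–Zygmund kernel. -/
structure CZKernel (d : ℕ) (ω : ℝ → ℝ) where
  kernel : Rd d → Rd d → ℝ
  CK : ℝ
  CK_pos : 0 < CK
  size : ∀ x y : Rd d, x ≠ y → |kernel x y| ≤ CK / dist x y ^ d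
  smooth : ∀ x x' y : Rd d, x ≠ y → dist x x' ≤ dist x y / 2 →
    |kernel x y - kernel x' y| + |kernel y x - kernel y x'| ≤
      1 / dist x y ^ d * ω (dist x x' / dist x y)

/-- Non-degeneracy of a Calderón–Zygmund kernel. -/
def CZKernel.NonDegenerate {d : ℕ} {ω : ℝ → ℝ} (K : CZKernel d ω) : Prop :=
  ∃ c : ℝ, 0 < c ∧ ∀ (x : Rd d) (r : ℝ), 0 < r →
    ∃ y : Rd d, c * r ≤ dist x y ∧ c / r ^ d ≤ |K.kernel y x|

/-- An `ω`-Calderón–Zygmund operator: a linear operator, bounded on some `L^{p₀}`, with an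
`ω`-Calderón–Zygmund kernel representation off the support. -/
structure CZOperator (d : ℕ) (ω : ℝ → ℝ) extends CZKernel d ω where
  T : (Rd d → ℝ) → Rd d → ℝ
  map_add : ∀ f g : Rd d → ℝ, T (f + g) = T f + T g
  map_smul : ∀ (c : ℝ) (f : Rd d → ℝ), T (c • f) = c • T f
  measurable_map : ∀ f : Rd d → ℝ, Measurable f → Measurable (T f)
  p₀ : ℝ
  one_lt_p₀ : 1 < p₀
  N₀ : ℝ
  bounded : ∀ f : Rd d → ℝ, Measurable f →
    wnorm p₀ (fun _ => 1) (T f) ≤ ENNReal.ofReal N₀ * wnorm p₀ (fun _ => 1) f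
  kernel_repr : ∀ f : Rd d → ℝ, BddCompactSupp f → ∀ x ∉ tsupport f,
    T f x = ∫ y, kernel x y * f y

/-- The commutator `[b, T] f = b · Tf − T(b f)`. -/
def commutatorOp (b : Rd d → ℝ) (T : (Rd d → ℝ) → Rd d → ℝ) : (Rd d → ℝ) → Rd d → ℝ :=
  fun f x => b x * T f x - T (fun y => b y * f y) x

/-- The sparse operator `𝒜^⋆_{S,b} f = Σ_{Q∈S} ⟨|b − ⟨b⟩_Q| |f|⟩_Q 1_Q`. -/
def sparseOpStar (S : Set (Cube d)) (b f : Rd d → ℝ) (x : Rd d) : ℝ≥0∞ :=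
  ∑' Q : S, (Q : Cube d).carrier.indicator
      (fun _ => ENNReal.ofReal (avg (Q : Cube d) fun y => |b y - avg (Q : Cube d) b| * |f y|)) x

/-- The sparse operator `f ↦ Σ_{Q∈S} ⟨|b − ⟨b⟩_Q|⟩_Q ⟨|f|⟩_Q 1_Q`. -/
def sparseOp2 (S : Set (Cube d)) (b f : Rd d → ℝ) (x : Rd d) : ℝ≥0∞ :=
  ∑' Q : S, (Q : Cube d).carrier.indicator
      (fun _ => ENNReal.ofReal ((avg (Q : Cube d) fun y => |b y - avg (Q : Cube d) b|) *
        avg (Q : Cube d) fun y => |f y|)) x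

/-- The sparse operator `f ↦ Σ_{Q∈S} (|Q|^{-s} ∫_Q |f|^s)^{1/s} 1_Q`. -/
def sparseOpPow (S : Set (Cube d)) (s : ℝ) (f : Rd d → ℝ) (x : Rd d) : ℝ≥0∞ :=
  ∑' Q : S, (Q : Cube d).carrier.indicator
      (fun _ => ENNReal.ofReal (((Q : Cube d).vol ^ (-s) *
        intC (Q : Cube d) fun y => |f y| ^ s) ^ (1 / s))) x

namespace Cube

lemma carrier_eq_preimage (Q : Cube d) :
    Q.carrier = (WithLp.ofLp : Rd d → Fin d → ℝ) ⁻¹'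
      (Set.univ.pi fun i => Set.Ico (Q.corner i) (Q.corner i + Q.side)) := by
  ext x; simp [carrier, Set.mem_pi]

lemma measurableSet_carrier (Q : Cube d) : MeasurableSet Q.carrier := by
  rw [carrier_eq_preimage]
  exact (PiLp.volume_preserving_ofLp (Fin d)).measurable
    (MeasurableSet.univ_pi fun i => measurableSet_Ico)

lemma volume_carrier (Q : Cube d) : volume Q.carrier = ENNReal.ofReal Q.vol := by
  rw [carrier_eq_preimage, (PiLp.volume_preserving_ofLp (Fin d)).measure_preimage
    (MeasurableSet.univ_pi fun i => measurableSet_Ico).nullMeasurableSet, Real.volume_pi_Ico]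
  simp [vol, ENNReal.ofReal_pow Q.side_pos.le]

lemma vol_pos (Q : Cube d) : 0 < Q.vol := pow_pos Q.side_pos d

lemma carrier_nonempty (Q : Cube d) : Q.carrier.Nonempty :=
  ⟨WithLp.toLp 2 Q.corner, fun i => by simp [Q.side_pos]⟩

lemma integrableOn_carrier (Q : Cube d) {f : Rd d → ℝ} (hf : LocallyIntegrable f volume) :
    IntegrableOn f Q.carrier volume := by
  have hK : IsCompact ((WithLp.toLp 2 : (Fin d → ℝ) → Rd d) ''
      (Set.Icc Q.corner (fun i => Q.corner i + Q.side))) :=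
    isCompact_Icc.image (PiLp.continuous_toLp 2 _)
  refine (hf.integrableOn_isCompact hK).mono_set fun x hx => ?_
  exact ⟨WithLp.ofLp x, ⟨fun i => (hx i).1, fun i => (hx i).2.le⟩, rfl⟩

lemma vol_eq_measureReal (Q : Cube d) : volume.real Q.carrier = Q.vol := by
  rw [Measure.real, volume_carrier, ENNReal.toReal_ofReal Q.vol_pos.le]

lemma vol_le_of_subset {Q R : Cube d} (h : Q.carrier ⊆ R.carrier) : Q.vol ≤ R.vol := by
  have := measure_mono (μ := volume) h
  rwa [volume_carrier, volume_carrier, ENNReal.ofReal_le_ofReal_iff R.vol_pos.le] at this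

lemma side_le_of_subset (hd : 0 < d) {Q R : Cube d} (h : Q.carrier ⊆ R.carrier) :
    Q.side ≤ R.side := by
  have := vol_le_of_subset h
  exact le_of_pow_le_pow_left₀ hd.ne' R.side_pos.le this

end Cube

namespace DyadicLattice

variable (D : DyadicLattice d)

lemma exists_ancestor {k : ℤ} (n : ℕ) {Q : Cube d} (hQ : Q ∈ D.layer k) :
    ∃ P ∈ D.layer (k - n), Q.carrier ⊆ P.carrier := by
  induction n with
  | zero => exact ⟨Q, by simpa using hQ, subset_rfl⟩
  | succ n ih =>
    obtain ⟨P, hP, hQP⟩ := ih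
    obtain ⟨R, hR, hPR⟩ := D.refines (k - (n + 1 : ℕ)) P (by
      have : k - ((n + 1 : ℕ) : ℤ) + 1 = k - n := by push_cast; ring
      rwa [this])
    exact ⟨R, hR, hQP.trans hPR⟩

lemma exists_ancestor_of_le {j k : ℤ} (h : j ≤ k) {Q : Cube d} (hQ : Q ∈ D.layer k) :
    ∃ P ∈ D.layer j, Q.carrier ⊆ P.carrier := by
  obtain ⟨n, hn⟩ := Int.le.dest h
  have := D.exists_ancestor n hQ
  rwa [show k - (n : ℤ) = j by omega] at this

lemma eq_of_mem_layer {k : ℤ} {Q R : Cube d} (hQ : Q ∈ D.layer k) (hR : R ∈ D.layer k)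
    {x : Rd d} (hxQ : x ∈ Q.carrier) (hxR : x ∈ R.carrier) : Q = R := by
  by_contra h
  have := D.pairwiseDisjoint k Q hQ R hR h
  exact (this ▸ (⟨hxQ, hxR⟩ : x ∈ Q.carrier ∩ R.carrier) : x ∈ (∅ : Set (Rd d)))

lemma subset_of_layer_le {j k : ℤ} (h : j ≤ k) {Q R : Cube d} (hQ : Q ∈ D.layer k)
    (hR : R ∈ D.layer j) {x : Rd d} (hxQ : x ∈ Q.carrier) (hxR : x ∈ R.carrier) :
    Q.carrier ⊆ R.carrier := by
  obtain ⟨P, hP, hQP⟩ := D.exists_ancestor_of_le h hQ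
  rwa [← D.eq_of_mem_layer hP hR (hQP hxQ) hxR]

variable {D}

lemma layer_of_side {k : ℤ} {Q : Cube d} (hQ : Q ∈ D.cubes) (hs : Q.side = (2 : ℝ) ^ (-k)) :
    Q ∈ D.layer k := by
  obtain ⟨j, hj⟩ := hQ
  have h := D.side_eq j Q hj
  rw [hs] at h
  have h2 := zpow_right_injective₀ (by norm_num : (0 : ℝ) < 2) (by norm_num) h
  have : j = k := by
    have : -k = -j := h2
    omega
  exact this ▸ hj

lemma subset_or_subset {Q R : Cube d} (hQ : Q ∈ D.cubes) (hR : R ∈ D.cubes)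
    {x : Rd d} (hxQ : x ∈ Q.carrier) (hxR : x ∈ R.carrier) :
    Q.carrier ⊆ R.carrier ∨ R.carrier ⊆ Q.carrier := by
  obtain ⟨k, hk⟩ := hQ
  obtain ⟨j, hj⟩ := hR
  rcases le_total j k with h | h
  · exact Or.inl (D.subset_of_layer_le h hk hj hxQ hxR)
  · exact Or.inr (D.subset_of_layer_le h hj hk hxR hxQ)

lemma eq_of_side_eq {Q R : Cube d} (hQ : Q ∈ D.cubes) (hR : R ∈ D.cubes) (h : Q.side = R.side)
    {x : Rd d} (hxQ : x ∈ Q.carrier) (hxR : x ∈ R.carrier) : Q = R := by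
  obtain ⟨k, hk⟩ := hR
  exact D.eq_of_mem_layer (layer_of_side hQ (h.trans (D.side_eq k R hk))) hk hxQ hxR

lemma eq_of_carrier_eq (hd : 0 < d) {Q R : Cube d} (hQ : Q ∈ D.cubes) (hR : R ∈ D.cubes)
    (h : Q.carrier = R.carrier) : Q = R := by
  obtain ⟨x, hx⟩ := Q.carrier_nonempty
  exact eq_of_side_eq hQ hR (le_antisymm (Cube.side_le_of_subset hd h.le)
    (Cube.side_le_of_subset hd h.ge)) hx (h ▸ hx)

variable (D) in
/-- The dyadic children of a cube, as a set. -/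
def childSet (Q : Cube d) : Set (Cube d) :=
  {R | R ∈ D.cubes ∧ R.side = Q.side / 2 ∧ R.carrier ⊆ Q.carrier}

lemma childSet_disjoint (Q : Cube d) {R R' : Cube d} (hR : R ∈ D.childSet Q)
    (hR' : R' ∈ D.childSet Q) (h : R ≠ R') : Disjoint R.carrier R'.carrier := by
  rw [Set.disjoint_left]
  intro x hx hx'
  exact h (eq_of_side_eq hR.1 hR'.1 (hR.2.1.trans hR'.2.1.symm) hx hx')

lemma childSet_vol {Q R : Cube d} (hR : R ∈ D.childSet Q) : Q.vol = 2 ^ d * R.vol := by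
  rw [Cube.vol, Cube.vol, hR.2.1, ← mul_pow]
  congr 1; ring

lemma childSet_finite (Q : Cube d) : (D.childSet Q).Finite := by
  have h := Measure.finite_const_le_meas_of_disjoint_iUnion (μ := (volume : Measure (Rd d)))
    (ε := ENNReal.ofReal (Q.vol / 2 ^ d)) (As := fun R : D.childSet Q => (R : Cube d).carrier)
    (by have := Q.vol_pos; simp; positivity) (fun R => (R : Cube d).measurableSet_carrier)
    (fun R R' h => childSet_disjoint Q R.2 R'.2 (fun h' => h (Subtype.ext h')))
    (by
      refine ((measure_mono (t := Q.carrier) (Set.iUnion_subset fun R => R.2.2.2)).trans_lt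
        ?_).ne
      rw [Cube.volume_carrier]; exact ENNReal.ofReal_lt_top)
  have h2 : (Set.univ : Set (D.childSet Q)).Finite := by
    refine h.subset fun R _ => ?_
    simp only [Set.mem_ofPred_eq, Cube.volume_carrier]
    apply ENNReal.ofReal_le_ofReal
    rw [childSet_vol R.2]; field_simp; rfl
  exact Set.finite_coe_iff.mp (Set.finite_univ_iff.mp h2)

variable (D) in
/-- The dyadic children of a cube. -/
def ch (Q : Cube d) : Finset (Cube d) := (D.childSet_finite Q).toFinset

lemma mem_ch {Q R : Cube d} :
    R ∈ D.ch Q ↔ R ∈ D.cubes ∧ R.side = Q.side / 2 ∧ R.carrier ⊆ Q.carrier := by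
  rw [ch, Set.Finite.mem_toFinset]; rfl

lemma ch_disjoint (Q : Cube d) {R R' : Cube d} (hR : R ∈ D.ch Q)
    (hR' : R' ∈ D.ch Q) (h : R ≠ R') : Disjoint R.carrier R'.carrier :=
  childSet_disjoint Q (mem_ch.mp hR) (mem_ch.mp hR') h

lemma ch_vol {Q R : Cube d} (hR : R ∈ D.ch Q) : Q.vol = 2 ^ d * R.vol :=
  childSet_vol (mem_ch.mp hR)

lemma ch_layer {k : ℤ} {Q R : Cube d} (hQ : Q ∈ D.layer k) (hR : R ∈ D.ch Q) :
    R ∈ D.layer (k + 1) := by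
  refine layer_of_side (mem_ch.mp hR).1 ?_
  rw [(mem_ch.mp hR).2.1, D.side_eq k Q hQ, neg_add, zpow_add₀ (by norm_num)]
  norm_num [div_eq_mul_inv]

lemma exists_ch_mem {Q : Cube d} (hQ : Q ∈ D.cubes) {x : Rd d} (hx : x ∈ Q.carrier) :
    ∃ R ∈ D.ch Q, x ∈ R.carrier := by
  obtain ⟨k, hk⟩ := hQ
  obtain ⟨R, hR, hxR⟩ := D.covers (k + 1) x
  refine ⟨R, mem_ch.mpr ⟨⟨_, hR⟩, ?_, D.subset_of_layer_le (by omega) hR hk hxR hx⟩, hxR⟩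
  rw [D.side_eq _ R hR, D.side_eq k Q hk, neg_add, zpow_add₀ (by norm_num)]
  norm_num [div_eq_mul_inv]

lemma carrier_eq_biUnion_ch {Q : Cube d} (hQ : Q ∈ D.cubes) :
    Q.carrier = ⋃ R ∈ D.ch Q, R.carrier := by
  ext x
  simp only [Set.mem_iUnion, exists_prop]
  exact ⟨fun hx => exists_ch_mem hQ hx, fun ⟨R, hR, hx⟩ => (mem_ch.mp hR).2.2 hx⟩

lemma intC_eq_sum_ch {Q : Cube d} (hQ : Q ∈ D.cubes) {f : Rd d → ℝ}
    (hf : IntegrableOn f Q.carrier volume) : intC Q f = ∑ R ∈ D.ch Q, intC R f := by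
  rw [intC, carrier_eq_biUnion_ch hQ, integral_biUnion_finset]
  · rfl
  · exact fun R _ => R.measurableSet_carrier
  · exact fun R hR R' hR' h => ch_disjoint Q hR hR' h
  · exact fun R hR => hf.mono_set (mem_ch.mp hR).2.2

lemma vol_eq_sum_ch {Q : Cube d} (hQ : Q ∈ D.cubes) : Q.vol = ∑ R ∈ D.ch Q, R.vol := by
  have h := intC_eq_sum_ch hQ (f := fun _ => (1 : ℝ))
    (by simp [Cube.volume_carrier])
  simpa [intC, Cube.vol_eq_measureReal] using h

lemma DQ_eq_of_mem {Q R : Cube d} (hR : R ∈ D.ch Q) (b : Rd d → ℝ) {x : Rd d}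
    (hx : x ∈ R.carrier) : D.DQ Q b x = avg R b - avg Q b := by
  have hR' := mem_ch.mp hR
  have h : x ∈ Q.carrier ∧ ∃ R, R ∈ D.cubes ∧ R.side = Q.side / 2 ∧ x ∈ R.carrier ∧
      R.carrier ⊆ Q.carrier := ⟨hR'.2.2 hx, R, hR'.1, hR'.2.1, hx, hR'.2.2⟩
  rw [DQ, dif_pos h]
  have hs := h.2.choose_spec
  rw [eq_of_side_eq hs.1 hR'.1 (hs.2.1.trans hR'.2.1.symm) hs.2.2.1 hx]

lemma DQ_eq_zero {Q : Cube d} (b : Rd d → ℝ) {x : Rd d} (hx : x ∉ Q.carrier) :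
    D.DQ Q b x = 0 := by
  rw [DQ, dif_neg]; exact fun h => hx h.1

lemma DQ_eq_sum {Q : Cube d} (hQ : Q ∈ D.cubes) (b : Rd d → ℝ) :
    D.DQ Q b = fun x => ∑ R ∈ D.ch Q, R.carrier.indicator (fun _ => avg R b - avg Q b) x := by
  funext x
  by_cases hx : x ∈ Q.carrier
  · obtain ⟨R, hR, hxR⟩ := exists_ch_mem hQ hx
    rw [DQ_eq_of_mem hR b hxR, Finset.sum_eq_single R]
    · simp [hxR]
    · intro R' hR' hne
      refine Set.indicator_of_notMem (fun h => ?_) _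
      exact Set.disjoint_left.mp (ch_disjoint Q hR' hR hne) h hxR
    · exact fun h => absurd hR h
  · rw [DQ_eq_zero b hx, Finset.sum_eq_zero]
    intro R hR
    exact Set.indicator_of_notMem (fun h => hx ((mem_ch.mp hR).2.2 h)) _

lemma measurable_DQ {Q : Cube d} (hQ : Q ∈ D.cubes) (b : Rd d → ℝ) : Measurable (D.DQ Q b) := by
  rw [DQ_eq_sum hQ]
  exact Finset.measurable_sum _ fun R _ => measurable_const.indicator R.measurableSet_carrier

/-- Integrating a martingale difference against a function. -/
lemma integral_DQ_mul {Q : Cube d} (hQ : Q ∈ D.cubes) (b : Rd d → ℝ) {h : Rd d → ℝ}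
    (hh : IntegrableOn h Q.carrier volume) :
    ∫ x, D.DQ Q b x * h x = ∑ R ∈ D.ch Q, (avg R b - avg Q b) * intC R h := by
  simp only [DQ_eq_sum hQ, Finset.sum_mul]
  have e : ∀ (R : Cube d) (x : Rd d), R.carrier.indicator (fun _ => avg R b - avg Q b) x * h x
      = R.carrier.indicator (fun x => (avg R b - avg Q b) * h x) x := by
    intro R x; by_cases hx : x ∈ R.carrier <;> simp [hx]
  simp only [e]
  rw [integral_finsetSum]
  · refine Finset.sum_congr rfl fun R hR => ?_
    rw [integral_indicator R.measurableSet_carrier, integral_const_mul]; rfl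
  · intro R hR
    rw [integrable_indicator_iff R.measurableSet_carrier]
    exact (hh.mono_set (mem_ch.mp hR).2.2).const_mul _

end DyadicLattice

lemma avg_nonneg (Q : Cube d) {u : Rd d → ℝ} (hu : ∀ x, 0 ≤ u x) : 0 ≤ avg Q u :=
  mul_nonneg (inv_nonneg.mpr Q.vol_pos.le) (integral_nonneg hu)

lemma vol_mul_avg (Q : Cube d) (u : Rd d → ℝ) : Q.vol * avg Q u = intC Q u := by
  rw [avg, mul_inv_cancel_left₀ Q.vol_pos.ne']

lemma abs_avg_le (Q : Cube d) (u : Rd d → ℝ) : |avg Q u| ≤ avg Q fun x => |u x| := by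
  rw [avg, avg, abs_mul, abs_of_nonneg (inv_nonneg.mpr Q.vol_pos.le)]
  exact mul_le_mul_of_nonneg_left abs_integral_le_integral_abs (inv_nonneg.mpr Q.vol_pos.le)

lemma avg_sub_const (Q : Cube d) {u : Rd d → ℝ} (hu : IntegrableOn u Q.carrier volume) (c : ℝ) :
    avg Q (fun x => u x - c) = avg Q u - c := by
  have h : IntegrableOn (fun _ : Rd d => c) Q.carrier volume := by
    simp [Cube.volume_carrier]
  have hv := Q.vol_pos.ne'
  rw [avg, avg, intC, integral_sub hu h]
  simp only [setIntegral_const, Cube.vol_eq_measureReal, smul_eq_mul, intC]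
  field_simp

lemma avg_mul_vol_abs_sub (Q : Cube d) (b : Rd d → ℝ) :
    (avg Q fun x => |b x - avg Q b|) * Q.vol = osc Q b := by
  rw [mul_comm, vol_mul_avg]; rfl

/-- One step of the energy increment for martingale differences. -/
lemma energy_step {ι : Type*} (s : Finset ι) (v x y : ι → ℝ) (V X Y σ τ : ℝ)
    (hv : ∀ i ∈ s, 0 ≤ v i) (hV : ∑ i ∈ s, v i = V) (hX : ∑ i ∈ s, v i * x i = V * X)
    (hY : ∑ i ∈ s, v i * y i = V * Y)
    (hxy : ∀ i ∈ s, |(x i - X) * (y i - Y)| ≤ (σ * (x i - X) ^ 2 + τ * (y i - Y) ^ 2) / 2) :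
    |∑ i ∈ s, (x i - X) * (v i * y i)| + V * ((σ * X ^ 2 + τ * Y ^ 2) / 2) ≤
      ∑ i ∈ s, v i * ((σ * x i ^ 2 + τ * y i ^ 2) / 2) := by
  have e1 : ∑ i ∈ s, (x i - X) * (v i * y i) = ∑ i ∈ s, v i * ((x i - X) * (y i - Y)) := by
    have : ∀ i, v i * ((x i - X) * (y i - Y)) =
        (x i - X) * (v i * y i) - Y * (v i * x i) + X * Y * v i := fun i => by ring
    simp only [this, Finset.sum_add_distrib, Finset.sum_sub_distrib, ← Finset.mul_sum, hX, hV]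
    ring
  have e2 : ∑ i ∈ s, v i * ((σ * (x i - X) ^ 2 + τ * (y i - Y) ^ 2) / 2) =
      ∑ i ∈ s, v i * ((σ * x i ^ 2 + τ * y i ^ 2) / 2) - V * ((σ * X ^ 2 + τ * Y ^ 2) / 2) := by
    have : ∀ i, v i * ((σ * (x i - X) ^ 2 + τ * (y i - Y) ^ 2) / 2) =
        v i * ((σ * x i ^ 2 + τ * y i ^ 2) / 2) - σ * X * (v i * x i) - τ * Y * (v i * y i)
          + (σ * X ^ 2 + τ * Y ^ 2) / 2 * v i := fun i => by ring
    simp only [this, Finset.sum_add_distrib, Finset.sum_sub_distrib, ← Finset.mul_sum, hX, hV, hY]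
    ring
  have e3 : |∑ i ∈ s, v i * ((x i - X) * (y i - Y))| ≤
      ∑ i ∈ s, v i * ((σ * (x i - X) ^ 2 + τ * (y i - Y) ^ 2) / 2) := by
    refine (Finset.abs_sum_le_sum_abs _ _).trans (Finset.sum_le_sum fun i hi => ?_)
    rw [abs_mul, abs_of_nonneg (hv i hi)]
    exact mul_le_mul_of_nonneg_left (hxy i hi) (hv i hi)
  rw [e1]; linarith

lemma abs_mul_le_weighted {β η M x y : ℝ} (hβ : 0 ≤ β) (hη : 0 ≤ η)
    (hx : |x| ≤ M * β) (hy : |y| ≤ M * η) :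
    |x * y| ≤ (η / β * x ^ 2 + β / η * y ^ 2) / 2 := by
  rcases hβ.eq_or_lt with rfl | hβ
  · have : x = 0 := abs_nonpos_iff.mp (by simpa using hx)
    simp [this]
  rcases hη.eq_or_lt with rfl | hη
  · have : y = 0 := abs_nonpos_iff.mp (by simpa using hy)
    simp [this]
  have h1 : (η / β * x ^ 2 + β / η * y ^ 2) = ((η * |x|) ^ 2 + (β * |y|) ^ 2) / (β * η) := by
    rw [mul_pow, mul_pow, sq_abs, sq_abs]; field_simp
  rw [h1, abs_mul, div_div, le_div_iff₀ (by positivity)]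
  nlinarith [sq_nonneg (η * |x| - β * |y|)]

lemma weighted_sq_le {β η M x y : ℝ} (hβ : 0 ≤ β) (hη : 0 ≤ η)
    (hx : |x| ≤ M * β) (hy : |y| ≤ M * η) :
    (η / β * x ^ 2 + β / η * y ^ 2) / 2 ≤ M ^ 2 * (β * η) := by
  have hx2 : x ^ 2 ≤ (M * β) ^ 2 := sq_le_sq' (by linarith [neg_abs_le x]) ((le_abs_self x).trans hx)
  have hy2 : y ^ 2 ≤ (M * η) ^ 2 := sq_le_sq' (by linarith [neg_abs_le y]) ((le_abs_self y).trans hy)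
  have h1 : η / β * x ^ 2 ≤ M ^ 2 * (β * η) := by
    rcases hβ.eq_or_lt with rfl | hβ
    · simp
    calc η / β * x ^ 2 ≤ η / β * (M * β) ^ 2 := by gcongr
      _ = M ^ 2 * (β * η) := by field_simp
  have h2 : β / η * y ^ 2 ≤ M ^ 2 * (β * η) := by
    rcases hη.eq_or_lt with rfl | hη
    · simp
    calc β / η * y ^ 2 ≤ β / η * (M * η) ^ 2 := by gcongr
      _ = M ^ 2 * (β * η) := by field_simp
  linarith

namespace DyadicLattice

variable {D : DyadicLattice d}

open Classical in
variable (D) in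
/-- The descendants of a cube through fewer than `n` generations. -/
def desc : ℕ → Cube d → Finset (Cube d)
  | 0, _ => ∅
  | n + 1, Q => insert Q ((D.ch Q).biUnion (desc n))

lemma desc_subset (n : ℕ) : ∀ {Q R : Cube d}, R ∈ D.desc n Q → R.carrier ⊆ Q.carrier := by
  induction n with
  | zero => intro Q R h; simp [desc] at h
  | succ n ih =>
    intro Q R h
    simp only [desc, Finset.mem_insert, Finset.mem_biUnion] at h
    rcases h with rfl | ⟨P, hP, hR⟩
    · exact subset_rfl
    · exact (ih hR).trans (mem_ch.mp hP).2.2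

lemma not_subset_ch (hd : 0 < d) {Q R : Cube d} (hR : R ∈ D.ch Q) :
    ¬ Q.carrier ⊆ R.carrier := by
  intro h
  have := Cube.side_le_of_subset hd h
  rw [(mem_ch.mp hR).2.1] at this
  linarith [Q.side_pos]

lemma disjoint_of_forall_subset {Q R R' : Cube d} (hR : R ∈ D.ch Q) (hR' : R' ∈ D.ch Q)
    (h : R ≠ R') {s t : Finset (Cube d)} (hs : ∀ T ∈ s, T.carrier ⊆ R.carrier)
    (ht : ∀ T ∈ t, T.carrier ⊆ R'.carrier) : Disjoint s t := by
  rw [Finset.disjoint_left]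
  intro T hT hT'
  obtain ⟨x, hx⟩ := T.carrier_nonempty
  exact Set.disjoint_left.mp (ch_disjoint Q hR hR' h) (hs T hT hx) (ht T hT' hx)

lemma sum_desc_succ (hd : 0 < d) (g : Cube d → ℝ) (n : ℕ) (Q : Cube d) :
    ∑ T ∈ D.desc (n + 1) Q, g T = g Q + ∑ R ∈ D.ch Q, ∑ T ∈ D.desc n R, g T := by
  classical
  rw [desc]
  rw [Finset.sum_insert, Finset.sum_biUnion]
  · intro R hR R' hR' h
    exact disjoint_of_forall_subset hR hR' h (fun T hT => desc_subset n hT)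
      (fun T hT => desc_subset n hT)
  · intro h
    obtain ⟨R, hR, hQ⟩ := Finset.mem_biUnion.mp h
    exact not_subset_ch hd hR (desc_subset n hQ)

lemma mem_desc (n : ℕ) : ∀ {Q R : Cube d} {k : ℤ} {m : ℕ}, Q ∈ D.layer k →
    R ∈ D.layer (k + m) → R.carrier ⊆ Q.carrier → m < n → R ∈ D.desc n Q := by
  induction n with
  | zero => intro Q R k m _ _ _ h; omega
  | succ n ih =>
    intro Q R k m hQ hR hRQ hm
    simp only [desc, Finset.mem_insert, Finset.mem_biUnion]
    obtain ⟨x, hx⟩ := R.carrier_nonempty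
    cases m with
    | zero => exact Or.inl (D.eq_of_mem_layer (by simpa using hR) hQ hx (hRQ hx))
    | succ m =>
      obtain ⟨P, hP, hxP⟩ := exists_ch_mem ⟨k, hQ⟩ (hRQ hx)
      have hPl := ch_layer hQ hP
      refine Or.inr ⟨P, hP, ih (m := m) hPl (by convert hR using 2; push_cast; ring)
        (D.subset_of_layer_le (by push_cast; omega) hR hPl hx hxP) (by omega)⟩

end DyadicLattice

/-- The stopping condition of the sparse domination argument. -/
def StopCond (b f h : Rd d → ℝ) (S R : Cube d) : Prop :=
  (6 * avg S (fun x => |f x|) < avg R fun x => |f x|) ∨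
  (6 * avg S (fun x => |h x|) < avg R fun x => |h x|) ∨
  (6 * avg S (fun x => |b x - avg S b|) < avg R fun x => |b x - avg S b|)

lemma not_stopCond_self (b f h : Rd d → ℝ) (S : Cube d) : ¬ StopCond b f h S S := by
  have h1 := avg_nonneg S (u := fun x => |f x|) fun x => abs_nonneg _
  have h2 := avg_nonneg S (u := fun x => |h x|) fun x => abs_nonneg _
  have h3 := avg_nonneg S (u := fun x => |b x - avg S b|) fun x => abs_nonneg _
  rintro (h | h | h) <;> linarith

/-- The stopping cubes in a family of cubes are covered by cubes at which the averages jump. -/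
def StopCovered (D : DyadicLattice d) (b f h : Rd d → ℝ) (G : Finset (Cube d)) : Prop :=
  ∀ T ∈ G, ∀ R ∈ G, R.carrier ⊆ T.carrier → R ≠ T →
    ∃ R' ∈ D.cubes, R.carrier ⊆ R'.carrier ∧ R'.carrier ⊆ T.carrier ∧ StopCond b f h T R'

namespace DyadicLattice

variable {D : DyadicLattice d}

lemma avg_ch_le {Q R : Cube d} (hR : R ∈ D.ch Q) {u : Rd d → ℝ} (hu : ∀ x, 0 ≤ u x)
    (hui : IntegrableOn u Q.carrier volume) : avg R u ≤ 2 ^ d * avg Q u := by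
  rw [avg, avg, ch_vol hR]
  have h1 : intC R u ≤ intC Q u :=
    setIntegral_mono_set hui (ae_of_all _ hu) (mem_ch.mp hR).2.2.eventuallyLE
  have hv := R.vol_pos
  calc R.vol⁻¹ * intC R u ≤ R.vol⁻¹ * intC Q u := by gcongr
    _ = 2 ^ d * ((2 ^ d * R.vol)⁻¹ * intC Q u) := by field_simp

end DyadicLattice

/-- The quantity `|⟨f⟩_Q| |∫ D_Q b h|`. -/
def paraTerm (D : DyadicLattice d) (b f h : Rd d → ℝ) (Q : Cube d) : ℝ :=
  |avg Q f| * |∑ R ∈ D.ch Q, (avg R b - avg Q b) * intC R h|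

/-- The quantity `⟨|f|⟩_Q ⟨|h|⟩_Q ∫_Q |b - ⟨b⟩_Q|`. -/
def sparseTerm (b f h : Rd d → ℝ) (Q : Cube d) : ℝ :=
  (avg Q fun x => |f x|) * (avg Q fun x => |h x|) * osc Q b

lemma sparseTerm_nonneg (b f h : Rd d → ℝ) (Q : Cube d) : 0 ≤ sparseTerm b f h Q :=
  mul_nonneg (mul_nonneg (avg_nonneg Q fun _ => abs_nonneg _) (avg_nonneg Q fun _ => abs_nonneg _))
    (integral_nonneg fun _ => abs_nonneg _)

/-- The energy of `b` and `h` on `Q` relative to the stopping cube `S`. -/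
def energy (b h : Rd d → ℝ) (S Q : Cube d) : ℝ :=
  Q.vol * (((avg S fun x => |h x|) / (avg S fun x => |b x - avg S b|) * (avg Q b - avg S b) ^ 2 +
    (avg S fun x => |b x - avg S b|) / (avg S fun x => |h x|) * (avg Q h) ^ 2) / 2)

section

variable {D : DyadicLattice d} {b f h : Rd d → ℝ}

lemma abs_avg_sub_le {Q : Cube d} (hb : IntegrableOn b Q.carrier volume) (c : ℝ) :
    |avg Q b - c| ≤ avg Q fun x => |b x - c| := by
  rw [← avg_sub_const Q hb]; exact abs_avg_le Q _

lemma energy_le {M : ℝ} {S Q : Cube d}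
    (h1 : |avg Q b - avg S b| ≤ M * avg S (fun x => |b x - avg S b|))
    (h2 : |avg Q h| ≤ M * avg S (fun x => |h x|)) :
    energy b h S Q ≤ M ^ 2 * (avg S (fun x => |b x - avg S b|) * avg S (fun x => |h x|)) * Q.vol := by
  rw [energy, mul_comm]
  exact mul_le_mul_of_nonneg_right (weighted_sq_le (avg_nonneg S fun x => abs_nonneg _)
    (avg_nonneg S fun x => abs_nonneg _) h1 h2) Q.vol_pos.le

lemma energy_nonneg (b h : Rd d → ℝ) (S Q : Cube d) : 0 ≤ energy b h S Q := by
  have h1 := avg_nonneg S (u := fun x => |h x|) fun _ => abs_nonneg _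
  have h2 := avg_nonneg S (u := fun x => |b x - avg S b|) fun _ => abs_nonneg _
  have h3 := Q.vol_pos
  unfold energy
  positivity

lemma child_bounds (hb : ∀ Q : Cube d, IntegrableOn b Q.carrier volume)
    (hh : ∀ Q : Cube d, IntegrableOn h Q.carrier volume)
    {S Q R : Cube d} (hg : ¬ StopCond b f h S Q) (hR : R ∈ D.ch Q) :
    |avg R b - avg S b| ≤ 2 ^ d * 6 * avg S (fun x => |b x - avg S b|) ∧
      |avg R h| ≤ 2 ^ d * 6 * avg S (fun x => |h x|) := by
  simp only [StopCond, not_or, not_lt] at hg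
  have hi : IntegrableOn (fun x => |b x - avg S b|) Q.carrier volume :=
    ((hb Q).sub (by simp [Cube.volume_carrier] : IntegrableOn (fun _ => avg S b) Q.carrier volume)).abs
  constructor
  · calc _ ≤ _ := abs_avg_sub_le (hb R) _
      _ ≤ _ := D.avg_ch_le hR (fun x => abs_nonneg _) hi
      _ ≤ 2 ^ d * (6 * avg S (fun x => |b x - avg S b|)) := by gcongr; exact hg.2.2
      _ = _ := by ring
  · calc _ ≤ _ := abs_avg_le R _
      _ ≤ _ := D.avg_ch_le hR (fun x => abs_nonneg _) (hh Q).abs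
      _ ≤ 2 ^ d * (6 * avg S (fun x => |h x|)) := by gcongr; exact hg.2.1
      _ = _ := by ring

lemma energy_increment (hb : ∀ Q : Cube d, IntegrableOn b Q.carrier volume)
    (hh : ∀ Q : Cube d, IntegrableOn h Q.carrier volume)
    {S Q : Cube d} (hQ : Q ∈ D.cubes) (hg : ¬ StopCond b f h S Q) :
    |∑ R ∈ D.ch Q, (avg R b - avg Q b) * intC R h| + energy b h S Q ≤
      ∑ R ∈ D.ch Q, energy b h S R := by
  have hvb : ∑ R ∈ D.ch Q, R.vol * avg R b = Q.vol * avg Q b := by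
    simp only [vol_mul_avg]; exact (D.intC_eq_sum_ch hQ (hb Q)).symm
  have hvh : ∑ R ∈ D.ch Q, R.vol * avg R h = Q.vol * avg Q h := by
    simp only [vol_mul_avg]; exact (D.intC_eq_sum_ch hQ (hh Q)).symm
  have hv := (D.vol_eq_sum_ch hQ).symm
  have hβ := avg_nonneg S (u := fun x => |b x - avg S b|) fun x => abs_nonneg _
  have hη := avg_nonneg S (u := fun x => |h x|) fun x => abs_nonneg _
  have key := energy_step (D.ch Q) Cube.vol (fun R => avg R b - avg S b) (fun R => avg R h)
    Q.vol (avg Q b - avg S b) (avg Q h)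
    ((avg S fun x => |h x|) / (avg S fun x => |b x - avg S b|))
    ((avg S fun x => |b x - avg S b|) / (avg S fun x => |h x|))
    (fun R _ => R.vol_pos.le) hv
    (by simp only [mul_sub, Finset.sum_sub_distrib, hvb, ← Finset.sum_mul, hv]) hvh
    (fun R hR => by
      have hc := child_bounds hb hh hg hR
      simp only [StopCond, not_or, not_lt] at hg
      have h1 : |avg Q b - avg S b| ≤ 6 * avg S (fun x => |b x - avg S b|) :=
        (abs_avg_sub_le (hb Q) _).trans hg.2.2
      have h2 : |avg Q h| ≤ 6 * avg S (fun x => |h x|) := (abs_avg_le Q _).trans hg.2.1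
      refine abs_mul_le_weighted (M := 2 ^ d * 6 + 6) hβ hη ?_ ?_
      · exact (abs_sub _ _).trans (by linarith [hc.1])
      · exact (abs_sub _ _).trans (by linarith [hc.2]))
  simp only [sub_sub_sub_cancel_right, vol_mul_avg] at key
  exact key

open Classical in
/-- Sparse domination of the localized paraproduct form. -/
lemma sparse_domination_aux (hd : 0 < d)
    (hb : ∀ Q : Cube d, IntegrableOn b Q.carrier volume)
    (hh : ∀ Q : Cube d, IntegrableOn h Q.carrier volume) (n : ℕ) :
    ∀ S Q : Cube d, S ∈ D.cubes → Q ∈ D.cubes → Q.carrier ⊆ S.carrier → ¬ StopCond b f h S Q →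
    ∃ G : Finset (Cube d), (∀ R ∈ G, R ∈ D.cubes ∧ ∃ R' ∈ D.cubes, R.carrier ⊆ R'.carrier ∧
        R'.carrier ⊆ Q.carrier ∧ StopCond b f h S R') ∧ StopCovered D b f h G ∧
      (∑ T ∈ D.desc n Q, paraTerm D b f h T) + 6 * avg S (fun x => |f x|) * energy b h S Q ≤
        6 * (2 ^ d * 6) ^ 2 * (avg S (fun x => |f x|) * (avg S (fun x => |b x - avg S b|) *
          avg S (fun x => |h x|)) * Q.vol + ∑ T ∈ G, sparseTerm b f h T) := by
  induction n with
  | zero =>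
    intro S Q _ _ _ hg
    refine ⟨∅, by simp, by simp [StopCovered], ?_⟩
    simp only [StopCond, not_or, not_lt] at hg
    have hβ := avg_nonneg S (u := fun x => |b x - avg S b|) fun x => abs_nonneg _
    have hη := avg_nonneg S (u := fun x => |h x|) fun x => abs_nonneg _
    have hφ := avg_nonneg S (u := fun x => |f x|) fun x => abs_nonneg _
    have h2 : (1 : ℝ) ≤ 2 ^ d := one_le_pow₀ (by norm_num)
    have := energy_le (M := 2 ^ d * 6) (S := S) (Q := Q)
      ((abs_avg_sub_le (hb Q) _).trans (hg.2.2.trans (by nlinarith)))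
      ((abs_avg_le Q h).trans (hg.2.1.trans (by nlinarith)))
    simp only [DyadicLattice.desc, Finset.sum_empty]
    have := mul_le_mul_of_nonneg_left this (mul_nonneg (by norm_num : (0 : ℝ) ≤ 6) hφ)
    linarith
  | succ n ih =>
    intro S Q hS hQ hQS hg
    have hR : ∀ R ∈ D.ch Q, ∃ G : Finset (Cube d),
        (∀ T ∈ G, T ∈ D.cubes ∧ T.carrier ⊆ R.carrier ∧ ∃ R' ∈ D.cubes,
          T.carrier ⊆ R'.carrier ∧ R'.carrier ⊆ Q.carrier ∧ StopCond b f h S R') ∧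
        StopCovered D b f h G ∧
        (∑ T ∈ D.desc n R, paraTerm D b f h T) + 6 * avg S (fun x => |f x|) * energy b h S R ≤
        6 * (2 ^ d * 6) ^ 2 * (avg S (fun x => |f x|) * (avg S (fun x => |b x - avg S b|) *
          avg S (fun x => |h x|)) * R.vol + ∑ T ∈ G, sparseTerm b f h T) := by
      intro R hR
      have hRm := DyadicLattice.mem_ch.mp hR
      by_cases hst : StopCond b f h S R
      · obtain ⟨G, hG1, hG2, hG3⟩ := ih R R hRm.1 hRm.1 subset_rfl (not_stopCond_self b f h R)
        have hRG : R ∉ G := by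
          intro hmem
          obtain ⟨-, R', hR', hRR', hR'R, hst'⟩ := hG1 R hmem
          rw [D.eq_of_carrier_eq hd hR' hRm.1 (hR'R.antisymm hRR')] at hst'
          exact not_stopCond_self b f h R hst'
        refine ⟨insert R G, ?_, ?_, ?_⟩
        · intro T hT
          rcases Finset.mem_insert.mp hT with rfl | hT
          · exact ⟨hRm.1, subset_rfl, T, hRm.1, subset_rfl, hRm.2.2, hst⟩
          · obtain ⟨hT1, R', hR', hTR', hR'R, -⟩ := hG1 T hT
            exact ⟨hT1, hTR'.trans hR'R, R, hRm.1, hTR'.trans hR'R, hRm.2.2, hst⟩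
        · intro T hT R₁ hR₁ hsub hne
          obtain rfl | hT' := Finset.mem_insert.mp hT
          · rcases Finset.mem_insert.mp hR₁ with rfl | hR₁
            · exact absurd rfl hne
            · exact (hG1 R₁ hR₁).2
          · rcases Finset.mem_insert.mp hR₁ with hRR | hR₁
            · exfalso
              subst hRR
              obtain ⟨hT1, R', hR', hTR', hR'R, -⟩ := hG1 T hT'
              exact hne (D.eq_of_carrier_eq hd hRm.1 hT1 (hsub.antisymm (hTR'.trans hR'R)))
            · exact hG2 T hT' R₁ hR₁ hsub hne
        · rw [Finset.sum_insert hRG]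
          have hc := child_bounds hb hh hg hR
          have he := energy_le (S := S) (Q := R) hc.1 hc.2
          have hφ := avg_nonneg S (u := fun x => |f x|) fun x => abs_nonneg _
          have hφR := avg_nonneg R (u := fun x => |f x|) fun x => abs_nonneg _
          have he' := mul_le_mul_of_nonneg_left he (mul_nonneg (by norm_num : (0 : ℝ) ≤ 6) hφ)
          have hen := mul_nonneg (mul_nonneg (by norm_num : (0 : ℝ) ≤ 6) hφR)
            (energy_nonneg b h R R)
          have hsp : avg R (fun x => |f x|) * (avg R (fun x => |b x - avg R b|) *
              avg R (fun x => |h x|)) * R.vol = sparseTerm b f h R := by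
            rw [sparseTerm, ← avg_mul_vol_abs_sub]; ring
          rw [hsp] at hG3
          linarith
      · obtain ⟨G, hG1, hG2, hG3⟩ := ih S R hS hRm.1 (hRm.2.2.trans hQS) hst
        refine ⟨G, fun T hT => ?_, hG2, hG3⟩
        obtain ⟨hT1, R', hR', hTR', hR'R, hst'⟩ := hG1 T hT
        exact ⟨hT1, hTR'.trans hR'R, R', hR', hTR', hR'R.trans hRm.2.2, hst'⟩
    choose! G hG1 hG2 hG3 using hR
    refine ⟨(D.ch Q).biUnion G, ?_, ?_, ?_⟩
    · intro T hT
      obtain ⟨R, hR, hTR⟩ := Finset.mem_biUnion.mp hT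
      exact ⟨(hG1 R hR T hTR).1, (hG1 R hR T hTR).2.2⟩
    · intro T hT R₁ hR₁ hsub hne
      obtain ⟨R, hR, hTR⟩ := Finset.mem_biUnion.mp hT
      obtain ⟨R', hR', hR₁R'⟩ := Finset.mem_biUnion.mp hR₁
      have : R = R' := by
        by_contra hRR'
        obtain ⟨x, hx⟩ := R₁.carrier_nonempty
        exact Set.disjoint_left.mp (D.ch_disjoint Q hR hR' hRR')
          ((hG1 R hR T hTR).2.1 (hsub hx)) ((hG1 R' hR' R₁ hR₁R').2.1 hx)
      subst this
      exact hG2 R hR T hTR R₁ hR₁R' hsub hne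
    · rw [D.sum_desc_succ hd, Finset.sum_biUnion]
      swap
      · intro R hR R' hR' hne
        exact D.disjoint_of_forall_subset hR hR' hne (fun T hT => (hG1 R hR T hT).2.1)
          (fun T hT => (hG1 R' hR' T hT).2.1)
      have hφ := avg_nonneg S (u := fun x => |f x|) fun x => abs_nonneg _
      have hgf : |avg Q f| ≤ 6 * avg S (fun x => |f x|) := by
        simp only [StopCond, not_or, not_lt] at hg
        exact (abs_avg_le Q f).trans hg.1
      have hinc := energy_increment hb hh hQ hg
      have ht : paraTerm D b f h Q + 6 * avg S (fun x => |f x|) * energy b h S Q ≤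
          ∑ R ∈ D.ch Q, 6 * avg S (fun x => |f x|) * energy b h S R := by
        rw [← Finset.mul_sum]
        calc _ ≤ 6 * avg S (fun x => |f x|) *
              |∑ R ∈ D.ch Q, (avg R b - avg Q b) * intC R h| +
              6 * avg S (fun x => |f x|) * energy b h S Q := by
              unfold paraTerm; gcongr
          _ ≤ _ := by rw [← mul_add]; gcongr
      have hsum := Finset.sum_le_sum hG3
      rw [Finset.sum_add_distrib] at hsum
      simp only [← Finset.mul_sum, Finset.sum_add_distrib] at hsum ht ⊢
      rw [← D.vol_eq_sum_ch hQ] at hsum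
      linarith

open Classical in
lemma sparse_domination_top (hd : 0 < d)
    (hb : ∀ Q : Cube d, IntegrableOn b Q.carrier volume)
    (hh : ∀ Q : Cube d, IntegrableOn h Q.carrier volume) (n : ℕ) {Q : Cube d} (hQ : Q ∈ D.cubes) :
    ∃ G : Finset (Cube d), (∀ R ∈ G, R ∈ D.cubes ∧ R.carrier ⊆ Q.carrier) ∧
      StopCovered D b f h G ∧
      ∑ T ∈ D.desc n Q, paraTerm D b f h T ≤
        6 * (2 ^ d * 6) ^ 2 * ∑ T ∈ G, sparseTerm b f h T := by
  obtain ⟨G, hG1, hG2, hG3⟩ := sparse_domination_aux (f := f) hd hb hh n Q Q hQ hQ subset_rfl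
    (not_stopCond_self b f h Q)
  have hQG : Q ∉ G := by
    intro hmem
    obtain ⟨-, R', hR', hRR', hR'R, hst'⟩ := hG1 Q hmem
    rw [D.eq_of_carrier_eq hd hR' hQ (hR'R.antisymm hRR')] at hst'
    exact not_stopCond_self b f h Q hst'
  refine ⟨insert Q G, ?_, ?_, ?_⟩
  · intro T hT
    obtain rfl | hT := Finset.mem_insert.mp hT
    · exact ⟨hQ, subset_rfl⟩
    · obtain ⟨hT1, R', hR', hTR', hR'R, -⟩ := hG1 T hT
      exact ⟨hT1, hTR'.trans hR'R⟩
  · intro T hT R₁ hR₁ hsub hne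
    obtain rfl | hT' := Finset.mem_insert.mp hT
    · rcases Finset.mem_insert.mp hR₁ with rfl | hR₁
      · exact absurd rfl hne
      · exact (hG1 R₁ hR₁).2
    · rcases Finset.mem_insert.mp hR₁ with hRR | hR₁
      · exfalso
        subst hRR
        obtain ⟨hT1, R', hR', hTR', hR'R, -⟩ := hG1 T hT'
        exact hne (D.eq_of_carrier_eq hd hQ hT1 (hsub.antisymm (hTR'.trans hR'R)))
      · exact hG2 T hT' R₁ hR₁ hsub hne
  · rw [Finset.sum_insert hQG]
    have hφ := avg_nonneg Q (u := fun x => |f x|) fun x => abs_nonneg _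
    have hen := mul_nonneg (mul_nonneg (by norm_num : (0 : ℝ) ≤ 6) hφ)
      (energy_nonneg b h Q Q)
    have hsp : avg Q (fun x => |f x|) * (avg Q (fun x => |b x - avg Q b|) *
        avg Q (fun x => |h x|)) * Q.vol = sparseTerm b f h Q := by
      rw [sparseTerm, ← avg_mul_vol_abs_sub]; ring
    rw [hsp] at hG3
    linarith

lemma paraTerm_nonneg (Q : Cube d) : 0 ≤ paraTerm D b f h Q :=
  mul_nonneg (abs_nonneg _) (abs_nonneg _)

open Classical in
/-- Sparse domination of the paraproduct form. -/
lemma sparse_domination (hd : 0 < d)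
    (hb : ∀ Q : Cube d, IntegrableOn b Q.carrier volume)
    (hh : ∀ Q : Cube d, IntegrableOn h Q.carrier volume) (F : Finset (Cube d))
    (hF : ∀ Q ∈ F, Q ∈ D.cubes) :
    ∃ G : Finset (Cube d), (∀ R ∈ G, R ∈ D.cubes) ∧ StopCovered D b f h G ∧
      ∑ T ∈ F, paraTerm D b f h T ≤ 6 * (2 ^ d * 6) ^ 2 * ∑ T ∈ G, sparseTerm b f h T := by
  choose! k hk using hF
  obtain ⟨k₀, hk₀⟩ : ∃ k₀, ∀ Q ∈ F, k₀ ≤ k Q := by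
    obtain ⟨m, hm⟩ := (F.image k).bddBelow
    exact ⟨m, fun Q hQ => hm (by simpa using ⟨Q, hQ, rfl⟩)⟩
  obtain ⟨k₁, hk₁⟩ : ∃ k₁, ∀ Q ∈ F, k Q ≤ k₁ := by
    obtain ⟨m, hm⟩ := (F.image k).bddAbove
    exact ⟨m, fun Q hQ => hm (by simpa using ⟨Q, hQ, rfl⟩)⟩
  have htop : ∀ Q ∈ F, ∃ P ∈ D.layer k₀, Q.carrier ⊆ P.carrier := fun Q hQ =>
    D.exists_ancestor_of_le (hk₀ Q hQ) (hk Q hQ)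
  choose! P hP hPQ using htop
  set n : ℕ := (k₁ - k₀).toNat + 1
  have hG : ∀ T ∈ F.image P, ∃ G : Finset (Cube d),
      (∀ R ∈ G, R ∈ D.cubes ∧ R.carrier ⊆ T.carrier) ∧ StopCovered D b f h G ∧
      ∑ S ∈ D.desc n T, paraTerm D b f h S ≤
        6 * (2 ^ d * 6) ^ 2 * ∑ S ∈ G, sparseTerm b f h S := by
    intro T hT
    obtain ⟨Q, hQ, rfl⟩ := Finset.mem_image.mp hT
    exact sparse_domination_top hd hb hh n ⟨k₀, hP Q hQ⟩
  have hlay : ∀ T ∈ F.image P, T ∈ D.layer k₀ := by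
    intro T hT
    obtain ⟨Q, hQ, rfl⟩ := Finset.mem_image.mp hT
    exact hP Q hQ
  choose! G hG1 hG2 hG3 using hG
  have key : ∀ T ∈ F.image P, ∀ T' ∈ F.image P, T ≠ T' → ∀ R R' : Cube d,
      R.carrier ⊆ T.carrier → R'.carrier ⊆ T'.carrier → ∀ x ∈ R.carrier, x ∉ R'.carrier := by
    intro T hT T' hT' hne R R' hR hR' x hx hx'
    exact hne (D.eq_of_mem_layer (hlay T hT) (hlay T' hT') (hR hx) (hR' hx'))
  refine ⟨(F.image P).biUnion G, ?_, ?_, ?_⟩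
  · intro R hR
    obtain ⟨T, hT, hRT⟩ := Finset.mem_biUnion.mp hR
    exact (hG1 T hT R hRT).1
  · intro R hR R₁ hR₁ hsub hne
    obtain ⟨T, hT, hRT⟩ := Finset.mem_biUnion.mp hR
    obtain ⟨T', hT', hRT'⟩ := Finset.mem_biUnion.mp hR₁
    obtain rfl : T = T' := by
      by_contra h
      obtain ⟨x, hx⟩ := R₁.carrier_nonempty
      exact key T hT T' hT' h R R₁ (hG1 T hT R hRT).2 (hG1 T' hT' R₁ hRT').2 x (hsub hx) hx
    exact hG2 T hT R hRT R₁ hRT' hsub hne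
  · rw [Finset.sum_biUnion]
    swap
    · intro T hT T' hT' hne
      rw [Function.onFun, Finset.disjoint_left]
      intro R hR hR'
      obtain ⟨x, hx⟩ := R.carrier_nonempty
      exact key T hT T' hT' hne R R (hG1 T hT R hR).2 (hG1 T' hT' R hR').2 x hx hx
    rw [Finset.mul_sum]
    refine le_trans ?_ (Finset.sum_le_sum hG3)
    rw [← Finset.sum_biUnion]
    swap
    · intro T hT T' hT' hne
      rw [Function.onFun, Finset.disjoint_left]
      intro R hR hR'
      obtain ⟨x, hx⟩ := R.carrier_nonempty
      exact key T hT T' hT' hne R R (D.desc_subset _ hR) (D.desc_subset _ hR') x hx hx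
    refine Finset.sum_le_sum_of_subset_of_nonneg ?_ fun _ _ _ => paraTerm_nonneg _
    intro Q hQ
    refine Finset.mem_biUnion.mpr ⟨P Q, Finset.mem_image_of_mem P hQ, ?_⟩
    refine D.mem_desc n (hP Q hQ) (m := (k Q - k₀).toNat) ?_ (hPQ Q hQ) ?_
    · have := hk₀ Q hQ
      have h2 : k₀ + ((k Q - k₀).toNat : ℤ) = k Q := by omega
      rw [h2]; exact hk Q hQ
    · have := hk₀ Q hQ; have := hk₁ Q hQ; omega

end

open Classical in
/-- Every finite family of dyadic cubes is covered by its maximal cubes. -/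
lemma exists_maximal_cubes (D : DyadicLattice d) (hd : 0 < d) (G : Finset (Cube d))
    (hG : ∀ R ∈ G, R ∈ D.cubes) :
    ∃ M ⊆ G, (∀ R ∈ M, ∀ R' ∈ M, R ≠ R' → Disjoint R.carrier R'.carrier) ∧
      ∀ R ∈ G, ∃ R' ∈ M, R.carrier ⊆ R'.carrier := by
  refine ⟨G.filter fun R => ∀ R' ∈ G, R.carrier ⊆ R'.carrier → R' = R,
    Finset.filter_subset _ _, ?_, ?_⟩
  · intro R hR R' hR' hne
    rw [Finset.mem_filter] at hR hR'
    rw [Set.disjoint_left]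
    intro x hx hx'
    rcases D.subset_or_subset (hG R hR.1) (hG R' hR'.1) hx hx' with h | h
    · exact hne (hR.2 R' hR'.1 h).symm
    · exact hne (hR'.2 R hR.1 h)
  · intro R hR
    obtain ⟨R', hR', hmax⟩ := Finset.exists_max_image (G.filter fun R' => R.carrier ⊆ R'.carrier)
      Cube.side ⟨R, by simp [hR]⟩
    rw [Finset.mem_filter] at hR'
    refine ⟨R', Finset.mem_filter.mpr ⟨hR'.1, fun S hS hsub => ?_⟩, hR'.2⟩
    have h1 := hmax S (Finset.mem_filter.mpr ⟨hS, hR'.2.trans hsub⟩)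
    have h2 := Cube.side_le_of_subset hd hsub
    obtain ⟨x, hx⟩ := R'.carrier_nonempty
    exact D.eq_of_side_eq (hG S hS) (hG R' hR'.1) (le_antisymm h1 h2) (hsub hx) hx

lemma weak_type_finite (T : Cube d) (u : Rd d → ℝ) (hu : ∀ x, 0 ≤ u x)
    (hui : IntegrableOn u T.carrier volume) (M : Finset (Cube d))
    (hM : ∀ R ∈ M, ∀ R' ∈ M, R ≠ R' → Disjoint R.carrier R'.carrier)
    (hMT : ∀ R ∈ M, R.carrier ⊆ T.carrier) (h6 : ∀ R ∈ M, 6 * avg T u < avg R u) :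
    6 * ∑ R ∈ M, R.vol ≤ T.vol := by
  have hav := avg_nonneg T hu
  have hsum : ∑ R ∈ M, intC R u ≤ intC T u := by
    have : ∑ R ∈ M, intC R u = ∫ x in ⋃ R ∈ M, R.carrier, u x :=
      (integral_biUnion_finset M (fun R _ => R.measurableSet_carrier)
        (fun R hR R' hR' hne => hM R hR R' hR' hne)
        (fun R hR => hui.mono_set (hMT R hR))).symm
    rw [this]
    exact setIntegral_mono_set hui (ae_of_all _ hu) (Set.iUnion₂_subset hMT).eventuallyLE
  rcases hav.eq_or_lt with h0 | hpos
  · have : M = ∅ := by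
      rw [Finset.eq_empty_iff_forall_notMem]
      intro R hR
      have h1 := h6 R hR
      have h2 : intC R u ≤ intC T u := setIntegral_mono_set hui (ae_of_all _ hu)
        (hMT R hR).eventuallyLE
      rw [← vol_mul_avg, ← vol_mul_avg, ← h0] at h2
      have := R.vol_pos
      rw [← h0] at h1
      nlinarith
    simp [this, T.vol_pos.le]
  · have h1 : ∑ R ∈ M, 6 * avg T u * R.vol ≤ ∑ R ∈ M, intC R u :=
      Finset.sum_le_sum fun R hR => by
        rw [← vol_mul_avg]; have := R.vol_pos; have := h6 R hR; nlinarith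
    rw [← Finset.mul_sum] at h1
    have h2 := h1.trans hsum
    rw [← vol_mul_avg] at h2
    nlinarith

open Classical in
/-- The part of `T` covered by smaller cubes of `G`. -/
def covered (G : Finset (Cube d)) (T : Cube d) : Set (Rd d) :=
  ⋃ R ∈ G.filter (fun R => R.carrier ⊆ T.carrier ∧ R ≠ T), R.carrier

/-- The family `G` is sparse: each cube has at most half its volume covered by smaller ones. -/
def SparseFin (G : Finset (Cube d)) : Prop :=
  ∀ T ∈ G, volume (covered G T) ≤ ENNReal.ofReal (T.vol / 2)

open Classical in
lemma StopCovered.sparseFin {D : DyadicLattice d} (hd : 0 < d) {b f h : Rd d → ℝ}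
    (hb : ∀ Q : Cube d, IntegrableOn b Q.carrier volume)
    (hf : ∀ Q : Cube d, IntegrableOn f Q.carrier volume)
    (hh : ∀ Q : Cube d, IntegrableOn h Q.carrier volume) {G : Finset (Cube d)}
    (hG : StopCovered D b f h G) : SparseFin G := by
  intro T hT
  have hst : ∀ R ∈ G.filter (fun R => R.carrier ⊆ T.carrier ∧ R ≠ T),
      ∃ R' ∈ D.cubes, R.carrier ⊆ R'.carrier ∧ R'.carrier ⊆ T.carrier ∧ StopCond b f h T R' := by
    intro R hR
    rw [Finset.mem_filter] at hR
    exact hG T hT R hR.1 hR.2.1 hR.2.2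
  choose! s hs1 hs2 hs3 hs4 using hst
  set H := G.filter (fun R => R.carrier ⊆ T.carrier ∧ R ≠ T) with hH
  have him : ∀ R ∈ H.image s, R ∈ D.cubes ∧ R.carrier ⊆ T.carrier ∧ StopCond b f h T R := by
    intro R hR
    obtain ⟨R', hR', rfl⟩ := Finset.mem_image.mp hR
    exact ⟨hs1 R' hR', hs3 R' hR', hs4 R' hR'⟩
  obtain ⟨M, hMs, hMd, hMc⟩ := exists_maximal_cubes D hd (H.image s) fun R hR => (him R hR).1
  have hw : ∀ u : Rd d → ℝ, (∀ x, 0 ≤ u x) → IntegrableOn u T.carrier volume →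
      6 * ∑ R ∈ M.filter (fun R => 6 * avg T u < avg R u), R.vol ≤ T.vol := by
    intro u hu hui
    refine weak_type_finite T u hu hui _ ?_ ?_ ?_
    · intro R hR R' hR'
      exact hMd R (Finset.mem_filter.mp hR).1 R' (Finset.mem_filter.mp hR').1
    · intro R hR
      exact (him R (hMs (Finset.mem_filter.mp hR).1)).2.1
    · intro R hR
      exact (Finset.mem_filter.mp hR).2
  have h1 := hw (fun x => |f x|) (fun _ => abs_nonneg _) (hf T).abs
  have h2 := hw (fun x => |h x|) (fun _ => abs_nonneg _) (hh T).abs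
  have h3 := hw (fun x => |b x - avg T b|) (fun _ => abs_nonneg _)
    ((hb T).sub (by simp [Cube.volume_carrier] :
      IntegrableOn (fun _ => avg T b) T.carrier volume)).abs
  have hsum : ∑ R ∈ M, R.vol ≤ T.vol / 2 := by
    have : ∑ R ∈ M, R.vol ≤
        ∑ R ∈ M.filter (fun R => 6 * avg T (fun x => |f x|) < avg R fun x => |f x|), R.vol +
        ∑ R ∈ M.filter (fun R => 6 * avg T (fun x => |h x|) < avg R fun x => |h x|), R.vol +
        ∑ R ∈ M.filter (fun R => 6 * avg T (fun x => |b x - avg T b|) <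
          avg R fun x => |b x - avg T b|), R.vol := by
      simp only [Finset.sum_filter, ← Finset.sum_add_distrib]
      refine Finset.sum_le_sum fun R hR => ?_
      have hv := R.vol_pos
      rcases (him R (hMs hR)).2.2 with h | h | h <;> rw [if_pos h] <;>
        split_ifs <;> linarith
    linarith
  calc volume (covered G T) ≤ volume (⋃ R ∈ M, R.carrier) := by
        refine measure_mono (Set.iUnion₂_subset fun R hR => ?_)
        obtain ⟨R', hR', hsub⟩ := hMc (s R) (Finset.mem_image_of_mem s hR)
        exact (hs2 R hR).trans (hsub.trans (Set.subset_biUnion_of_mem (u := Cube.carrier) hR'))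
    _ ≤ ∑ R ∈ M, volume R.carrier := measure_biUnion_finset_le _ _
    _ = ENNReal.ofReal (∑ R ∈ M, R.vol) := by
        rw [ENNReal.ofReal_sum_of_nonneg fun R _ => R.vol_pos.le]
        simp only [Cube.volume_carrier]
    _ ≤ _ := ENNReal.ofReal_le_ofReal hsum

/-- The measure `w dx`. -/
def wm (w : Rd d → ℝ) : Measure (Rd d) := volume.withDensity fun x => ENNReal.ofReal (w x)

lemma wm_apply (w : Rd d → ℝ) {s : Set (Rd d)} (hs : MeasurableSet s) :
    wm w s = ∫⁻ x in s, ENNReal.ofReal (w x) := withDensity_apply _ hs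

lemma wm_carrier {w : Rd d → ℝ} (hw : IsWeight w) (Q : Cube d) :
    wm w Q.carrier = ENNReal.ofReal (wInt Q w) := by
  rw [wm_apply w Q.measurableSet_carrier, wInt, intC,
    ofReal_integral_eq_lintegral_ofReal (Q.integrableOn_carrier hw.2.2)
      (ae_of_all _ fun x => (hw.1 x).le)]

lemma wInt_pos {w : Rd d → ℝ} (hw : IsWeight w) (Q : Cube d) : 0 < wInt Q w := by
  rw [wInt, intC, integral_pos_iff_support_of_nonneg (fun x => (hw.1 x).le)
    (Q.integrableOn_carrier hw.2.2)]
  have : Function.support w = Set.univ := by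
    ext x; simp [(hw.1 x).ne']
  rw [this]
  simp [Cube.volume_carrier, Q.vol_pos]

lemma wm_carrier_ne_zero {w : Rd d → ℝ} (hw : IsWeight w) (Q : Cube d) : wm w Q.carrier ≠ 0 := by
  rw [wm_carrier hw]; simpa using wInt_pos hw Q

lemma wm_carrier_ne_top {w : Rd d → ℝ} (hw : IsWeight w) (Q : Cube d) : wm w Q.carrier ≠ ⊤ := by
  rw [wm_carrier hw]; exact ENNReal.ofReal_ne_top

instance (w : Rd d → ℝ) : SFinite (wm w) := by unfold wm; infer_instance

/-- The part of `T` not covered by smaller cubes of `G`. -/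
def ePart (G : Finset (Cube d)) (T : Cube d) : Set (Rd d) := T.carrier \ covered G T

lemma measurableSet_covered (G : Finset (Cube d)) (T : Cube d) :
    MeasurableSet (covered G T) :=
  Finset.measurableSet_biUnion _ fun R _ => R.measurableSet_carrier

lemma measurableSet_ePart (G : Finset (Cube d)) (T : Cube d) : MeasurableSet (ePart G T) :=
  T.measurableSet_carrier.diff (measurableSet_covered G T)

lemma ePart_subset (G : Finset (Cube d)) (T : Cube d) : ePart G T ⊆ T.carrier := Set.sdiff_subset

lemma SparseFin.volume_le {G : Finset (Cube d)} (hG : SparseFin G) {T : Cube d} (hT : T ∈ G) :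
    volume T.carrier ≤ 2 * volume (ePart G T) := by
  have h1 := hG T hT
  have h2 : volume T.carrier ≤ volume (ePart G T) + volume (covered G T) := by
    refine (measure_mono ?_).trans (measure_union_le _ _)
    intro x hx
    by_cases h : x ∈ covered G T
    · exact Or.inr h
    · exact Or.inl ⟨hx, h⟩
  have h3 : volume T.carrier = 2 * ENNReal.ofReal (T.vol / 2) := by
    rw [T.volume_carrier, ← ENNReal.ofReal_ofNat, ← ENNReal.ofReal_mul (by norm_num)]
    congr 1; ring
  have h4 : ENNReal.ofReal (T.vol / 2) ≤ volume (ePart G T) := by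
    have h5 : ENNReal.ofReal (T.vol / 2) + ENNReal.ofReal (T.vol / 2) ≤
        volume (ePart G T) + ENNReal.ofReal (T.vol / 2) := by
      rw [← two_mul, ← h3]; exact h2.trans (by gcongr)
    exact (ENNReal.add_le_add_iff_right ENNReal.ofReal_ne_top).mp h5
  rw [h3]; gcongr

lemma ePart_disjoint (D : DyadicLattice d) {G : Finset (Cube d)} (hG : ∀ R ∈ G, R ∈ D.cubes)
    {T T' : Cube d} (hT : T ∈ G) (hT' : T' ∈ G) (hne : T ≠ T') :
    Disjoint (ePart G T) (ePart G T') := by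
  classical
  rw [Set.disjoint_left]
  rintro x ⟨hx, hxc⟩ ⟨hx', hxc'⟩
  rcases D.subset_or_subset (hG T hT) (hG T' hT') hx hx' with h | h
  · exact hxc' (Set.mem_biUnion (x := T) (by simp [hT, h, hne]) hx)
  · exact hxc (Set.mem_biUnion (x := T') (by simp [hT', h, hne.symm]) hx')

lemma sum_lintegral_ePart_le (D : DyadicLattice d) {G : Finset (Cube d)}
    (hG : ∀ R ∈ G, R ∈ D.cubes) {H : Finset (Cube d)} (hHG : H ⊆ G) (Q : Cube d)
    (hHQ : ∀ R ∈ H, R.carrier ⊆ Q.carrier) (m : Measure (Rd d)) (g : Rd d → ℝ≥0∞) :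
    ∑ S ∈ H, ∫⁻ x in ePart G S, g x ∂m ≤ ∫⁻ x in Q.carrier, g x ∂m := by
  rw [← lintegral_biUnion_finset (fun S hS S' hS' h => ePart_disjoint D hG (hHG hS) (hHG hS') h)
    (fun S _ => measurableSet_ePart G S)]
  exact lintegral_mono_set (Set.iUnion₂_subset fun S hS => (ePart_subset G S).trans (hHQ S hS))

open Classical in
/-- The measure `m` satisfies the Carleson packing condition with constant `K` along all finite
sparse families of dyadic cubes. -/
def CarlesonFor (D : DyadicLattice d) (m : Measure (Rd d)) (K : ℝ≥0∞) : Prop :=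
  ∀ G : Finset (Cube d), (∀ R ∈ G, R ∈ D.cubes) → SparseFin G → ∀ Q ∈ D.cubes,
    ∑ S ∈ G.filter (fun S => S.carrier ⊆ Q.carrier), m S.carrier ≤ K * m Q.carrier

lemma carlesonFor_ainf (D : DyadicLattice d) {w : Rd d → ℝ} (hw : IsWeight w) :
    CarlesonFor D (wm w) (2 * AinfCharOn D.cubes w) := by
  classical
  intro G hG hs Q hQ
  set g : Rd d → ℝ≥0∞ := fun x => ⨆ (R : Cube d) (_ : R ∈ D.cubes) (_ : x ∈ R.carrier),
    ENNReal.ofReal ((∫ y in Q.carrier ∩ R.carrier, w y) / R.vol)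
  have h1 : ∀ S ∈ G.filter (fun S => S.carrier ⊆ Q.carrier),
      wm w S.carrier ≤ 2 * ∫⁻ x in ePart G S, g x := by
    intro S hS
    rw [Finset.mem_filter] at hS
    have e1 : wm w S.carrier = ENNReal.ofReal (wInt S w / S.vol) * volume S.carrier := by
      rw [wm_carrier hw, S.volume_carrier, ← ENNReal.ofReal_mul
        (div_nonneg (wInt_pos hw S).le S.vol_pos.le), div_mul_cancel₀ _ S.vol_pos.ne']
    rw [e1]
    calc _ ≤ ENNReal.ofReal (wInt S w / S.vol) * (2 * volume (ePart G S)) := by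
          gcongr; exact hs.volume_le hS.1
      _ = 2 * ∫⁻ x in ePart G S, ENNReal.ofReal (wInt S w / S.vol) := by
          rw [setLIntegral_const]; ring
      _ ≤ _ := by
          gcongr 2 * ?_
          refine setLIntegral_mono' (measurableSet_ePart G S) fun x hx => ?_
          have := le_iSup₂_of_le (f := fun (R : Cube d) (_ : R ∈ D.cubes) =>
            ⨆ (_ : x ∈ R.carrier), ENNReal.ofReal ((∫ y in Q.carrier ∩ R.carrier, w y) / R.vol))
            S (hG S hS.1) (le_iSup_of_le (ePart_subset G S hx) le_rfl)
          rwa [Set.inter_eq_right.mpr hS.2] at this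
  calc _ ≤ ∑ S ∈ G.filter (fun S => S.carrier ⊆ Q.carrier), 2 * ∫⁻ x in ePart G S, g x :=
        Finset.sum_le_sum h1
    _ ≤ 2 * ∫⁻ x in Q.carrier, g x := by
        rw [← Finset.mul_sum]
        gcongr
        exact sum_lintegral_ePart_le D hG (Finset.filter_subset _ _) Q
          (fun R hR => (Finset.mem_filter.mp hR).2) volume g
    _ ≤ 2 * (AinfCharOn D.cubes w * wm w Q.carrier) := by
        gcongr
        have h2 : (∫⁻ x in Q.carrier, g x) / ENNReal.ofReal (wInt Q w) ≤ AinfCharOn D.cubes w :=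
          le_iSup₂_of_le (f := fun (Q : Cube d) (_ : Q ∈ D.cubes) =>
            (∫⁻ x in Q.carrier, ⨆ (R : Cube d) (_ : R ∈ D.cubes) (_ : x ∈ R.carrier),
              ENNReal.ofReal ((∫ y in Q.carrier ∩ R.carrier, w y) / R.vol)) /
              ENNReal.ofReal (wInt Q w)) Q hQ le_rfl
        rw [← wm_carrier hw] at h2
        exact (ENNReal.div_le_iff (wm_carrier_ne_zero hw Q) (wm_carrier_ne_top hw Q)).mp h2
    _ = _ := by ring

lemma volume_le_wm_prod {w : Fin 3 → Rd d → ℝ} (hw : ∀ i, IsWeight (w i)) {s : Fin 3 → ℝ}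
    (hs : ∀ i, 0 < s i) (hs1 : ∑ i, s i = 1) (h1 : ∀ x, ∏ i, w i x ^ s i = 1)
    {E : Set (Rd d)} (hE : MeasurableSet E) : volume E ≤ ∏ i, wm (w i) E ^ s i := by
  have := ENNReal.lintegral_prod_norm_pow_le (μ := volume.restrict E) (Finset.univ : Finset (Fin 3))
    (f := fun i x => ENNReal.ofReal (w i x))
    (fun i _ => (ENNReal.measurable_ofReal.comp (hw i).2.1).aemeasurable) hs1
    (fun i _ => (hs i).le)
  simp only [wm_apply _ hE]
  refine le_trans (le_of_eq ?_) this
  have e : ∀ x, ∏ i, ENNReal.ofReal (w i x) ^ s i = 1 := by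
    intro x
    rw [← ENNReal.ofReal_one, ← h1 x, ENNReal.ofReal_prod_of_nonneg
      fun i _ => Real.rpow_nonneg ((hw i).1 x).le _]
    exact Finset.prod_congr rfl fun i _ => ENNReal.ofReal_rpow_of_pos ((hw i).1 x)
  simp [e]

lemma carlesonFor_of_prod (D : DyadicLattice d) {w : Fin 3 → Rd d → ℝ} (hw : ∀ i, IsWeight (w i))
    {s : Fin 3 → ℝ} (hs : ∀ i, 0 < s i) (hs1 : ∑ i, s i = 1) (h1 : ∀ x, ∏ i, w i x ^ s i = 1)
    {B : ℝ≥0∞} (hB : B ≠ ⊤)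
    (hBw : ∀ Q ∈ D.cubes, ∏ i, wm (w i) Q.carrier ^ s i ≤ B * volume Q.carrier) (i : Fin 3) :
    ∃ K : ℝ≥0∞, K ≠ ⊤ ∧ CarlesonFor D (wm (w i)) K := by
  classical
  refine ⟨(2 * B) ^ (1 / s i), ENNReal.rpow_ne_top_of_nonneg (one_div_pos.mpr (hs i)).le
    (ENNReal.mul_ne_top (by simp) hB), fun G hG hsp Q hQ => ?_⟩
  have key : ∀ S ∈ G, wm (w i) S.carrier ≤ (2 * B) ^ (1 / s i) * wm (w i) (ePart G S) := by
    intro S hS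
    set V := volume (ePart G S)
    have hV := hsp.volume_le hS
    have hV0 : V ≠ 0 := by
      intro h0
      have : volume S.carrier = 0 := le_antisymm (hV.trans (by simp [V, h0] at *)) bot_le
      rw [S.volume_carrier, ENNReal.ofReal_eq_zero] at this
      exact absurd S.vol_pos (not_lt.mpr this)
    have hVt : V ≠ ⊤ := by
      refine ne_top_of_le_ne_top ?_ (measure_mono (ePart_subset G S))
      rw [S.volume_carrier]; exact ENNReal.ofReal_ne_top
    have a1 : wm (w i) S.carrier ^ s i * V ≤ (2 * B) * wm (w i) (ePart G S) ^ s i * V := by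
      calc wm (w i) S.carrier ^ s i * V
          ≤ wm (w i) S.carrier ^ s i * (wm (w i) (ePart G S) ^ s i *
            ∏ j ∈ Finset.univ.erase i, wm (w j) S.carrier ^ s j) := by
              gcongr
              refine (volume_le_wm_prod hw hs hs1 h1 (measurableSet_ePart G S)).trans ?_
              rw [← Finset.mul_prod_erase Finset.univ _ (Finset.mem_univ i)]
              gcongr with j hj
              · exact (hs j).le
              · exact ePart_subset G S
        _ = wm (w i) (ePart G S) ^ s i * ∏ j, wm (w j) S.carrier ^ s j := by
              rw [← Finset.mul_prod_erase Finset.univ (fun j => wm (w j) S.carrier ^ s j)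
                (Finset.mem_univ i)]; ring
        _ ≤ wm (w i) (ePart G S) ^ s i * (B * (2 * V)) := by
              gcongr; exact (hBw S (hG S hS)).trans (by gcongr)
        _ = _ := by ring
    have a2 : wm (w i) S.carrier ^ s i ≤ (2 * B) * wm (w i) (ePart G S) ^ s i :=
      (ENNReal.mul_le_mul_iff_left hV0 hVt).mp a1
    have a3 := ENNReal.rpow_le_rpow a2 (one_div_pos.mpr (hs i)).le
    rwa [ENNReal.mul_rpow_of_nonneg _ _ (one_div_pos.mpr (hs i)).le, ← ENNReal.rpow_mul,
      ← ENNReal.rpow_mul, mul_one_div_cancel (hs i).ne', ENNReal.rpow_one, ENNReal.rpow_one] at a3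
  calc _ ≤ ∑ S ∈ G.filter (fun S => S.carrier ⊆ Q.carrier),
          (2 * B) ^ (1 / s i) * wm (w i) (ePart G S) :=
        Finset.sum_le_sum fun S hS => key S (Finset.mem_filter.mp hS).1
    _ ≤ _ := by
        rw [← Finset.mul_sum]
        gcongr
        have := sum_lintegral_ePart_le D hG (Finset.filter_subset _ _) Q
          (fun R hR => (Finset.mem_filter.mp hR).2) (wm (w i)) fun _ => 1
        simpa using this

lemma rpow_eq_mul_rpow_sub_one {p : ℝ} (hp : 1 < p) (a : ℝ≥0∞) : a ^ p = a * a ^ (p - 1) := by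
  conv_rhs => rw [← ENNReal.rpow_one a, ← ENNReal.rpow_mul, one_mul,
    ← ENNReal.rpow_add_of_nonneg _ _ zero_le_one (by linarith)]
  rw [add_sub_cancel]

lemma lintegral_rpow_indicator {s : ℝ} (hs : -1 < s) {a : ℝ≥0∞} (ha : a ≠ ⊤) :
    ∫⁻ t in Ioi (0 : ℝ), {t : ℝ | ENNReal.ofReal t < a}.indicator
      (fun t => ENNReal.ofReal (t ^ s)) t = a ^ (s + 1) / ENNReal.ofReal (s + 1) := by
  lift a to NNReal using ha
  have hs' : 0 < s + 1 := by linarith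
  have hset : {t : ℝ | ENNReal.ofReal t < (a : ℝ≥0∞)} ∩ Ioi 0 = Ioo (0 : ℝ) a := by
    ext t
    simp only [Set.mem_inter_iff, Set.mem_ofPred_eq, Set.mem_Ioi, Set.mem_Ioo]
    constructor
    · rintro ⟨h1, h2⟩
      rw [← ENNReal.ofReal_coe_nnreal, ENNReal.ofReal_lt_ofReal_iff'] at h1
      exact ⟨h2, h1.1⟩
    · rintro ⟨h1, h2⟩
      refine ⟨?_, h1⟩
      rw [← ENNReal.ofReal_coe_nnreal, ENNReal.ofReal_lt_ofReal_iff']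
      exact ⟨h2, h1.trans h2⟩
  have hm : MeasurableSet {t : ℝ | ENNReal.ofReal t < (a : ℝ≥0∞)} :=
    measurableSet_lt ENNReal.measurable_ofReal measurable_const
  rw [lintegral_indicator hm, Measure.restrict_restrict hm, hset,
    setLIntegral_congr Ioo_ae_eq_Ioc]
  rw [← ofReal_integral_eq_lintegral_ofReal, ← intervalIntegral.integral_of_le a.coe_nonneg,
    integral_rpow (Or.inl hs), Real.zero_rpow hs'.ne', sub_zero, ENNReal.ofReal_div_of_pos hs',
    ← ENNReal.ofReal_rpow_of_nonneg a.coe_nonneg hs'.le, ENNReal.ofReal_coe_nnreal]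
  · exact (intervalIntegral.intervalIntegrable_rpow' hs).1
  · refine (ae_restrict_iff' measurableSet_Ioc).mpr (ae_of_all _ fun t ht => ?_)
    exact Real.rpow_nonneg ht.1.le _

/-- The average of `φ` over `Q` with respect to `m`. -/
def lavg (m : Measure (Rd d)) (Q : Cube d) (φ : Rd d → ℝ≥0∞) : ℝ≥0∞ :=
  (∫⁻ x in Q.carrier, φ x ∂m) / m Q.carrier

open Classical in
lemma carleson_level (D : DyadicLattice d) (hd : 0 < d) {m : Measure (Rd d)} {K : ℝ≥0∞}
    {G : Finset (Cube d)} (hG : ∀ R ∈ G, R ∈ D.cubes)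
    (hK : ∀ Q ∈ G, ∑ S ∈ G.filter (fun S => S.carrier ⊆ Q.carrier), m S.carrier ≤
      K * m Q.carrier) (h0 : ∀ Q ∈ G, m Q.carrier ≠ 0) (ht : ∀ Q ∈ G, m Q.carrier ≠ ⊤)
    {φ : Rd d → ℝ≥0∞} (hφ : Measurable φ) {t : ℝ≥0∞} (ht0 : t ≠ 0) (htt : t ≠ ⊤) :
    ∑ S ∈ G.filter (fun S => t < lavg m S φ), m S.carrier ≤
      K * (2 / t * ∫⁻ x, {x | t < 2 * φ x}.indicator φ x ∂m) := by
  have hm : MeasurableSet {x | t < 2 * φ x} := measurableSet_lt measurable_const (hφ.const_mul 2)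
  obtain ⟨M, hMG, hMd, hMc⟩ := exists_maximal_cubes D hd (G.filter fun S => t < lavg m S φ)
    fun R hR => hG R (Finset.mem_filter.mp hR).1
  have h1 : ∀ S ∈ M, m S.carrier ≤
      2 / t * ∫⁻ x in S.carrier, {x | t < 2 * φ x}.indicator φ x ∂m := by
    intro S hS
    have hSG := Finset.mem_filter.mp (hMG hS)
    have a1 : t * m S.carrier ≤ ∫⁻ x in S.carrier, φ x ∂m := by
      have := hSG.2.le
      rwa [lavg, ENNReal.le_div_iff_mul_le (Or.inl (h0 S hSG.1)) (Or.inl (ht S hSG.1))] at this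
    have a2 : ∫⁻ x in S.carrier, φ x ∂m ≤
        ∫⁻ x in S.carrier, {x | t < 2 * φ x}.indicator φ x ∂m + t / 2 * m S.carrier := by
      rw [← setLIntegral_const, ← lintegral_add_right _ measurable_const]
      refine lintegral_mono fun x => ?_
      by_cases hx : t < 2 * φ x
      · rw [Set.indicator_of_mem (by exact hx)]; exact le_self_add
      · rw [Set.indicator_of_notMem (by exact hx), zero_add]
        rw [ENNReal.le_div_iff_mul_le (by simp) (by simp), mul_comm]
        exact not_lt.mp hx
    have a3 : t * m S.carrier = t / 2 * m S.carrier + t / 2 * m S.carrier := by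
      rw [← add_mul, ENNReal.add_halves]
    have a4 : t / 2 * m S.carrier ≤ ∫⁻ x in S.carrier, {x | t < 2 * φ x}.indicator φ x ∂m := by
      have := a1.trans a2
      rw [a3] at this
      exact (ENNReal.add_le_add_iff_right (ENNReal.mul_ne_top
        (ENNReal.div_ne_top htt (by simp)) (ht S hSG.1))).mp this
    calc m S.carrier = 2 / t * (t / 2 * m S.carrier) := by
          rw [← mul_assoc, ← ENNReal.mul_div_mul_comm (by simp) (by simp), mul_comm 2 t,
            ENNReal.div_self (mul_ne_zero ht0 (by simp)) (ENNReal.mul_ne_top htt (by simp)), one_mul]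
      _ ≤ _ := by gcongr
  calc ∑ S ∈ G.filter (fun S => t < lavg m S φ), m S.carrier
      ≤ ∑ Q ∈ M, ∑ S ∈ G.filter (fun S => S.carrier ⊆ Q.carrier), m S.carrier := by
        rw [← Finset.sum_biUnion]
        · refine Finset.sum_le_sum_of_subset fun S hS => ?_
          obtain ⟨Q, hQ, hsub⟩ := hMc S hS
          exact Finset.mem_biUnion.mpr ⟨Q, hQ,
            Finset.mem_filter.mpr ⟨(Finset.mem_filter.mp hS).1, hsub⟩⟩
        · intro Q hQ Q' hQ' hne
          rw [Function.onFun, Finset.disjoint_left]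
          intro S hS hS'
          obtain ⟨x, hx⟩ := S.carrier_nonempty
          exact Set.disjoint_left.mp (hMd Q hQ Q' hQ' hne) ((Finset.mem_filter.mp hS).2 hx)
            ((Finset.mem_filter.mp hS').2 hx)
    _ ≤ ∑ Q ∈ M, K * (2 / t * ∫⁻ x in Q.carrier, {x | t < 2 * φ x}.indicator φ x ∂m) := by
        refine Finset.sum_le_sum fun Q hQ => (hK Q (Finset.mem_filter.mp (hMG hQ)).1).trans ?_
        gcongr
        exact h1 Q hQ
    _ ≤ _ := by
        rw [← Finset.mul_sum, ← Finset.mul_sum]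
        gcongr
        rw [← lintegral_biUnion_finset (fun Q hQ Q' hQ' h => hMd Q hQ Q' hQ' h)
          (fun Q _ => Q.measurableSet_carrier)]
        exact setLIntegral_le_lintegral _ _

/-- The Carleson embedding constant. -/
def embC (p : ℝ) : ℝ≥0∞ := ENNReal.ofReal p * (2 ^ p / ENNReal.ofReal (p - 1))

open Classical in
lemma carleson_embedding (D : DyadicLattice d) (hd : 0 < d) {m : Measure (Rd d)} [SFinite m]
    {K : ℝ≥0∞} {p : ℝ} (hp : 1 < p)
    {G : Finset (Cube d)} (hG : ∀ R ∈ G, R ∈ D.cubes)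
    (hK : ∀ Q ∈ G, ∑ S ∈ G.filter (fun S => S.carrier ⊆ Q.carrier), m S.carrier ≤
      K * m Q.carrier) (h0 : ∀ Q ∈ G, m Q.carrier ≠ 0) (ht : ∀ Q ∈ G, m Q.carrier ≠ ⊤)
    {φ : Rd d → ℝ≥0∞} (hφ : Measurable φ) (hφt : ∀ x, φ x ≠ ⊤)
    (hφi : ∀ Q ∈ G, ∫⁻ x in Q.carrier, φ x ∂m ≠ ⊤) :
    ∑ S ∈ G, lavg m S φ ^ p * m S.carrier ≤ embC p * (K * ∫⁻ x, φ x ^ p ∂m) := by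
  have hp0 : 0 < p := by linarith
  have hlt : ∀ Q ∈ G, lavg m Q φ ≠ ⊤ := fun Q hQ => ENNReal.div_ne_top (hφi Q hQ) (h0 Q hQ)
  have hpo : ENNReal.ofReal p ≠ 0 := by simpa using hp0
  have e1 : ∀ S ∈ G, lavg m S φ ^ p * m S.carrier = ENNReal.ofReal p *
      ∫⁻ t in Ioi (0 : ℝ), {t : ℝ | ENNReal.ofReal t < lavg m S φ}.indicator
        (fun t => ENNReal.ofReal (t ^ (p - 1))) t * m S.carrier := by
    intro S hS
    rw [lintegral_mul_const' _ _ (ht S hS), lintegral_rpow_indicator (by linarith) (hlt S hS),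
      sub_add_cancel, ← mul_assoc, ENNReal.mul_div_cancel hpo ENNReal.ofReal_ne_top]
  have hmeas : ∀ (a : ℝ≥0∞) (s : ℝ), Measurable ({t : ℝ | ENNReal.ofReal t < a}.indicator
      (fun t : ℝ => ENNReal.ofReal (t ^ s))) := fun a s =>
    (ENNReal.measurable_ofReal.comp (measurable_id.pow_const s)).indicator
      (measurableSet_lt ENNReal.measurable_ofReal measurable_const)
  rw [Finset.sum_congr rfl e1, ← Finset.mul_sum, ← lintegral_finsetSum]
  swap
  · exact fun S _ => (hmeas _ _).mul_const _
  have e2 : ∀ t ∈ Ioi (0 : ℝ), ∑ S ∈ G, {t : ℝ | ENNReal.ofReal t < lavg m S φ}.indicator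
        (fun t => ENNReal.ofReal (t ^ (p - 1))) t * m S.carrier ≤
      2 * K * ∫⁻ x, φ x * {t : ℝ | ENNReal.ofReal t < 2 * φ x}.indicator
        (fun t => ENNReal.ofReal (t ^ (p - 2))) t ∂m := by
    intro t ht'
    have htpos : (0 : ℝ) < t := ht'
    have hl := carleson_level D hd hG hK h0 ht hφ (t := ENNReal.ofReal t) (by simpa using htpos)
      ENNReal.ofReal_ne_top
    have b1 : ∑ S ∈ G, {t : ℝ | ENNReal.ofReal t < lavg m S φ}.indicator
        (fun t => ENNReal.ofReal (t ^ (p - 1))) t * m S.carrier =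
        ENNReal.ofReal (t ^ (p - 1)) *
          ∑ S ∈ G.filter (fun S => ENNReal.ofReal t < lavg m S φ), m S.carrier := by
      rw [Finset.sum_filter, Finset.mul_sum]
      refine Finset.sum_congr rfl fun S _ => ?_
      by_cases h : ENNReal.ofReal t < lavg m S φ
      · rw [Set.indicator_of_mem (by exact h), if_pos h]
      · rw [Set.indicator_of_notMem (by exact h), if_neg h, zero_mul, mul_zero]
    have b2 : ∀ x, φ x * {t : ℝ | ENNReal.ofReal t < 2 * φ x}.indicator
        (fun t => ENNReal.ofReal (t ^ (p - 2))) t =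
        ENNReal.ofReal (t ^ (p - 2)) * {x | ENNReal.ofReal t < 2 * φ x}.indicator φ x := by
      intro x
      by_cases h : ENNReal.ofReal t < 2 * φ x
      · rw [Set.indicator_of_mem (by exact h), Set.indicator_of_mem (by exact h), mul_comm]
      · rw [Set.indicator_of_notMem (by exact h), Set.indicator_of_notMem (by exact h)]; simp
    have b3 : ENNReal.ofReal (t ^ (p - 1)) / ENNReal.ofReal t = ENNReal.ofReal (t ^ (p - 2)) := by
      rw [← ENNReal.ofReal_div_of_pos htpos, show p - 1 = (p - 2) + 1 by ring,
        Real.rpow_add_one htpos.ne', mul_div_cancel_right₀ _ htpos.ne']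
    rw [b1]
    simp only [b2]
    rw [lintegral_const_mul' _ _ ENNReal.ofReal_ne_top, ← b3]
    calc _ ≤ _ := mul_le_mul_right hl _
      _ = _ := by simp only [div_eq_mul_inv]; ring
  calc _ ≤ ENNReal.ofReal p * ∫⁻ t in Ioi (0 : ℝ), 2 * K *
        ∫⁻ x, φ x * {t : ℝ | ENNReal.ofReal t < 2 * φ x}.indicator
        (fun t => ENNReal.ofReal (t ^ (p - 2))) t ∂m := by
        gcongr ENNReal.ofReal p * ?_
        exact setLIntegral_mono' measurableSet_Ioi e2
    _ = ENNReal.ofReal p * (2 * K * ∫⁻ x, (∫⁻ t in Ioi (0 : ℝ), φ x *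
        {t : ℝ | ENNReal.ofReal t < 2 * φ x}.indicator
        (fun t => ENNReal.ofReal (t ^ (p - 2))) t) ∂m) := by
        have hjm : Measurable (fun z : ℝ × Rd d => φ z.2 *
            {t : ℝ | ENNReal.ofReal t < 2 * φ z.2}.indicator
              (fun t => ENNReal.ofReal (t ^ (p - 2))) z.1) := by
          refine (hφ.comp measurable_snd).mul ?_
          have : (fun z : ℝ × Rd d => {t : ℝ | ENNReal.ofReal t < 2 * φ z.2}.indicator
              (fun t => ENNReal.ofReal (t ^ (p - 2))) z.1) =
              {z : ℝ × Rd d | ENNReal.ofReal z.1 < 2 * φ z.2}.indicator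
                (fun z => ENNReal.ofReal (z.1 ^ (p - 2))) := by
            ext z; simp [Set.indicator]
          rw [this]
          exact (ENNReal.measurable_ofReal.comp (measurable_fst.pow_const _)).indicator
            (measurableSet_lt (ENNReal.measurable_ofReal.comp measurable_fst)
              ((hφ.comp measurable_snd).const_mul 2))
        rw [lintegral_const_mul _ hjm.lintegral_prod_right',
          lintegral_lintegral_swap hjm.aemeasurable]
    _ = ENNReal.ofReal p * (2 * K * ∫⁻ x, 2 ^ (p - 1) / ENNReal.ofReal (p - 1) * φ x ^ p ∂m) := by
        congr 3
        ext x
        rw [lintegral_const_mul _ (hmeas _ _), lintegral_rpow_indicator (by linarith)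
          (ENNReal.mul_ne_top (by simp) (hφt x)), show p - 2 + 1 = p - 1 by ring,
          ENNReal.mul_rpow_of_nonneg _ _ (by linarith : 0 ≤ p - 1)]
        rw [rpow_eq_mul_rpow_sub_one hp (φ x)]
        simp only [div_eq_mul_inv]; ring
    _ = _ := by
        rw [lintegral_const_mul _ (hφ.pow_const p), embC]
        rw [rpow_eq_mul_rpow_sub_one hp 2]
        simp only [div_eq_mul_inv]; ring

lemma embC_ne_top {p : ℝ} (hp : 1 < p) : embC p ≠ ⊤ := by
  unfold embC
  have : ENNReal.ofReal (p - 1) ≠ 0 := by simpa using hp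
  refine ENNReal.mul_ne_top ENNReal.ofReal_ne_top (ENNReal.div_ne_top ?_ this)
  exact ENNReal.rpow_ne_top_of_nonneg (by linarith) (by simp)

lemma sum_rpow_mul_rpow_le {ι : Type*} (s : Finset ι) (X Y : ι → ℝ≥0∞) {a b : ℝ} (ha : 0 < a)
    (hb : 0 < b) (hab : a + b = 1) :
    ∑ i ∈ s, X i ^ a * Y i ^ b ≤ (∑ i ∈ s, X i) ^ a * (∑ i ∈ s, Y i) ^ b := by
  have hc : (1 / a).HolderConjugate (1 / b) := by
    rw [Real.holderConjugate_iff]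
    refine ⟨by rw [lt_div_iff₀ ha]; linarith, by simpa using hab⟩
  have := ENNReal.inner_le_Lp_mul_Lq s (fun i => X i ^ a) (fun i => Y i ^ b) hc
  simpa only [← ENNReal.rpow_mul, mul_one_div_cancel ha.ne', mul_one_div_cancel hb.ne',
    ENNReal.rpow_one, one_div_one_div] using this

lemma sum_rpow_mul_rpow_mul_rpow_le {ι : Type*} (s : Finset ι) (X Y Z : ι → ℝ≥0∞) {a b c : ℝ}
    (ha : 0 < a) (hb : 0 < b) (hc : 0 < c) (habc : a + b + c = 1) :
    ∑ i ∈ s, X i ^ a * Y i ^ b * Z i ^ c ≤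
      (∑ i ∈ s, X i) ^ a * (∑ i ∈ s, Y i) ^ b * (∑ i ∈ s, Z i) ^ c := by
  have hbc : 0 < b + c := by linarith
  have h1 := sum_rpow_mul_rpow_le s X (fun i => Y i ^ (b / (b + c)) * Z i ^ (c / (b + c))) ha hbc
    (by linarith)
  have h2 := sum_rpow_mul_rpow_le s Y Z (a := b / (b + c)) (b := c / (b + c)) (by positivity)
    (by positivity) (by field_simp)
  have e : ∀ y z : ℝ≥0∞, (y ^ (b / (b + c)) * z ^ (c / (b + c))) ^ (b + c) = y ^ b * z ^ c := by
    intro y z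
    rw [ENNReal.mul_rpow_of_nonneg _ _ hbc.le, ← ENNReal.rpow_mul, ← ENNReal.rpow_mul,
      div_mul_cancel₀ _ hbc.ne', div_mul_cancel₀ _ hbc.ne']
  simp only [e] at h1
  calc _ = ∑ i ∈ s, X i ^ a * (Y i ^ b * Z i ^ c) := by simp only [mul_assoc]
    _ ≤ _ := h1
    _ ≤ (∑ i ∈ s, X i) ^ a *
        ((∑ i ∈ s, Y i) ^ (b / (b + c)) * (∑ i ∈ s, Z i) ^ (c / (b + c))) ^ (b + c) := by gcongr
    _ = _ := by rw [e, mul_assoc]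

lemma sum_rpow_le_rpow_sum {ι : Type*} (s : Finset ι) (Y : ι → ℝ≥0∞) {t : ℝ} (ht : 1 ≤ t) :
    ∑ i ∈ s, Y i ^ t ≤ (∑ i ∈ s, Y i) ^ t := by
  classical
  induction s using Finset.induction_on with
  | empty => simp
  | insert i s hi ih =>
    rw [Finset.sum_insert hi, Finset.sum_insert hi]
    exact (add_le_add le_rfl ih).trans (ENNReal.add_rpow_le_rpow_add _ _ ht)

lemma sum_rpow_mul_rpow_le_of_one_le {ι : Type*} (s : Finset ι) (X Y : ι → ℝ≥0∞) {a b : ℝ}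
    (ha : 0 < a) (ha1 : a < 1) (hab : 1 ≤ a + b) :
    ∑ i ∈ s, X i ^ a * Y i ^ b ≤ (∑ i ∈ s, X i) ^ a * (∑ i ∈ s, Y i) ^ b := by
  have h1a : 0 < 1 - a := by linarith
  have h1 := sum_rpow_mul_rpow_le s X (fun i => Y i ^ (b / (1 - a))) ha h1a (by ring)
  simp only [← ENNReal.rpow_mul, div_mul_cancel₀ _ h1a.ne'] at h1
  refine h1.trans ?_
  gcongr
  calc _ ≤ ((∑ i ∈ s, Y i) ^ (b / (1 - a))) ^ (1 - a) := by
        gcongr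
        exact sum_rpow_le_rpow_sum s Y (by rw [le_div_iff₀ h1a]; linarith)
    _ = _ := by rw [← ENNReal.rpow_mul, div_mul_cancel₀ _ h1a.ne']

lemma lintegral_wm {w : Rd d → ℝ} (hw : IsWeight w) (g : Rd d → ℝ≥0∞) :
    ∫⁻ x, g x ∂(wm w) = ∫⁻ x, ENNReal.ofReal (w x) * g x := by
  have hm : Measurable (fun x => ENNReal.ofReal (w x)) := hw.2.1.ennreal_ofReal
  rw [wm, lintegral_withDensity_eq_lintegral_mul_non_measurable _ hm (by simp)]
  rfl

lemma setLIntegral_wm {w : Rd d → ℝ} (hw : IsWeight w) (Q : Cube d) (g : Rd d → ℝ≥0∞) :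
    ∫⁻ x in Q.carrier, g x ∂(wm w) = ∫⁻ x in Q.carrier, ENNReal.ofReal (w x) * g x := by
  have hm : Measurable (fun x => ENNReal.ofReal (w x)) := hw.2.1.ennreal_ofReal
  rw [wm, setLIntegral_withDensity_eq_setLIntegral_mul_non_measurable _ hm _
    Q.measurableSet_carrier (by simp)]
  rfl

/-- The function `|u| / w`. -/
def relDens (w u : Rd d → ℝ) (x : Rd d) : ℝ≥0∞ := ENNReal.ofReal (|u x| / w x)

lemma measurable_relDens {w u : Rd d → ℝ} (hw : IsWeight w) (hu : Measurable u) :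
    Measurable (relDens w u) :=
  ENNReal.measurable_ofReal.comp ((measurable_abs.comp hu).div hw.2.1)

lemma ofReal_mul_relDens {w : Rd d → ℝ} (hw : IsWeight w) (u : Rd d → ℝ) (x : Rd d) :
    ENNReal.ofReal (w x) * relDens w u x = ENNReal.ofReal |u x| := by
  rw [relDens, ← ENNReal.ofReal_mul (hw.1 x).le, mul_div_cancel₀ _ (hw.1 x).ne']

lemma setLIntegral_relDens {w u : Rd d → ℝ} (hw : IsWeight w) {Q : Cube d}
    (hu : IntegrableOn u Q.carrier volume) :
    ∫⁻ x in Q.carrier, relDens w u x ∂(wm w) = ENNReal.ofReal (intC Q fun x => |u x|) := by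
  rw [setLIntegral_wm hw]
  simp only [ofReal_mul_relDens hw]
  rw [intC, ofReal_integral_eq_lintegral_ofReal hu.abs (ae_of_all _ fun x => abs_nonneg _)]

lemma lavg_relDens_mul {w u : Rd d → ℝ} (hw : IsWeight w) {Q : Cube d}
    (hu : IntegrableOn u Q.carrier volume) :
    lavg (wm w) Q (relDens w u) * wm w Q.carrier = ENNReal.ofReal (intC Q fun x => |u x|) := by
  rw [lavg, setLIntegral_relDens hw hu,
    ENNReal.div_mul_cancel (wm_carrier_ne_zero hw Q) (wm_carrier_ne_top hw Q)]

lemma one_div_conj {p : ℝ} (hp : 1 < p) : 1 / conj p = 1 - 1 / p := by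
  have : p - 1 ≠ 0 := by linarith
  have : p ≠ 0 := by linarith
  unfold conj; field_simp

lemma one_lt_conj {p : ℝ} (hp : 1 < p) : 1 < conj p := by
  unfold conj; rw [lt_div_iff₀ (by linarith)]; linarith

lemma ofReal_sparseTerm_le {p q : ℝ} (hp : 1 < p) (hq : 1 < q) {w₁ w₂ w₃ : Rd d → ℝ}
    (hw₁ : IsWeight w₁) (hw₂ : IsWeight w₂) (hw₃ : IsWeight w₃) {B : ℝ≥0∞} {Q : Cube d}
    (hB : wm w₁ Q.carrier ^ (1 / conj p) * wm w₂ Q.carrier ^ (1 / q) *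
      wm w₃ Q.carrier ^ (1 / p + 1 / conj q) ≤ B * volume Q.carrier ^ 2) {f h : Rd d → ℝ}
    (hf : IntegrableOn f Q.carrier volume) (hh : IntegrableOn h Q.carrier volume)
    (b : Rd d → ℝ) :
    ENNReal.ofReal (sparseTerm b f h Q) ≤
      B * ((lavg (wm w₁) Q (relDens w₁ f) ^ p * wm w₁ Q.carrier) ^ (1 / p) *
        (lavg (wm w₂) Q (relDens w₂ h) ^ conj q * wm w₂ Q.carrier) ^ (1 / conj q) *
        (ENNReal.ofReal (osc Q b) / wm w₃ Q.carrier ^ (1 / p + 1 / conj q))) := by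
  have hp0 : 0 < 1 / p := by positivity
  have hq0 : 0 < 1 / q := by positivity
  have hp0' : 0 < p := by linarith
  have hq0' : 0 < conj q := by linarith [one_lt_conj hq]
  set m₁ := wm w₁ Q.carrier with hm₁
  set m₂ := wm w₂ Q.carrier with hm₂
  set m₃ := wm w₃ Q.carrier with hm₃
  set A := lavg (wm w₁) Q (relDens w₁ f)
  set C := lavg (wm w₂) Q (relDens w₂ h)
  have h30 : m₃ ^ (1 / p + 1 / conj q) ≠ 0 := by
    rw [Ne, ENNReal.rpow_eq_zero_iff]
    simp [hm₃, wm_carrier_ne_zero hw₃, wm_carrier_ne_top hw₃]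
  have h3t : m₃ ^ (1 / p + 1 / conj q) ≠ ⊤ :=
    ENNReal.rpow_ne_top_of_nonneg (by positivity) (wm_carrier_ne_top hw₃ Q)
  have hV : volume Q.carrier = ENNReal.ofReal Q.vol := Q.volume_carrier
  have hV0 : volume Q.carrier ≠ 0 := by rw [hV]; simpa using Q.vol_pos
  have hVt : volume Q.carrier ≠ ⊤ := by rw [hV]; exact ENNReal.ofReal_ne_top
  have e1 : (A ^ p * m₁) ^ (1 / p) = A * m₁ ^ (1 / p) := by
    rw [ENNReal.mul_rpow_of_nonneg _ _ hp0.le, ← ENNReal.rpow_mul, mul_one_div_cancel hp0'.ne',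
      ENNReal.rpow_one]
  have e2 : (C ^ conj q * m₂) ^ (1 / conj q) = C * m₂ ^ (1 / conj q) := by
    rw [ENNReal.mul_rpow_of_nonneg _ _ (by positivity), ← ENNReal.rpow_mul,
      mul_one_div_cancel hq0'.ne', ENNReal.rpow_one]
  have e3 : m₁ = m₁ ^ (1 / p) * m₁ ^ (1 / conj p) := by
    rw [← ENNReal.rpow_add _ _ (wm_carrier_ne_zero hw₁ Q) (wm_carrier_ne_top hw₁ Q),
      one_div_conj hp, add_sub_cancel, ENNReal.rpow_one]
  have e4 : m₂ = m₂ ^ (1 / conj q) * m₂ ^ (1 / q) := by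
    rw [← ENNReal.rpow_add _ _ (wm_carrier_ne_zero hw₂ Q) (wm_carrier_ne_top hw₂ Q),
      one_div_conj hq, sub_add_cancel, ENNReal.rpow_one]
  have e5 : ENNReal.ofReal (sparseTerm b f h Q) * volume Q.carrier ^ 2 =
      (A * m₁) * (C * m₂) * ENNReal.ofReal (osc Q b) := by
    have hfi : 0 ≤ intC Q (fun x => |f x|) := integral_nonneg fun _ => abs_nonneg _
    have hhi : 0 ≤ intC Q (fun x => |h x|) := integral_nonneg fun _ => abs_nonneg _
    rw [lavg_relDens_mul hw₁ hf, lavg_relDens_mul hw₂ hh, hV,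
      ← ENNReal.ofReal_pow Q.vol_pos.le, ← ENNReal.ofReal_mul (sparseTerm_nonneg _ _ _ _),
      ← ENNReal.ofReal_mul hfi, ← ENNReal.ofReal_mul (mul_nonneg hfi hhi), sparseTerm, ← vol_mul_avg,
        ← vol_mul_avg]
    congr 1; ring
  rw [e1, e2]
  refine (ENNReal.mul_le_mul_iff_left (c := volume Q.carrier ^ 2) (by simp [hV0]) (by simp [hVt])).mp ?_
  rw [e5]
  calc A * m₁ * (C * m₂) * ENNReal.ofReal (osc Q b)
      = A * (m₁ ^ (1 / p) * m₁ ^ (1 / conj p)) * (C * (m₂ ^ (1 / conj q) * m₂ ^ (1 / q))) *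
        (ENNReal.ofReal (osc Q b) / m₃ ^ (1 / p + 1 / conj q) * m₃ ^ (1 / p + 1 / conj q)) := by
        rw [← e3, ← e4, ENNReal.div_mul_cancel h30 h3t]
    _ = A * m₁ ^ (1 / p) * (C * m₂ ^ (1 / conj q)) *
        (ENNReal.ofReal (osc Q b) / m₃ ^ (1 / p + 1 / conj q)) *
        (m₁ ^ (1 / conj p) * m₂ ^ (1 / q) * m₃ ^ (1 / p + 1 / conj q)) := by ring
    _ ≤ A * m₁ ^ (1 / p) * (C * m₂ ^ (1 / conj q)) *
        (ENNReal.ofReal (osc Q b) / m₃ ^ (1 / p + 1 / conj q)) * (B * volume Q.carrier ^ 2) := by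
        gcongr
    _ = _ := by ring

lemma wm_carrier_rpow_mul_le {p q : ℝ} (hp : 1 < p) (hq : 1 < q) {𝒟 : Set (Cube d)}
    {w₁ w₂ w₃ : Rd d → ℝ} (hw₁ : IsWeight w₁) (hw₂ : IsWeight w₂) (hw₃ : IsWeight w₃)
    {Q : Cube d} (hQ : Q ∈ 𝒟) :
    wm w₁ Q.carrier ^ (1 / conj p) * wm w₂ Q.carrier ^ (1 / q) *
      wm w₃ Q.carrier ^ (1 / p + 1 / conj q) ≤ BupperOn 𝒟 p q w₁ w₂ w₃ * volume Q.carrier ^ 2 := by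
  have hp' := one_lt_conj hp
  have hq' := one_lt_conj hq
  have hv := Q.vol_pos
  have h1 := wInt_pos hw₁ Q
  have h2 := wInt_pos hw₂ Q
  have h3 := wInt_pos hw₃ Q
  have ha1 : 0 ≤ avg Q w₁ := avg_nonneg Q fun x => (hw₁.1 x).le
  have ha2 : 0 ≤ avg Q w₂ := avg_nonneg Q fun x => (hw₂.1 x).le
  have ha3 : 0 ≤ avg Q w₃ := avg_nonneg Q fun x => (hw₃.1 x).le
  have he : 1 / conj p + 1 / q + (1 / p + 1 / conj q) = (2 : ℕ) := by
    rw [one_div_conj hp, one_div_conj hq]; push_cast; ring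
  have key : wInt Q w₁ ^ (1 / conj p) * wInt Q w₂ ^ (1 / q) * wInt Q w₃ ^ (1 / p + 1 / conj q) =
      (avg Q w₁ ^ (1 / conj p) * avg Q w₂ ^ (1 / q) * avg Q w₃ ^ (1 / p + 1 / conj q)) *
        Q.vol ^ 2 := by
    rw [← Real.rpow_natCast Q.vol 2, ← he, Real.rpow_add hv, Real.rpow_add hv, wInt, wInt, wInt,
      ← vol_mul_avg, ← vol_mul_avg, ← vol_mul_avg, Real.mul_rpow hv.le ha1,
      Real.mul_rpow hv.le ha2, Real.mul_rpow hv.le ha3]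
    ring
  rw [wm_carrier hw₁, wm_carrier hw₂, wm_carrier hw₃, Q.volume_carrier,
    ENNReal.ofReal_rpow_of_pos h1, ENNReal.ofReal_rpow_of_pos h2, ENNReal.ofReal_rpow_of_pos h3,
    ← ENNReal.ofReal_mul (by positivity), ← ENNReal.ofReal_mul (by positivity), key,
    ENNReal.ofReal_mul (by positivity), ENNReal.ofReal_pow hv.le]
  gcongr
  rw [BupperOn]
  exact le_iSup₂ (f := fun (Q : Cube d) (_ : Q ∈ 𝒟) => ENNReal.ofReal (avg Q w₁ ^ (1 / conj p) *
    avg Q w₂ ^ (1 / q) * avg Q w₃ ^ (1 / p + 1 / conj q))) Q hQ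

/-- The dual weight `μ^{-p'/p}`. -/
def dualW (p : ℝ) (μ : Rd d → ℝ) (x : Rd d) : ℝ := μ x ^ (-(conj p / p))

lemma isWeight_dualW {p : ℝ} {μ : Rd d → ℝ} (hμ : IsWeight μ)
    (h : LocallyIntegrable (dualW p μ) volume) : IsWeight (dualW p μ) :=
  ⟨fun x => Real.rpow_pos_of_pos (hμ.1 x) _, hμ.2.1.pow_const _, h⟩

lemma lintegral_relDens_dualW {p : ℝ} (hp : 1 < p) {μ : Rd d → ℝ} (hμ : IsWeight μ)
    (h : LocallyIntegrable (dualW p μ) volume) (f : Rd d → ℝ) :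
    ∫⁻ x, relDens (dualW p μ) f x ^ p ∂(wm (dualW p μ)) =
      ∫⁻ x, ENNReal.ofReal (|f x| ^ p * μ x) := by
  rw [lintegral_wm (isWeight_dualW hμ h)]
  refine lintegral_congr fun x => ?_
  have hx := hμ.1 x
  have hd : 0 < dualW p μ x := (isWeight_dualW hμ h).1 x
  rw [relDens, ENNReal.ofReal_rpow_of_nonneg (by positivity) (by linarith),
    ← ENNReal.ofReal_mul hd.le, Real.div_rpow (abs_nonneg _) hd.le]
  congr 1
  have : dualW p μ x / dualW p μ x ^ p = μ x := by
    have hp1 : p - 1 ≠ 0 := by linarith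
    have hp0 : p ≠ 0 := by linarith
    rw [dualW, ← Real.rpow_mul hx.le, ← Real.rpow_sub hx]
    conv_rhs => rw [← Real.rpow_one (μ x)]
    congr 1
    unfold conj; field_simp; ring
  rw [← this]; ring

lemma lintegral_relDens_mul {s : ℝ} (hs : 0 ≤ s) {w : Rd d → ℝ} (hw : IsWeight w) (g : Rd d → ℝ) :
    ∫⁻ x, relDens w (fun x => w x * g x) x ^ s ∂(wm w) =
      ∫⁻ x, ENNReal.ofReal (|g x| ^ s * w x) := by
  rw [lintegral_wm hw]
  refine lintegral_congr fun x => ?_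
  have hx := hw.1 x
  rw [relDens, abs_mul, abs_of_pos hx, mul_div_cancel_left₀ _ hx.ne',
    ENNReal.ofReal_rpow_of_nonneg (abs_nonneg _) hs, ← ENNReal.ofReal_mul hx.le, mul_comm]

/-- The bilinear sparse form attached to `b` is bounded by `N` on `L^p(μ) × L^{q'}(λ)`. -/
def SparseBound (D : DyadicLattice d) (p q : ℝ) (μ lam b : Rd d → ℝ) (N : ℝ≥0∞) : Prop :=
  ∀ G : Finset (Cube d), (∀ R ∈ G, R ∈ D.cubes) → SparseFin G → ∀ f g : Rd d → ℝ,
    Measurable f → Measurable g → (∀ Q : Cube d, IntegrableOn f Q.carrier volume) →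
    (∀ Q : Cube d, IntegrableOn (fun x => lam x * g x) Q.carrier volume) →
    ∑ Q ∈ G, ENNReal.ofReal (sparseTerm b f (fun x => lam x * g x) Q) ≤
      N * (wnorm p μ f * wnorm (conj q) lam g)

lemma sum_lavg_relDens_le (D : DyadicLattice d) (hd : 0 < d) {s : ℝ} (hs : 1 < s)
    {w u : Rd d → ℝ} (hw : IsWeight w) (hu : Measurable u)
    (hui : ∀ Q : Cube d, IntegrableOn u Q.carrier volume) {K : ℝ≥0∞} (hK : CarlesonFor D (wm w) K)
    {G : Finset (Cube d)} (hG : ∀ R ∈ G, R ∈ D.cubes) (hGs : SparseFin G) :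
    ∑ Q ∈ G, lavg (wm w) Q (relDens w u) ^ s * wm w Q.carrier ≤
      embC s * K * ∫⁻ x, relDens w u x ^ s ∂(wm w) := by
  rw [mul_assoc]
  refine carleson_embedding D hd hs hG (fun Q hQ => ?_) (fun Q _ => wm_carrier_ne_zero hw Q)
    (fun Q _ => wm_carrier_ne_top hw Q) (measurable_relDens hw hu)
    (fun x => ENNReal.ofReal_ne_top) (fun Q _ => ?_)
  · exact hK G hG hGs Q (hG Q hQ)
  · rw [setLIntegral_relDens hw (hui Q)]; exact ENNReal.ofReal_ne_top

lemma sparseBound_of_bmo (D : DyadicLattice d) (hd : 0 < d) {p q : ℝ} (hp : 1 < p) (hq : 1 < q)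
    (hpq : p ≤ q) {μ lam ν b : Rd d → ℝ} (hμ : IsWeight μ) (hlam : IsWeight lam)
    (hν : IsWeight ν) (hμ' : LocallyIntegrable (dualW p μ) volume) {K₁ K₂ : ℝ≥0∞}
    (hK₁ : CarlesonFor D (wm (dualW p μ)) K₁) (hK₂ : CarlesonFor D (wm lam) K₂) :
    SparseBound D p q μ lam b (BupperOn D.cubes p q (dualW p μ) lam ν *
      bmoNormOn D.cubes (1 / p + 1 / conj q) ν b *
      ((embC p * K₁) ^ (1 / p) * (embC (conj q) * K₂) ^ (1 / conj q))) := by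
  intro G hG hGs f g hf hg hfi hhi
  have hq' := one_lt_conj hq
  have hw := isWeight_dualW hμ hμ'
  have hp0 : 0 < 1 / p := by positivity
  set h := fun x => lam x * g x with hh
  set X := fun Q => lavg (wm (dualW p μ)) Q (relDens (dualW p μ) f) ^ p *
    wm (dualW p μ) Q.carrier
  set Y := fun Q => lavg (wm lam) Q (relDens lam h) ^ conj q * wm lam Q.carrier
  set B := BupperOn D.cubes p q (dualW p μ) lam ν
  set N := bmoNormOn D.cubes (1 / p + 1 / conj q) ν b
  have hX : ∑ Q ∈ G, X Q ≤ embC p * K₁ * ∫⁻ x, ENNReal.ofReal (|f x| ^ p * μ x) := by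
    rw [← lintegral_relDens_dualW hp hμ hμ']
    exact sum_lavg_relDens_le D hd hp hw hf hfi hK₁ hG hGs
  have hY : ∑ Q ∈ G, Y Q ≤ embC (conj q) * K₂ *
      ∫⁻ x, ENNReal.ofReal (|g x| ^ conj q * lam x) := by
    rw [← lintegral_relDens_mul (by linarith) hlam]
    exact sum_lavg_relDens_le D hd hq' hlam (hlam.2.1.mul hg) hhi hK₂ hG hGs
  have hterm : ∀ Q ∈ G, ENNReal.ofReal (sparseTerm b f h Q) ≤
      B * N * (X Q ^ (1 / p) * Y Q ^ (1 / conj q)) := by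
    intro Q hQ
    refine (ofReal_sparseTerm_le hp hq hw hlam hν
      (wm_carrier_rpow_mul_le hp hq hw hlam hν (hG Q hQ)) (hfi Q) (hhi Q) b).trans ?_
    have hN : ENNReal.ofReal (osc Q b) / wm ν Q.carrier ^ (1 / p + 1 / conj q) ≤ N := by
      have h3 := wInt_pos hν Q
      rw [wm_carrier hν, ENNReal.ofReal_rpow_of_pos h3, ← ENNReal.ofReal_div_of_pos (by positivity)]
      exact le_iSup₂ (f := fun (Q : Cube d) (_ : Q ∈ D.cubes) =>
        ENNReal.ofReal (osc Q b / wInt Q ν ^ (1 / p + 1 / conj q))) Q (hG Q hQ)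
    calc _ ≤ B * (X Q ^ (1 / p) * Y Q ^ (1 / conj q) * N) := by gcongr
      _ = _ := by ring
  calc _ ≤ ∑ Q ∈ G, B * N * (X Q ^ (1 / p) * Y Q ^ (1 / conj q)) := Finset.sum_le_sum hterm
    _ = B * N * ∑ Q ∈ G, X Q ^ (1 / p) * Y Q ^ (1 / conj q) := by rw [Finset.mul_sum]
    _ ≤ B * N * ((∑ Q ∈ G, X Q) ^ (1 / p) * (∑ Q ∈ G, Y Q) ^ (1 / conj q)) := by
        gcongr
        refine sum_rpow_mul_rpow_le_of_one_le G X Y hp0 ?_ ?_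
        · rw [div_lt_one (by linarith)]; exact hp
        · rw [one_div_conj hq]
          have : 1 / q ≤ 1 / p := one_div_le_one_div_of_le (by linarith) hpq
          linarith
    _ ≤ B * N * ((embC p * K₁ * ∫⁻ x, ENNReal.ofReal (|f x| ^ p * μ x)) ^ (1 / p) *
        (embC (conj q) * K₂ * ∫⁻ x, ENNReal.ofReal (|g x| ^ conj q * lam x)) ^ (1 / conj q)) := by
        gcongr
    _ = _ := by
        rw [ENNReal.mul_rpow_of_nonneg _ _ hp0.le, ENNReal.mul_rpow_of_nonneg (embC (conj q) * K₂) _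
          (by positivity), wnorm, wnorm]
        ring

/-- The largest value of `osc(b, S) / ν(S)` over the cubes `S ∈ G` containing a point. -/
def sharpFin (G : Finset (Cube d)) (ν b : Rd d → ℝ) (x : Rd d) : ℝ≥0∞ :=
  G.sup fun S => S.carrier.indicator (fun _ => ENNReal.ofReal (osc S b / wInt S ν)) x

lemma measurable_sharpFin (G : Finset (Cube d)) (ν b : Rd d → ℝ) :
    Measurable (sharpFin G ν b) := by
  have : sharpFin G ν b = G.sup fun S =>
      S.carrier.indicator (fun _ => ENNReal.ofReal (osc S b / wInt S ν)) := by
    ext x; rw [sharpFin, Finset.sup_apply]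
  rw [this]
  refine Finset.sup_induction (p := fun φ : Rd d → ℝ≥0∞ => Measurable φ) measurable_const
    (fun _ h _ h' => Measurable.sup h h') fun S _ => ?_
  exact measurable_const.indicator S.measurableSet_carrier

lemma sharpFin_le (G : Finset (Cube d)) (ν b : Rd d → ℝ) (x : Rd d) :
    sharpFin G ν b x ≤ G.sup fun S => ENNReal.ofReal (osc S b / wInt S ν) :=
  Finset.sup_mono_fun fun _ _ => Set.indicator_le_self _ _ _

lemma sup_osc_ne_top (G : Finset (Cube d)) (ν b : Rd d → ℝ) :
    (G.sup fun S => ENNReal.ofReal (osc S b / wInt S ν)) ≠ ⊤ := by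
  refine ne_of_lt ((Finset.sup_lt_iff ENNReal.zero_lt_top).mpr fun S _ => ENNReal.ofReal_lt_top)

lemma sharpFin_le_sharpMaxOn {𝒟 : Set (Cube d)} {G : Finset (Cube d)} (hG : ∀ R ∈ G, R ∈ 𝒟)
    (ν b : Rd d → ℝ) (x : Rd d) : sharpFin G ν b x ≤ sharpMaxOn 𝒟 ν b x := by
  refine Finset.sup_le fun S hS => ?_
  by_cases hx : x ∈ S.carrier
  · rw [Set.indicator_of_mem hx]
    exact le_iSup₂_of_le S (hG S hS) (le_iSup_of_le hx le_rfl)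
  · rw [Set.indicator_of_notMem hx]; exact zero_le

lemma ofReal_osc_div_le_lavg {ν : Rd d → ℝ} (hν : IsWeight ν) {G : Finset (Cube d)}
    {T : Cube d} (hT : T ∈ G) (b : Rd d → ℝ) :
    ENNReal.ofReal (osc T b / wInt T ν) ≤ lavg (wm ν) T (sharpFin G ν b) := by
  rw [lavg, ENNReal.le_div_iff_mul_le (Or.inl (wm_carrier_ne_zero hν T))
    (Or.inl (wm_carrier_ne_top hν T)), ← setLIntegral_const]
  refine setLIntegral_mono' T.measurableSet_carrier fun x hx => ?_
  refine le_trans ?_ (Finset.le_sup (f := fun S : Cube d =>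
    S.carrier.indicator (fun _ => ENNReal.ofReal (osc S b / wInt S ν)) x) hT)
  rw [Set.indicator_of_mem hx]

lemma sparseBound_of_sharp (D : DyadicLattice d) (hd : 0 < d) {p q r : ℝ} (hp : 1 < p)
    (hq : 1 < q) (hqp : q < p) (hr : 1 / r = 1 / q - 1 / p) {μ lam ν b : Rd d → ℝ}
    (hμ : IsWeight μ) (hlam : IsWeight lam)
    (hν : IsWeight ν) (hμ' : LocallyIntegrable (dualW p μ) volume) {K₁ K₂ K₃ : ℝ≥0∞}
    (hK₁ : CarlesonFor D (wm (dualW p μ)) K₁) (hK₂ : CarlesonFor D (wm lam) K₂)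
    (hK₃ : CarlesonFor D (wm ν) K₃) :
    SparseBound D p q μ lam b (BupperOn D.cubes p q (dualW p μ) lam ν *
      sharpNormOn D.cubes r ν b *
      ((embC p * K₁) ^ (1 / p) * (embC (conj q) * K₂) ^ (1 / conj q) *
        (embC r * K₃) ^ (1 / r))) := by
  intro G hG hGs f g hf hg hfi hhi
  have hq' := one_lt_conj hq
  have hw := isWeight_dualW hμ hμ'
  have hp0 : 0 < 1 / p := by positivity
  have hr0 : 0 < 1 / r := by
    rw [hr]; have := one_div_lt_one_div_of_lt (by linarith) hqp; linarith
  have hr1 : 1 < r := by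
    have h1 : 1 / r < 1 := by
      rw [hr]; have : 1 / q < 1 := by rw [div_lt_one (by linarith)]; exact hq
      linarith
    have h2 : 0 < r := one_div_pos.mp hr0
    rwa [div_lt_one h2] at h1
  set h := fun x => lam x * g x with hh
  set X := fun Q => lavg (wm (dualW p μ)) Q (relDens (dualW p μ) f) ^ p *
    wm (dualW p μ) Q.carrier
  set Y := fun Q => lavg (wm lam) Q (relDens lam h) ^ conj q * wm lam Q.carrier
  set Z := fun Q => lavg (wm ν) Q (sharpFin G ν b) ^ r * wm ν Q.carrier
  set B := BupperOn D.cubes p q (dualW p μ) lam ν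
  have hX : ∑ Q ∈ G, X Q ≤ embC p * K₁ * ∫⁻ x, ENNReal.ofReal (|f x| ^ p * μ x) := by
    rw [← lintegral_relDens_dualW hp hμ hμ']
    exact sum_lavg_relDens_le D hd hp hw hf hfi hK₁ hG hGs
  have hY : ∑ Q ∈ G, Y Q ≤ embC (conj q) * K₂ *
      ∫⁻ x, ENNReal.ofReal (|g x| ^ conj q * lam x) := by
    rw [← lintegral_relDens_mul (by linarith) hlam]
    exact sum_lavg_relDens_le D hd hq' hlam (hlam.2.1.mul hg) hhi hK₂ hG hGs
  have hZ : ∑ Q ∈ G, Z Q ≤ embC r * K₃ *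
      ∫⁻ x, sharpMaxOn D.cubes ν b x ^ r * ENNReal.ofReal (ν x) := by
    have hle : ∀ Q : Cube d, ∫⁻ x in Q.carrier, sharpFin G ν b x ∂(wm ν) ≠ ⊤ := by
      intro Q
      refine ne_top_of_le_ne_top ?_ (lintegral_mono (sharpFin_le G ν b))
      rw [setLIntegral_const]
      exact ENNReal.mul_ne_top (sup_osc_ne_top G ν b) (wm_carrier_ne_top hν Q)
    have := carleson_embedding D hd hr1 hG (fun Q hQ => hK₃ G hG hGs Q (hG Q hQ))
      (fun Q _ => wm_carrier_ne_zero hν Q) (fun Q _ => wm_carrier_ne_top hν Q)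
      (measurable_sharpFin G ν b)
      (fun x => ne_top_of_le_ne_top (sup_osc_ne_top G ν b) (sharpFin_le G ν b x))
      (fun Q _ => hle Q)
    refine this.trans ?_
    rw [mul_assoc, lintegral_wm hν]
    refine mul_le_mul_right (mul_le_mul_right (lintegral_mono fun x => ?_) _) _
    rw [mul_comm]
    gcongr
    exact sharpFin_le_sharpMaxOn hG ν b x
  have hterm : ∀ Q ∈ G, ENNReal.ofReal (sparseTerm b f h Q) ≤
      B * (X Q ^ (1 / p) * Y Q ^ (1 / conj q) * Z Q ^ (1 / r)) := by
    intro Q hQ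
    refine (ofReal_sparseTerm_le hp hq hw hlam hν
      (wm_carrier_rpow_mul_le hp hq hw hlam hν (hG Q hQ)) (hfi Q) (hhi Q) b).trans ?_
    have hN : ENNReal.ofReal (osc Q b) / wm ν Q.carrier ^ (1 / p + 1 / conj q) ≤
        Z Q ^ (1 / r) := by
      have h3 := wInt_pos hν Q
      have hlav := ofReal_osc_div_le_lavg hν hQ b
      have hm0 := wm_carrier_ne_zero hν Q
      have hmt := wm_carrier_ne_top hν Q
      calc _ = ENNReal.ofReal (osc Q b / wInt Q ν) * wm ν Q.carrier ^ (1 / r) := by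
            have he : -(1 / p + 1 / conj q) = -1 + 1 / r := by rw [hr, one_div_conj hq]; ring
            rw [ENNReal.ofReal_div_of_pos h3, ← wm_carrier hν, ENNReal.div_eq_inv_mul,
              ENNReal.div_eq_inv_mul, ← ENNReal.rpow_neg, he, ENNReal.rpow_add _ _ hm0 hmt,
              ENNReal.rpow_neg_one]
            ring
        _ ≤ lavg (wm ν) Q (sharpFin G ν b) * wm ν Q.carrier ^ (1 / r) := by gcongr
        _ = _ := by
            rw [ENNReal.mul_rpow_of_nonneg _ _ hr0.le, ← ENNReal.rpow_mul,
              mul_one_div_cancel (by linarith), ENNReal.rpow_one]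
    gcongr
  calc _ ≤ ∑ Q ∈ G, B * (X Q ^ (1 / p) * Y Q ^ (1 / conj q) * Z Q ^ (1 / r)) :=
        Finset.sum_le_sum hterm
    _ = B * ∑ Q ∈ G, X Q ^ (1 / p) * Y Q ^ (1 / conj q) * Z Q ^ (1 / r) := by rw [Finset.mul_sum]
    _ ≤ B * ((∑ Q ∈ G, X Q) ^ (1 / p) * (∑ Q ∈ G, Y Q) ^ (1 / conj q) *
          (∑ Q ∈ G, Z Q) ^ (1 / r)) := by
        gcongr
        refine sum_rpow_mul_rpow_mul_rpow_le G X Y Z hp0 (by positivity) hr0 ?_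
        rw [one_div_conj hq, hr]; ring
    _ ≤ B * ((embC p * K₁ * ∫⁻ x, ENNReal.ofReal (|f x| ^ p * μ x)) ^ (1 / p) *
        (embC (conj q) * K₂ * ∫⁻ x, ENNReal.ofReal (|g x| ^ conj q * lam x)) ^ (1 / conj q) *
        (embC r * K₃ *
          ∫⁻ x, sharpMaxOn D.cubes ν b x ^ r * ENNReal.ofReal (ν x)) ^ (1 / r)) := by
        gcongr
    _ = _ := by
        rw [ENNReal.mul_rpow_of_nonneg _ _ hp0.le, ENNReal.mul_rpow_of_nonneg (embC (conj q) * K₂) _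
          (by positivity), ENNReal.mul_rpow_of_nonneg (embC r * K₃) _ hr0.le, wnorm, wnorm,
          sharpNormOn, wnormE]
        ring

namespace DyadicLattice

variable {D : DyadicLattice d}

lemma exists_abs_DQ_le {Q : Cube d} (hQ : Q ∈ D.cubes) (b : Rd d → ℝ) :
    ∃ M : ℝ, ∀ x, |D.DQ Q b x| ≤ M := by
  refine ⟨∑ R ∈ D.ch Q, |avg R b - avg Q b|, fun x => ?_⟩
  rw [DQ_eq_sum hQ]
  refine (Finset.abs_sum_le_sum_abs _ _).trans (Finset.sum_le_sum fun R _ => ?_)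
  by_cases hx : x ∈ R.carrier <;> simp [hx]

lemma integrable_DQ_mul {Q : Cube d} (hQ : Q ∈ D.cubes) (b : Rd d → ℝ) {h : Rd d → ℝ}
    (hh : IntegrableOn h Q.carrier volume) : Integrable (fun x => D.DQ Q b x * h x) volume := by
  obtain ⟨M, hM⟩ := exists_abs_DQ_le hQ b
  have e : (fun x => D.DQ Q b x * h x) = Q.carrier.indicator fun x => D.DQ Q b x * h x := by
    ext x
    by_cases hx : x ∈ Q.carrier
    · rw [Set.indicator_of_mem hx]
    · rw [Set.indicator_of_notMem hx, DQ_eq_zero b hx, zero_mul]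
  rw [e, integrable_indicator_iff Q.measurableSet_carrier]
  exact hh.bdd_mul (c := M) (measurable_DQ hQ b).aestronglyMeasurable (ae_of_all _ hM)

end DyadicLattice

lemma integrableOn_of_wnorm {p : ℝ} (hp : 1 < p) {μ : Rd d → ℝ} (hμ : IsWeight μ)
    (hμ' : LocallyIntegrable (dualW p μ) volume) {f : Rd d → ℝ} (hf : Measurable f)
    (hfp : wnorm p μ f < ⊤) (Q : Cube d) : IntegrableOn f Q.carrier volume := by
  have hp0 : 0 < p := by linarith
  have hp' := one_lt_conj hp
  have hpc : p.HolderConjugate (conj p) := by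
    rw [Real.holderConjugate_iff]; refine ⟨hp, ?_⟩
    rw [← one_div, ← one_div, one_div_conj hp]; ring
  have h1 : ∫⁻ x, ENNReal.ofReal (|f x| ^ p * μ x) < ⊤ := by
    rw [wnorm, ENNReal.rpow_lt_top_iff_of_pos (by positivity)] at hfp
    exact hfp
  have h2 : ∫⁻ x in Q.carrier, ENNReal.ofReal (dualW p μ x) ≠ ⊤ := by
    rw [← wm_apply _ Q.measurableSet_carrier]
    exact wm_carrier_ne_top (isWeight_dualW hμ hμ') Q
  refine ⟨hf.aestronglyMeasurable, ?_⟩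
  rw [hasFiniteIntegral_iff_norm]
  have hle : ∀ x, ENNReal.ofReal ‖f x‖ ≤
      ENNReal.ofReal (|f x| ^ p * μ x) + ENNReal.ofReal (dualW p μ x) := by
    intro x
    have hx := hμ.1 x
    have hd : 0 < dualW p μ x := (isWeight_dualW hμ hμ').1 x
    rw [← ENNReal.ofReal_add (by positivity) hd.le, Real.norm_eq_abs]
    refine ENNReal.ofReal_le_ofReal ?_
    have hy := Real.young_inequality_of_nonneg (a := |f x| * μ x ^ (1 / p))
      (b := μ x ^ (-(1 / p))) (by positivity) (by positivity) hpc
    rw [mul_assoc, ← Real.rpow_add hx, add_neg_cancel, Real.rpow_zero, mul_one,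
      Real.mul_rpow (abs_nonneg _) (by positivity), ← Real.rpow_mul hx.le, ← Real.rpow_mul hx.le,
      one_div_mul_cancel hp0.ne', Real.rpow_one] at hy
    have e : -(1 / p) * conj p = -(conj p / p) := by ring
    rw [e] at hy
    refine hy.trans (add_le_add ?_ ?_)
    · exact div_le_self (by positivity) hp.le
    · exact div_le_self hd.le hp'.le
  calc _ ≤ ∫⁻ x in Q.carrier,
        (ENNReal.ofReal (|f x| ^ p * μ x) + ENNReal.ofReal (dualW p μ x)) :=
        lintegral_mono hle
    _ = (∫⁻ x in Q.carrier, ENNReal.ofReal (|f x| ^ p * μ x)) +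
        ∫⁻ x in Q.carrier, ENNReal.ofReal (dualW p μ x) := by
        refine lintegral_add_right _ ?_
        exact (isWeight_dualW hμ hμ').2.1.ennreal_ofReal
    _ < ⊤ := ENNReal.add_lt_top.mpr
        ⟨(setLIntegral_le_lintegral _ _).trans_lt h1, lt_top_iff_ne_top.mpr h2⟩

/-- Signed finite partial sums of the paraproduct. -/
def signedSum (D : DyadicLattice d) (b f : Rd d → ℝ) (c : Cube d → ℝ) (F : Finset (Cube d))
    (x : Rd d) : ℝ :=
  ∑ Q ∈ F, c Q * (D.DQ Q b x * avg Q f)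

lemma measurable_signedSum {D : DyadicLattice d} (b f : Rd d → ℝ) (c : Cube d → ℝ)
    {F : Finset (Cube d)} (hF : ∀ Q ∈ F, Q ∈ D.cubes) : Measurable (signedSum D b f c F) :=
  Finset.measurable_sum _ fun Q hQ =>
    ((DyadicLattice.measurable_DQ (hF Q hQ) b).mul_const _).const_mul _

/-- All signed finite partial sums of the paraproduct are bounded by `N`. -/
def PartialBound (D : DyadicLattice d) (p q : ℝ) (μ lam b : Rd d → ℝ) (N : ℝ≥0∞) : Prop :=
  ∀ F : Finset (Cube d), (∀ Q ∈ F, Q ∈ D.cubes) → ∀ c : Cube d → ℝ, (∀ Q, |c Q| ≤ 1) →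
    ∀ f : Rd d → ℝ, Measurable f → wnorm p μ f < ⊤ →
      wnorm q lam (signedSum D b f c F) ≤ N * wnorm p μ f

lemma SparseBound.partialBound {D : DyadicLattice d} (hd : 0 < d) {p q : ℝ} (hp : 1 < p)
    (hq : 1 < q) {μ lam b : Rd d → ℝ} (hμ : IsWeight μ) (hlam : IsWeight lam)
    (hμ' : LocallyIntegrable (dualW p μ) volume) (hb : L1loc b) {N : ℝ≥0∞}
    (hN : SparseBound D p q μ lam b N) :
    PartialBound D p q μ lam b (ENNReal.ofReal (6 * (2 ^ d * 6) ^ 2) * N) := by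
  intro F hF c hc f hf hfp
  have hq0 : 0 < q := by linarith
  have hq' := one_lt_conj hq
  have hfi := integrableOn_of_wnorm hp hμ hμ' hf hfp
  have hbi : ∀ Q : Cube d, IntegrableOn b Q.carrier volume :=
    fun Q => Q.integrableOn_carrier hb.2
  set u := signedSum D b f c F with hu
  have hum : Measurable u := measurable_signedSum b f c hF
  obtain ⟨M, hM⟩ : ∃ M : ℝ, ∀ x, |u x| ≤ M := by
    have : ∀ Q : Cube d, ∃ M : ℝ, Q ∈ F → ∀ x, |D.DQ Q b x| ≤ M := by
      intro Q
      by_cases hQ : Q ∈ F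
      · obtain ⟨M, hM⟩ := DyadicLattice.exists_abs_DQ_le (hF Q hQ) b
        exact ⟨M, fun _ => hM⟩
      · exact ⟨0, fun h => absurd h hQ⟩
    choose m hm using this
    refine ⟨∑ Q ∈ F, m Q * |avg Q f|, fun x => ?_⟩
    refine (Finset.abs_sum_le_sum_abs _ _).trans (Finset.sum_le_sum fun Q hQ => ?_)
    rw [abs_mul, abs_mul]
    have h1 := hm Q hQ x
    calc |c Q| * (|D.DQ Q b x| * |avg Q f|) ≤ 1 * (|D.DQ Q b x| * |avg Q f|) := by
          gcongr; exact hc Q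
      _ ≤ _ := by rw [one_mul]; gcongr
  set g : Rd d → ℝ := fun x => u x * |u x| ^ (q - 2) with hg
  have hgm : Measurable g := hum.mul ((measurable_abs.comp hum).pow_const _)
  have hgabs : ∀ x, |g x| = |u x| ^ (q - 1) := by
    intro x
    rcases eq_or_ne (u x) 0 with h0 | h0
    · simp [hg, h0, Real.zero_rpow (by linarith : q - 1 ≠ 0)]
    · rw [hg]
      simp only [abs_mul]
      rw [abs_of_nonneg (Real.rpow_nonneg (abs_nonneg (u x)) _)]
      conv_lhs => rw [← Real.rpow_one |u x|]
      rw [← Real.rpow_mul (abs_nonneg _), ← Real.rpow_add (abs_pos.mpr h0)]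
      congr 1; ring
  have hug : ∀ x, u x * g x = |u x| ^ q := by
    intro x
    rcases eq_or_ne (u x) 0 with h0 | h0
    · simp [h0, Real.zero_rpow hq0.ne']
    · have : u x * g x = |u x| * |g x| := by
        rw [← abs_mul, hg]
        simp only [← mul_assoc]
        rw [abs_mul, abs_of_nonneg (mul_self_nonneg (u x)),
          abs_of_nonneg (Real.rpow_nonneg (abs_nonneg (u x)) _)]
      rw [this, hgabs]
      conv_lhs => rw [← Real.rpow_one |u x|]
      rw [← Real.rpow_mul (abs_nonneg _), ← Real.rpow_add (abs_pos.mpr h0)]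
      congr 1; ring
  have hgM : ∀ x, ‖g x‖ ≤ M ^ (q - 1) := fun x => by
    rw [Real.norm_eq_abs, hgabs]
    exact Real.rpow_le_rpow (abs_nonneg _) (hM x) (by linarith)
  set h : Rd d → ℝ := fun x => lam x * g x with hh
  have hhi : ∀ Q : Cube d, IntegrableOn h Q.carrier volume := fun Q =>
    (Q.integrableOn_carrier hlam.2.2).mul_bdd hgm.aestronglyMeasurable (ae_of_all _ hgM)
  have hexp : (fun x => u x * h x) = fun x => ∑ Q ∈ F, c Q * avg Q f * (D.DQ Q b x * h x) := by
    ext x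
    rw [hu, signedSum, Finset.sum_mul]
    exact Finset.sum_congr rfl fun Q _ => by ring
  have huhi : Integrable (fun x => u x * h x) volume := by
    rw [hexp]
    exact integrable_finsetSum _ fun Q hQ =>
      (DyadicLattice.integrable_DQ_mul (hF Q hQ) b (hhi Q)).const_mul _
  have huh : ∀ x, u x * h x = |u x| ^ q * lam x := fun x => by
    rw [← hug]; simp only [hh]; ring
  set X := ∫⁻ x, ENNReal.ofReal (|u x| ^ q * lam x) with hX
  have hXeq : X = ENNReal.ofReal (∫ x, u x * h x) := by
    rw [ofReal_integral_eq_lintegral_ofReal huhi (ae_of_all _ fun x => ?_)]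
    · simp only [huh, hX]
    · have := (hlam.1 x).le
      simp only [huh, Pi.zero_apply]; positivity
  have hXt : X ≠ ⊤ := by rw [hXeq]; exact ENNReal.ofReal_ne_top
  have hpar : ∫ x, u x * h x ≤ ∑ Q ∈ F, paraTerm D b f h Q := by
    rw [hexp, integral_finsetSum _ fun Q hQ =>
      (DyadicLattice.integrable_DQ_mul (hF Q hQ) b (hhi Q)).const_mul _]
    refine Finset.sum_le_sum fun Q hQ => ?_
    rw [integral_const_mul, DyadicLattice.integral_DQ_mul (hF Q hQ) b (hhi Q), paraTerm]
    refine (le_abs_self _).trans ?_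
    rw [abs_mul, abs_mul]
    calc _ ≤ 1 * |avg Q f| * |∑ R ∈ D.ch Q, (avg R b - avg Q b) * intC R h| := by
          gcongr; exact hc Q
      _ = _ := by rw [one_mul]
  obtain ⟨G, hG, hGs, hGle⟩ := sparse_domination (f := f) hd hbi hhi F hF
  have hsb := hN G hG (hGs.sparseFin hd hbi hfi hhi) f g hf hgm hfi hhi
  have hgn : wnorm (conj q) lam g = X ^ (1 / conj q) := by
    rw [wnorm, hX]
    congr 2
    ext x
    rw [hgabs, ← Real.rpow_mul (abs_nonneg _)]
    congr 3
    have : q - 1 ≠ 0 := by linarith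
    unfold conj; field_simp
  have hmain : X ≤ ENNReal.ofReal (6 * (2 ^ d * 6) ^ 2) * N * wnorm p μ f * X ^ (1 / conj q) := by
    calc X ≤ ENNReal.ofReal (6 * (2 ^ d * 6) ^ 2 * ∑ T ∈ G, sparseTerm b f h T) := by
          rw [hXeq]; exact ENNReal.ofReal_le_ofReal (hpar.trans hGle)
      _ = ENNReal.ofReal (6 * (2 ^ d * 6) ^ 2) * ∑ T ∈ G, ENNReal.ofReal (sparseTerm b f h T) := by
          rw [ENNReal.ofReal_mul (by positivity),
            ENNReal.ofReal_sum_of_nonneg fun T _ => sparseTerm_nonneg b f h T]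
      _ ≤ ENNReal.ofReal (6 * (2 ^ d * 6) ^ 2) *
          (N * (wnorm p μ f * wnorm (conj q) lam g)) := by gcongr
      _ = _ := by rw [hgn]; ring
  change X ^ (1 / q) ≤ _
  rcases eq_or_ne X 0 with h0 | h0
  · rw [h0, ENNReal.zero_rpow_of_pos (by positivity)]; exact zero_le
  · have hX1 : X = X ^ (1 / q) * X ^ (1 / conj q) := by
      rw [← ENNReal.rpow_add _ _ h0 hXt, one_div_conj hq, add_sub_cancel, ENNReal.rpow_one]
    have h0' : X ^ (1 / conj q) ≠ 0 := by
      rw [Ne, ENNReal.rpow_eq_zero_iff]; simp [h0, hXt]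
    have ht' : X ^ (1 / conj q) ≠ ⊤ := ENNReal.rpow_ne_top_of_nonneg (by positivity) hXt
    refine (ENNReal.mul_le_mul_iff_left h0' ht').mp ?_
    rw [← hX1]; exact hmain

/-- The sign attached to an index by a set of indices. -/
def sgn {ι : Type*} [DecidableEq ι] (t : Finset ι) (i : ι) : ℝ := if i ∈ t then 1 else -1

section Signs

variable {ι : Type*} [DecidableEq ι]

lemma sum_powerset_insert_signed {i : ι} {s : Finset ι} (hi : i ∉ s) (a : ι → ℝ) (φ : ℝ → ℝ) :
    ∑ t ∈ (insert i s).powerset, φ (∑ k ∈ insert i s, sgn t k * a k) =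
      ∑ t ∈ s.powerset, (φ (∑ k ∈ s, sgn t k * a k - a i) +
        φ (∑ k ∈ s, sgn t k * a k + a i)) := by
  rw [Finset.sum_powerset_insert hi, ← Finset.sum_add_distrib]
  refine Finset.sum_congr rfl fun t ht => ?_
  have hit : i ∉ t := fun h => hi (Finset.mem_powerset.mp ht h)
  rw [Finset.sum_insert hi, Finset.sum_insert hi]
  have e : ∑ k ∈ s, sgn (insert i t) k * a k = ∑ k ∈ s, sgn t k * a k := by
    refine Finset.sum_congr rfl fun k hk => ?_
    have : k ≠ i := fun h => hi (h ▸ hk)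
    simp [sgn, this]
  rw [e]
  simp only [sgn, hit, if_false, Finset.mem_insert_self, if_true]
  congr 2 <;> ring

lemma sum_signed_sq (s : Finset ι) (a : ι → ℝ) :
    ∑ t ∈ s.powerset, (∑ k ∈ s, sgn t k * a k) ^ 2 = 2 ^ s.card * ∑ k ∈ s, a k ^ 2 := by
  induction s using Finset.induction_on with
  | empty => simp
  | insert i s hi ih =>
    rw [sum_powerset_insert_signed hi a (· ^ 2), Finset.sum_insert hi, Finset.card_insert_of_notMem hi]
    have : ∀ t ∈ s.powerset, ((∑ k ∈ s, sgn t k * a k - a i) ^ 2 +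
        (∑ k ∈ s, sgn t k * a k + a i) ^ 2) = 2 * (∑ k ∈ s, sgn t k * a k) ^ 2 + 2 * a i ^ 2 :=
      fun t _ => by ring
    rw [Finset.sum_congr rfl this, Finset.sum_add_distrib, ← Finset.mul_sum, ih]
    simp only [Finset.sum_const, Finset.card_powerset, nsmul_eq_mul]
    push_cast; ring

lemma sum_signed_pow_four_le (s : Finset ι) (a : ι → ℝ) :
    ∑ t ∈ s.powerset, (∑ k ∈ s, sgn t k * a k) ^ 4 ≤
      2 ^ s.card * (3 * (∑ k ∈ s, a k ^ 2) ^ 2) := by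
  induction s using Finset.induction_on with
  | empty => simp
  | insert i s hi ih =>
    rw [sum_powerset_insert_signed hi a (· ^ 4), Finset.sum_insert hi, Finset.card_insert_of_notMem hi]
    have : ∀ t ∈ s.powerset, ((∑ k ∈ s, sgn t k * a k - a i) ^ 4 +
        (∑ k ∈ s, sgn t k * a k + a i) ^ 4) = 2 * (∑ k ∈ s, sgn t k * a k) ^ 4 +
          12 * a i ^ 2 * (∑ k ∈ s, sgn t k * a k) ^ 2 + 2 * a i ^ 4 :=
      fun t _ => by ring
    rw [Finset.sum_congr rfl this, Finset.sum_add_distrib, Finset.sum_add_distrib,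
      ← Finset.mul_sum, ← Finset.mul_sum, sum_signed_sq]
    simp only [Finset.sum_const, Finset.card_powerset, nsmul_eq_mul]
    push_cast
    have h2 : (0 : ℝ) < 2 ^ s.card := by positivity
    have h4 : 0 ≤ a i ^ 4 := by positivity
    rw [pow_succ (2 : ℝ) s.card]
    nlinarith [mul_nonneg h2.le h4]

lemma abs_rpow_eq_mul {q T x : ℝ} (hT : 0 < T) :
    |x| ^ q = T ^ (q / 2) * (x ^ 2 / T) ^ (q / 2) := by
  rw [← Real.mul_rpow hT.le (by positivity), mul_div_cancel₀ _ hT.ne', ← sq_abs,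
    ← Real.rpow_natCast, ← Real.rpow_mul (abs_nonneg _)]
  congr 1; push_cast; ring

/-- A lower Khintchine inequality. -/
lemma exists_khintchine_lower {q : ℝ} (hq : 0 < q) :
    ∃ c : ℝ, 0 < c ∧ ∀ (s : Finset ι) (a : ι → ℝ),
      c * (2 ^ s.card * (∑ k ∈ s, a k ^ 2) ^ (q / 2)) ≤
        ∑ t ∈ s.powerset, |∑ k ∈ s, sgn t k * a k| ^ q := by
  have hq2 : 0 < q / 2 := by positivity
  rcases le_total q 2 with h2 | h2
  · refine ⟨6 ^ (q / 2) / 12, by positivity, fun s a => ?_⟩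
    set S := ∑ k ∈ s, a k ^ 2 with hS
    have hS0 : 0 ≤ S := Finset.sum_nonneg fun _ _ => sq_nonneg _
    rcases hS0.eq_or_lt with h0 | h0
    · rw [← h0, Real.zero_rpow hq2.ne', mul_zero, mul_zero]
      exact Finset.sum_nonneg fun _ _ => by positivity
    have hT : 0 < 6 * S := by positivity
    have hpt : ∀ t ∈ s.powerset, (6 * S) ^ (q / 2) * ((∑ k ∈ s, sgn t k * a k) ^ 2 / (6 * S) -
        (∑ k ∈ s, sgn t k * a k) ^ 4 / (6 * S) ^ 2) ≤ |∑ k ∈ s, sgn t k * a k| ^ q := by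
      intro t _
      rw [abs_rpow_eq_mul hT]
      gcongr
      set x := ∑ k ∈ s, sgn t k * a k
      have e : x ^ 4 / (6 * S) ^ 2 = (x ^ 2 / (6 * S)) ^ 2 := by rw [div_pow]; ring
      rw [e]
      have hy : 0 ≤ x ^ 2 / (6 * S) := by positivity
      set y := x ^ 2 / (6 * S)
      rcases le_total y 1 with h1 | h1
      · have := Real.rpow_le_rpow_of_exponent_ge_of_imp hy h1 (by linarith : q / 2 ≤ 1)
          (fun _ h => absurd h one_ne_zero)
        rw [Real.rpow_one] at this
        nlinarith [sq_nonneg y]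
      · have := Real.rpow_nonneg hy (q / 2)
        nlinarith
    refine le_trans ?_ (Finset.sum_le_sum hpt)
    rw [← Finset.mul_sum, Finset.sum_sub_distrib, ← Finset.sum_div, ← Finset.sum_div,
      sum_signed_sq, ← hS, Real.mul_rpow (by norm_num) hS0]
    have h4 := sum_signed_pow_four_le s a
    rw [← hS] at h4
    have h5 : (2 : ℝ) ^ s.card / 12 ≤ 2 ^ s.card * S / (6 * S) -
        (∑ t ∈ s.powerset, (∑ k ∈ s, sgn t k * a k) ^ 4) / (6 * S) ^ 2 := by
      calc (2 : ℝ) ^ s.card / 12 = 2 ^ s.card * S / (6 * S) -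
            2 ^ s.card * (3 * S ^ 2) / (6 * S) ^ 2 := by field_simp; norm_num
        _ ≤ _ := by gcongr
    calc _ = 6 ^ (q / 2) * S ^ (q / 2) * ((2 : ℝ) ^ s.card / 12) := by ring
      _ ≤ _ := by gcongr
  · refine ⟨(1 / 2) ^ (q / 2), by positivity, fun s a => ?_⟩
    set S := ∑ k ∈ s, a k ^ 2 with hS
    have hS0 : 0 ≤ S := Finset.sum_nonneg fun _ _ => sq_nonneg _
    rcases hS0.eq_or_lt with h0 | h0
    · rw [← h0, Real.zero_rpow hq2.ne', mul_zero, mul_zero]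
      exact Finset.sum_nonneg fun _ _ => by positivity
    have hT : 0 < 1 / 2 * S := by positivity
    have hpt : ∀ t ∈ s.powerset, (1 / 2 * S) ^ (q / 2) *
        ((∑ k ∈ s, sgn t k * a k) ^ 2 / (1 / 2 * S) - 1) ≤ |∑ k ∈ s, sgn t k * a k| ^ q := by
      intro t _
      rw [abs_rpow_eq_mul hT]
      gcongr
      set x := ∑ k ∈ s, sgn t k * a k
      have hy : 0 ≤ x ^ 2 / (1 / 2 * S) := by positivity
      set y := x ^ 2 / (1 / 2 * S)
      rcases le_total y 1 with h1 | h1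
      · have := Real.rpow_nonneg hy (q / 2)
        linarith
      · have := Real.rpow_le_rpow_of_exponent_le h1 (by linarith : 1 ≤ q / 2)
        rw [Real.rpow_one] at this
        linarith
    refine le_trans ?_ (Finset.sum_le_sum hpt)
    rw [← Finset.mul_sum, Finset.sum_sub_distrib, ← Finset.sum_div,
      sum_signed_sq, ← hS, Real.mul_rpow (by norm_num) hS0]
    simp only [Finset.sum_const, Finset.card_powerset, nsmul_eq_mul, mul_one]
    have : (2 : ℝ) ^ s.card * S / (1 / 2 * S) - (2 : ℝ) ^ s.card = 2 ^ s.card := by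
      field_simp; ring
    push_cast
    rw [this]
    exact le_of_eq (by ring)

lemma exists_sum_enorm_rpow_le {q : ℝ} (hq : 0 < q) :
    ∃ c κ : ℝ, 0 < c ∧ κ < 1 ∧ 0 ≤ κ ∧ ∀ (s : Finset ι) (a : ι → ℝ),
      ENNReal.ofReal c * (2 ^ s.card * ∑ k ∈ s, ‖a k‖ₑ ^ q) ≤
        (s.card : ℝ≥0∞) ^ κ * ∑ t ∈ s.powerset, ‖∑ k ∈ s, sgn t k * a k‖ₑ ^ q := by
  obtain ⟨c, hc, hk⟩ := exists_khintchine_lower (ι := ι) hq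
  have hq2 : 0 < q / 2 := by positivity
  have hen : ∀ x : ℝ, ‖x‖ₑ ^ q = ENNReal.ofReal (|x| ^ q) := fun x => by
    rw [← ofReal_norm, Real.norm_eq_abs,
      ENNReal.ofReal_rpow_of_nonneg (abs_nonneg _) hq.le]
  have hk' : ∀ (s : Finset ι) (a : ι → ℝ),
      ENNReal.ofReal c * (2 ^ s.card * (∑ k ∈ s, ENNReal.ofReal (a k ^ 2)) ^ (q / 2)) ≤
        ∑ t ∈ s.powerset, ‖∑ k ∈ s, sgn t k * a k‖ₑ ^ q := by
    intro s a
    simp only [hen]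
    rw [← ENNReal.ofReal_sum_of_nonneg fun _ _ => by positivity,
      ← ENNReal.ofReal_sum_of_nonneg fun _ _ => by positivity,
      ENNReal.ofReal_rpow_of_nonneg (Finset.sum_nonneg fun _ _ => by positivity) hq2.le,
      show (2 : ℝ≥0∞) = ENNReal.ofReal 2 by simp, ← ENNReal.ofReal_pow (by norm_num),
      ← ENNReal.ofReal_mul (by positivity), ← ENNReal.ofReal_mul hc.le]
    exact ENNReal.ofReal_le_ofReal (hk s a)
  have hsq : ∀ x : ℝ, ‖x‖ₑ ^ q = ENNReal.ofReal (x ^ 2) ^ (q / 2) := fun x => by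
    rw [hen, ENNReal.ofReal_rpow_of_nonneg (sq_nonneg _) hq2.le,
      abs_rpow_eq_mul one_pos]
    simp
  have main : ∃ κ : ℝ, κ < 1 ∧ 0 ≤ κ ∧ ∀ (s : Finset ι) (a : ι → ℝ), ∑ k ∈ s, ‖a k‖ₑ ^ q ≤
      (s.card : ℝ≥0∞) ^ κ * (∑ k ∈ s, ENNReal.ofReal (a k ^ 2)) ^ (q / 2) := by
    rcases lt_or_ge q 2 with h2 | h2
    · refine ⟨1 - q / 2, by linarith, by linarith, fun s a => ?_⟩
      simp only [hsq]
      have := sum_rpow_mul_rpow_le s (fun k => ENNReal.ofReal (a k ^ 2)) (fun _ => 1) hq2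
        (by linarith : 0 < 1 - q / 2) (by ring)
      simpa [mul_comm] using this
    · refine ⟨0, by norm_num, le_rfl, fun s a => ?_⟩
      simp only [hsq, ENNReal.rpow_zero, one_mul]
      exact sum_rpow_le_rpow_sum s _ (by linarith)
  obtain ⟨κ, h1, h0, hm⟩ := main
  refine ⟨c, κ, hc, h1, h0, fun s a => ?_⟩
  calc _ ≤ ENNReal.ofReal c * (2 ^ s.card * ((s.card : ℝ≥0∞) ^ κ *
        (∑ k ∈ s, ENNReal.ofReal (a k ^ 2)) ^ (q / 2))) := by gcongr; exact hm s a
    _ = (s.card : ℝ≥0∞) ^ κ * (ENNReal.ofReal c *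
        (2 ^ s.card * (∑ k ∈ s, ENNReal.ofReal (a k ^ 2)) ^ (q / 2))) := by ring
    _ ≤ _ := by gcongr; exact hk' s a

end Signs

section LpSummable

variable {Ω ι : Type*} [MeasurableSpace Ω] {m : Measure Ω} {q : ℝ}

lemma Lp_enorm_rpow (hq : 0 < q) (v : Lp ℝ (ENNReal.ofReal q) m) :
    ‖v‖ₑ ^ q = ∫⁻ x, ‖v x‖ₑ ^ q ∂m := by
  rw [Lp.enorm_def, eLpNorm_eq_lintegral_rpow_enorm_toReal (by simpa using hq) ENNReal.ofReal_ne_top,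
    ENNReal.toReal_ofReal hq.le, ← ENNReal.rpow_mul, one_div_mul_cancel hq.ne', ENNReal.rpow_one]

lemma exists_sum_Lp_enorm_rpow_le [DecidableEq ι] (hq : 0 < q) :
    ∃ c κ : ℝ, 0 < c ∧ κ < 1 ∧ 0 ≤ κ ∧
      ∀ (s : Finset ι) (v : ι → Lp ℝ (ENNReal.ofReal q) m),
      ENNReal.ofReal c * (2 ^ s.card * ∑ k ∈ s, ‖v k‖ₑ ^ q) ≤
        (s.card : ℝ≥0∞) ^ κ * ∑ t ∈ s.powerset, ‖∑ k ∈ s, sgn t k • v k‖ₑ ^ q := by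
  obtain ⟨c, κ, hc, h1, h0, hk⟩ := exists_sum_enorm_rpow_le (ι := ι) hq
  refine ⟨c, κ, hc, h1, h0, fun s v => ?_⟩
  have hmeas : ∀ w : Lp ℝ (ENNReal.ofReal q) m, AEMeasurable (fun x => ‖w x‖ₑ ^ q) m :=
    fun w => (Lp.aestronglyMeasurable w).enorm.pow_const q
  have hae : ∀ t : Finset ι, (fun x => ‖(∑ k ∈ s, sgn t k • v k : Lp ℝ (ENNReal.ofReal q) m) x‖ₑ ^ q)
      =ᵐ[m] fun x => ‖∑ k ∈ s, sgn t k * v k x‖ₑ ^ q := by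
    intro t
    have h2 : ∀ᵐ x ∂m, ∀ k ∈ s, (sgn t k • v k : Lp ℝ (ENNReal.ofReal q) m) x = sgn t k * v k x := by
      rw [Filter.eventually_all_finset]
      exact fun k _ => Lp.coeFn_smul (sgn t k) (v k)
    filter_upwards [Lp.coeFn_fun_finsetSum s fun k => sgn t k • v k, h2] with x h1 h2
    rw [h1, Finset.sum_congr rfl h2]
  simp only [Lp_enorm_rpow hq]
  rw [← lintegral_finsetSum' _ fun k _ => hmeas (v k), ← lintegral_finsetSum' _ fun t _ => hmeas _]
  have hm1 : AEMeasurable (fun x => ∑ k ∈ s, ‖v k x‖ₑ ^ q) m :=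
    Finset.aemeasurable_fun_sum _ fun k _ => hmeas (v k)
  rw [← mul_assoc, ← lintegral_const_mul'' _ hm1,
    ← lintegral_const_mul' _ _ (ENNReal.rpow_ne_top_of_nonneg h0 (ENNReal.natCast_ne_top _))]
  have hall : ∀ᵐ x ∂m, ∀ t ∈ s.powerset,
      ‖(∑ k ∈ s, sgn t k • v k : Lp ℝ (ENNReal.ofReal q) m) x‖ₑ ^ q =
        ‖∑ k ∈ s, sgn t k * v k x‖ₑ ^ q := by
    rw [Filter.eventually_all_finset]
    exact fun t _ => hae t
  refine lintegral_mono_ae ?_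
  filter_upwards [hall] with x hx
  rw [Finset.sum_congr rfl hx, mul_assoc]
  exact hk s fun k => v k x

/-- In `L^q`, a series all of whose signed finite partial sums are bounded is summable. -/
lemma summable_of_signed_bounded [Fact (1 ≤ ENNReal.ofReal q)] (hq : 0 < q)
    (V : ι → Lp ℝ (ENNReal.ofReal q) m) {N : ℝ≥0∞} (hN : N ≠ ⊤)
    (h : ∀ (F : Finset ι) (c : ι → ℝ), (∀ i, |c i| ≤ 1) → ‖∑ i ∈ F, c i • V i‖ₑ ≤ N) :
    Summable V := by
  classical
  rw [summable_iff_vanishing_norm]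
  by_contra! hcon
  obtain ⟨ε, hε, hs⟩ := hcon
  obtain ⟨B, hB, hdis⟩ := exists_seq_of_forall_finset_exists
    (fun t : Finset ι => ε ≤ ‖∑ i ∈ t, V i‖) (fun s t => Disjoint s t) (by
      intro S _
      obtain ⟨t, ht, hle⟩ := hs (S.biUnion id)
      refine ⟨t, hle, fun s hsS => ?_⟩
      exact (Finset.disjoint_of_subset_right (Finset.subset_biUnion_of_mem id hsS) ht).symm)
  have hdis' : ∀ k l i, i ∈ B k → i ∈ B l → k = l := by
    intro k l i hk hl
    rcases lt_trichotomy k l with h | h | h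
    · exact absurd hl (Finset.disjoint_left.mp (hdis k l h) hk)
    · exact h
    · exact absurd hk (Finset.disjoint_left.mp (hdis l k h) hl)
  obtain ⟨c, κ, hc, h1, h0, hk⟩ := exists_sum_Lp_enorm_rpow_le (ι := ℕ) (m := m) hq
  have hbd : ∀ n : ℕ, ∀ t ∈ (Finset.range n).powerset,
      ‖∑ k ∈ Finset.range n, sgn t k • ∑ i ∈ B k, V i‖ₑ ≤ N := by
    intro n t _
    have e : ∑ k ∈ Finset.range n, sgn t k • ∑ i ∈ B k, V i =
        ∑ i ∈ (Finset.range n).biUnion B, (if ∃ k ∈ t, i ∈ B k then (1 : ℝ) else -1) • V i := by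
      rw [Finset.sum_biUnion]
      · refine Finset.sum_congr rfl fun k _ => ?_
        rw [Finset.smul_sum]
        refine Finset.sum_congr rfl fun i hi => ?_
        have : (∃ l ∈ t, i ∈ B l) ↔ k ∈ t :=
          ⟨fun ⟨l, hl, hil⟩ => (hdis' k l i hi hil) ▸ hl, fun hkt => ⟨k, hkt, hi⟩⟩
        rw [sgn]
        simp only [this]
      · intro k _ l _ hkl
        exact Finset.disjoint_left.mpr fun i hi hi' => hkl (hdis' k l i hi hi')
    rw [e]
    exact h _ _ fun i => by split_ifs <;> simp
  have hmain : ∀ n : ℕ, c * ε ^ q * n ≤ (n : ℝ) ^ κ * N.toReal ^ q := by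
    intro n
    have h2 := hk (Finset.range n) fun k => ∑ i ∈ B k, V i
    rw [Finset.card_range] at h2
    have hlow : (n : ℝ≥0∞) * ENNReal.ofReal ε ^ q ≤
        ∑ k ∈ Finset.range n, ‖∑ i ∈ B k, V i‖ₑ ^ q := by
      calc (n : ℝ≥0∞) * ENNReal.ofReal ε ^ q = ∑ k ∈ Finset.range n, ENNReal.ofReal ε ^ q := by simp
        _ ≤ _ := by
          refine Finset.sum_le_sum fun k _ => ?_
          gcongr
          rw [← ofReal_norm]
          exact ENNReal.ofReal_le_ofReal (hB k)
    have hup : ∑ t ∈ (Finset.range n).powerset,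
        ‖∑ k ∈ Finset.range n, sgn t k • ∑ i ∈ B k, V i‖ₑ ^ q ≤ 2 ^ n * N ^ q := by
      calc _ ≤ ∑ t ∈ (Finset.range n).powerset, N ^ q :=
            Finset.sum_le_sum fun t ht => by gcongr; exact hbd n t ht
        _ = _ := by simp
    have h3 : ENNReal.ofReal c * (2 ^ n * (n * ENNReal.ofReal ε ^ q)) ≤
        (n : ℝ≥0∞) ^ κ * (2 ^ n * N ^ q) :=
      (by gcongr : _ ≤ _).trans (h2.trans (by gcongr))
    have h4 := ENNReal.toReal_mono (by finiteness) h3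
    simp only [ENNReal.toReal_mul, ENNReal.toReal_pow, ENNReal.toReal_ofReal hc.le,
      ← ENNReal.toReal_rpow, ENNReal.toReal_natCast, ENNReal.toReal_ofNat,
      ENNReal.toReal_ofReal hε.le] at h4
    have h2n : (0 : ℝ) < 2 ^ n := by positivity
    refine le_of_mul_le_mul_left ?_ h2n
    calc _ = c * (2 ^ n * (n * ε ^ q)) := by ring
      _ ≤ _ := h4
      _ = _ := by ring
  have hlim : Tendsto (fun n : ℕ => (n : ℝ) ^ (1 - κ)) atTop atTop :=
    (tendsto_rpow_atTop (by linarith)).comp tendsto_natCast_atTop_atTop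
  have hpos : 0 < c * ε ^ q := by positivity
  obtain ⟨n, hn, hn0⟩ := ((hlim.eventually_gt_atTop (N.toReal ^ q / (c * ε ^ q))).and
    (eventually_gt_atTop 0)).exists
  rw [div_lt_iff₀ hpos] at hn
  have hn0' : (0 : ℝ) < n := by exact_mod_cast hn0
  have h5 := hmain n
  have h6 : (n : ℝ) = (n : ℝ) ^ κ * (n : ℝ) ^ (1 - κ) := by
    rw [← Real.rpow_add hn0', add_sub_cancel, Real.rpow_one]
  have h7 : 0 < (n : ℝ) ^ κ := by positivity
  have h8 : c * ε ^ q * n = (n : ℝ) ^ κ * ((n : ℝ) ^ (1 - κ) * (c * ε ^ q)) := by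
    conv_lhs => rw [h6]
    ring
  rw [h8] at h5
  exact absurd (le_of_mul_le_mul_left h5 h7) (not_le.mpr hn)

end LpSummable

lemma wnorm_eq_eLpNorm {q : ℝ} (hq : 0 < q) {lam : Rd d → ℝ} (hlam : IsWeight lam)
    (u : Rd d → ℝ) : wnorm q lam u = eLpNorm u (ENNReal.ofReal q) (wm lam) := by
  rw [eLpNorm_eq_lintegral_rpow_enorm_toReal (by simpa using hq) ENNReal.ofReal_ne_top,
    ENNReal.toReal_ofReal hq.le, lintegral_wm hlam, wnorm]
  congr 2
  ext x
  rw [ENNReal.ofReal_mul (by positivity), mul_comm, ← ENNReal.ofReal_rpow_of_nonneg (abs_nonneg _)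
    hq.le, ← Real.norm_eq_abs, ofReal_norm]

/-- Uniformly bounded signed partial sums force unconditional convergence of the paraproduct. -/
lemma exists_uncondConvLq {D : DyadicLattice d} {p q : ℝ} (hq : 1 < q)
    {μ lam b f : Rd d → ℝ} (hlam : IsWeight lam) (hf : Measurable f) (hfp : wnorm p μ f < ⊤)
    {N₀ : ℝ≥0∞} (hN₀ : N₀ ≠ ⊤) (hP₀ : PartialBound D p q μ lam b N₀) :
    ∃ Pf : Rd d → ℝ, UncondConvLq D q lam b f Pf ∧
      ∀ N, PartialBound D p q μ lam b N → wnorm q lam Pf ≤ N * wnorm p μ f := by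
  classical
  have hq0 : 0 < q := by linarith
  have : Fact (1 ≤ ENNReal.ofReal q) := ⟨by simpa using hq.le⟩
  have hfin : N₀ * wnorm p μ f ≠ ⊤ := ENNReal.mul_ne_top hN₀ hfp.ne
  have hmem : ∀ Q : D.cubes,
      MemLp (fun x => D.DQ Q b x * avg (Q : Cube d) f) (ENNReal.ofReal q) (wm lam) := by
    intro Q
    refine ⟨((DyadicLattice.measurable_DQ Q.2 b).mul_const _).aestronglyMeasurable, ?_⟩
    rw [← wnorm_eq_eLpNorm hq0 hlam]
    have h := hP₀ {(Q : Cube d)} (by simp) (fun _ => 1) (by simp) f hf hfp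
    have e : signedSum D b f (fun _ => 1) {(Q : Cube d)} =
        fun x => D.DQ Q b x * avg (Q : Cube d) f := by
      ext x; simp [signedSum]
    rw [e] at h
    exact h.trans_lt (lt_top_iff_ne_top.mpr hfin)
  set V : D.cubes → Lp ℝ (ENNReal.ofReal q) (wm lam) := fun Q => (hmem Q).toLp _ with hV
  set ext0 : (D.cubes → ℝ) → Cube d → ℝ :=
    fun c Q => if h : Q ∈ D.cubes then c ⟨Q, h⟩ else 0 with hext
  have hcoe : ∀ (F : Finset D.cubes) (c : D.cubes → ℝ),
      ⇑(∑ i ∈ F, c i • V i) =ᵐ[wm lam]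
        signedSum D b f (ext0 c) (F.map (Function.Embedding.subtype _)) := by
    intro F c
    have h2 : ∀ᵐ x ∂(wm lam), ∀ i ∈ F, (c i • V i : Lp ℝ (ENNReal.ofReal q) (wm lam)) x =
        c i * (D.DQ i b x * avg (i : Cube d) f) := by
      rw [Filter.eventually_all_finset]
      intro i _
      filter_upwards [Lp.coeFn_smul (c i) (V i), (hmem i).coeFn_toLp] with x h1 h2
      rw [h1, Pi.smul_apply, smul_eq_mul, hV, h2]
    filter_upwards [Lp.coeFn_fun_finsetSum F fun i => c i • V i, h2] with x h1 h2
    rw [h1, Finset.sum_congr rfl h2, signedSum, Finset.sum_map]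
    refine Finset.sum_congr rfl fun i _ => ?_
    simp [hext]
  have hbd : ∀ N, PartialBound D p q μ lam b N → ∀ (F : Finset D.cubes) (c : D.cubes → ℝ),
      (∀ i, |c i| ≤ 1) → ‖∑ i ∈ F, c i • V i‖ₑ ≤ N * wnorm p μ f := by
    intro N hN F c hc
    rw [Lp.enorm_def, eLpNorm_congr_ae (hcoe F c), ← wnorm_eq_eLpNorm hq0 hlam]
    refine hN _ (by simp +contextual) _ (fun Q => ?_) f hf hfp
    simp only [hext]
    split_ifs
    · exact hc _
    · simp
  have hsum : Summable V := summable_of_signed_bounded hq0 V hfin (hbd N₀ hP₀)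
  have hlim := hsum.hasSum
  rw [HasSum, SummationFilter.unconditional_filter] at hlim
  refine ⟨⇑(∑' i, V i), fun ε hε => ?_, fun N hN => ?_⟩
  · obtain ⟨F₀, hF₀⟩ := (Metric.tendsto_atTop.mp hlim) ε hε
    refine ⟨F₀.map (Function.Embedding.subtype _), by intro Q; simp +contextual, fun F hF hFF => ?_⟩
    have hFs : (F.subtype (· ∈ D.cubes)).map (Function.Embedding.subtype _) = F :=
      Finset.subtype_map_of_mem fun Q hQ => hF hQ
    have h1 := hF₀ (F.subtype (· ∈ D.cubes)) (by
      intro Q hQ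
      rw [Finset.mem_subtype]
      exact hFF (Finset.mem_map_of_mem (Function.Embedding.subtype _) hQ))
    have h2 := hcoe (F.subtype (· ∈ D.cubes)) fun _ => 1
    simp only [one_smul] at h2
    rw [hFs] at h2
    have h3 : (fun x => parasum D b f F x - (∑' i, V i : Lp ℝ (ENNReal.ofReal q) (wm lam)) x)
        =ᵐ[wm lam] ⇑(∑ i ∈ F.subtype (· ∈ D.cubes), V i - ∑' i, V i) := by
      filter_upwards [Lp.coeFn_sub (∑ i ∈ F.subtype (· ∈ D.cubes), V i) (∑' i, V i), h2]
        with x h4 h5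
      rw [h4, Pi.sub_apply, h5, parasum, signedSum]
      congr 1
      refine Finset.sum_congr rfl fun Q hQ => ?_
      have : Q ∈ D.cubes := hF hQ
      simp [hext, this]
    rw [wnorm_eq_eLpNorm hq0 hlam, eLpNorm_congr_ae h3, ← Lp.enorm_def, ← ofReal_norm,
      ← dist_eq_norm]
    exact (ENNReal.ofReal_lt_ofReal_iff hε).mpr h1
  · rw [wnorm_eq_eLpNorm hq0 hlam, ← Lp.enorm_def]
    refine le_of_tendsto ((continuous_enorm.tendsto _).comp hlim) (Eventually.of_forall fun F => ?_)
    have := hbd N hN F (fun _ => 1) (by simp)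
    simpa using this

/-- The three weights of the Bloom condition all satisfy a Carleson embedding with finite constant. -/
lemma exists_carlesonFor {D : DyadicLattice d} {p q : ℝ} (hp : 1 < p) (hq : 1 < q)
    {μ lam ν : Rd d → ℝ} (hμ : IsWeight μ) (hlam : IsWeight lam) (hν : IsWeight ν)
    (hμ' : LocallyIntegrable (dualW p μ) volume)
    (hbloom : ∀ x, ν x ^ (1 / p + 1 / conj q) = μ x ^ (1 / p) * lam x ^ (-(1 / q)))
    (hB : BupperOn D.cubes p q (dualW p μ) lam ν < ⊤) :
    (∃ K, K ≠ ⊤ ∧ CarlesonFor D (wm (dualW p μ)) K) ∧ (∃ K, K ≠ ⊤ ∧ CarlesonFor D (wm lam) K) ∧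
      ∃ K, K ≠ ⊤ ∧ CarlesonFor D (wm ν) K := by
  have hp' := one_lt_conj hp
  have hq' := one_lt_conj hq
  have hp0 : 0 < p := by linarith
  have hq0 : 0 < q := by linarith
  have hdw := isWeight_dualW hμ hμ'
  have hw : ∀ i, IsWeight ((![dualW p μ, lam, ν] : Fin 3 → Rd d → ℝ) i) := by
    intro i; fin_cases i
    exacts [hdw, hlam, hν]
  set s : Fin 3 → ℝ := ![1 / conj p * (1 / 2), 1 / q * (1 / 2), (1 / p + 1 / conj q) * (1 / 2)] with hs
  have hs0 : ∀ i, 0 < s i := by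
    intro i; fin_cases i <;> simp [hs] <;> positivity
  have hs1 : ∑ i, s i = 1 := by
    simp only [hs, Fin.sum_univ_three, Matrix.cons_val]
    rw [one_div_conj hp, one_div_conj hq]; ring
  have h1 : ∀ x, ∏ i, (![dualW p μ, lam, ν] : Fin 3 → Rd d → ℝ) i x ^ s i = 1 := by
    intro x
    simp only [hs, Fin.prod_univ_three, Matrix.cons_val]
    have hμx := hμ.1 x
    have hlx := hlam.1 x
    have hνx := hν.1 x
    have hdx := hdw.1 x
    rw [Real.rpow_mul hdx.le, Real.rpow_mul hlx.le, Real.rpow_mul hνx.le,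
      ← Real.mul_rpow (by positivity) (by positivity),
      ← Real.mul_rpow (by positivity) (by positivity), hbloom, dualW, ← Real.rpow_mul hμx.le]
    have e : -(conj p / p) * (1 / conj p) = -(1 / p) := by field_simp
    rw [e]
    have e2 : μ x ^ (-(1 / p)) * lam x ^ (1 / q) * (μ x ^ (1 / p) * lam x ^ (-(1 / q))) =
        (μ x ^ (-(1 / p)) * μ x ^ (1 / p)) * (lam x ^ (1 / q) * lam x ^ (-(1 / q))) := by ring
    rw [e2, ← Real.rpow_add hμx, ← Real.rpow_add hlx]
    simp
  have hBt : BupperOn D.cubes p q (dualW p μ) lam ν ^ (1 / 2 : ℝ) ≠ ⊤ :=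
    ENNReal.rpow_ne_top_of_nonneg (by norm_num) hB.ne
  have hBw : ∀ Q ∈ D.cubes, ∏ i, wm ((![dualW p μ, lam, ν] : Fin 3 → Rd d → ℝ) i) Q.carrier ^ s i ≤
      BupperOn D.cubes p q (dualW p μ) lam ν ^ (1 / 2 : ℝ) * volume Q.carrier := by
    intro Q hQ
    simp only [hs, Fin.prod_univ_three, Matrix.cons_val]
    have h := ENNReal.rpow_le_rpow (wm_carrier_rpow_mul_le hp hq hdw hlam hν hQ)
      (by norm_num : (0 : ℝ) ≤ 1 / 2)
    rw [ENNReal.mul_rpow_of_nonneg _ _ (by norm_num), ENNReal.mul_rpow_of_nonneg _ _ (by norm_num),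
      ENNReal.mul_rpow_of_nonneg _ _ (by norm_num), ← ENNReal.rpow_mul, ← ENNReal.rpow_mul,
      ← ENNReal.rpow_mul, ← ENNReal.rpow_natCast (volume Q.carrier), ← ENNReal.rpow_mul] at h
    simpa using h
  have key := carlesonFor_of_prod D hw hs0 hs1 h1 hBt hBw
  exact ⟨key 0, key 1, key 2⟩

/-- **Theorem 3.9** (Bloom upper estimate for paraproducts). Let `(μ',λ,ν) ∈ B_{p',q}`
with `μ' = μ^{−p'/p}` and `ν^{1/p+1/q'} = μ^{1/p} λ^{−1/q}`. If `b ∈ BMO_ν^α` (when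
`p ≤ q`), respectively `M_ν^♯ b ∈ L^r(ν)` (when `p > q`), then for every `f ∈ L^p(μ)` the
paraproduct sum `Π_b f = Σ_{Q∈𝒟} D_Q b ⟨f⟩_Q` converges unconditionally in `L^q(λ)`, with
the corresponding quantitative bound on `‖Π_b‖_{L^p(μ)→L^q(λ)}`. -/
theorem stmt8 (d : ℕ) (hd : 0 < d) (p q r α : ℝ) (hp : 1 < p) (hq : 1 < q)
    (hr : 1 / r = 1 / q - 1 / p) (hα : α / d = 1 / p - 1 / q) :
    ∃ C : ℝ, 0 < C ∧
      ∀ (D : DyadicLattice d) (μ lam ν : Rd d → ℝ),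
        IsWeight μ → IsWeight lam → IsWeight ν →
        LocallyIntegrable (fun x => μ x ^ (-(conj p / p))) volume →
        (∀ x, ν x ^ (1 / p + 1 / conj q) = μ x ^ (1 / p) * lam x ^ (-(1 / q))) →
        BupperOn D.cubes p q (fun x => μ x ^ (-(conj p / p))) lam ν < ⊤ →
        ∀ b : Rd d → ℝ, L1loc b →
          (p ≤ q → bmoNormOn D.cubes (1 + α / d) ν b < ⊤ →
            ∀ f : Rd d → ℝ, Measurable f → wnorm p μ f < ⊤ →
              ∃ Pf : Rd d → ℝ, UncondConvLq D q lam b f Pf ∧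
                wnorm q lam Pf ≤
                  ENNReal.ofReal C *
                    BupperOn D.cubes p q (fun x => μ x ^ (-(conj p / p))) lam ν *
                    AinfCharOn D.cubes (fun x => μ x ^ (-(conj p / p))) ^ (1 / p) *
                    AinfCharOn D.cubes lam ^ (1 / conj q) *
                    bmoNormOn D.cubes (1 + α / d) ν b * wnorm p μ f) ∧
          (q < p → sharpNormOn D.cubes r ν b < ⊤ →
            ∀ f : Rd d → ℝ, Measurable f → wnorm p μ f < ⊤ →
              ∃ Pf : Rd d → ℝ, UncondConvLq D q lam b f Pf ∧
                wnorm q lam Pf ≤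
                  ENNReal.ofReal C *
                    BupperOn D.cubes p q (fun x => μ x ^ (-(conj p / p))) lam ν *
                    AinfCharOn D.cubes (fun x => μ x ^ (-(conj p / p))) ^ (1 / p) *
                    AinfCharOn D.cubes lam ^ (1 / conj q) *
                    AinfCharOn D.cubes ν ^ (1 / r) *
                    sharpNormOn D.cubes r ν b * wnorm p μ f) := by
  have hp0 : 0 < p := by linarith
  have hq0 : 0 < q := by linarith
  have hp' := one_lt_conj hp
  have hq' := one_lt_conj hq
  have hαe : 1 + α / d = 1 / p + 1 / conj q := by rw [hα, one_div_conj hq]; ring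
  set C₀ : ℝ≥0∞ := ENNReal.ofReal (6 * (2 ^ d * 6) ^ 2) *
    ((embC p * 2) ^ (1 / p) * (embC (conj q) * 2) ^ (1 / conj q)) with hC₀
  have hC₀t : C₀ ≠ ⊤ := by
    have h1 := embC_ne_top hp
    have h2 := embC_ne_top hq'
    refine ENNReal.mul_ne_top ENNReal.ofReal_ne_top (ENNReal.mul_ne_top ?_ ?_) <;>
      exact ENNReal.rpow_ne_top_of_nonneg (by positivity) (by finiteness)
  set C₁ : ℝ≥0∞ := C₀ * (embC r * 2) ^ (1 / r) with hC₁
  have hr1 : q < p → 1 < r := by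
    intro hqp
    have h1 : 1 / p < 1 / q := one_div_lt_one_div_of_lt hq0 hqp
    have h2 : 0 < 1 / r := by rw [hr]; linarith
    have h3 : 1 / r < 1 := by
      have : 1 / q < 1 := by rw [div_lt_one hq0]; exact hq
      have : 0 < 1 / p := by positivity
      rw [hr]; linarith
    have hr0 : 0 < r := one_div_pos.mp h2
    rwa [div_lt_one hr0] at h3
  have hC₁t : q < p → C₁ ≠ ⊤ := by
    intro hqp
    have h1 := embC_ne_top (hr1 hqp)
    have h2 := hr1 hqp
    exact ENNReal.mul_ne_top hC₀t (ENNReal.rpow_ne_top_of_nonneg (by positivity) (by finiteness))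
  refine ⟨C₀.toReal + C₁.toReal + 1, by positivity, ?_⟩
  intro D μ lam ν hμ hlam hν hμ' hbloom hB b hb
  change LocallyIntegrable (dualW p μ) volume at hμ'
  change BupperOn D.cubes p q (dualW p μ) lam ν < ⊤ at hB
  rw [hαe]
  obtain ⟨⟨K₁, hK₁t, hK₁⟩, ⟨K₂, hK₂t, hK₂⟩, ⟨K₃, hK₃t, hK₃⟩⟩ :=
    exists_carlesonFor hp hq hμ hlam hν hμ' hbloom hB
  have hA₁ := carlesonFor_ainf D (isWeight_dualW hμ hμ')
  have hA₂ := carlesonFor_ainf D hlam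
  have hA₃ := carlesonFor_ainf D hν
  have he₁ : embC p ≠ ⊤ := embC_ne_top hp
  have he₂ : embC (conj q) ≠ ⊤ := embC_ne_top hq'
  have hf₁ : (embC p * K₁) ^ (1 / p) ≠ ⊤ :=
    ENNReal.rpow_ne_top_of_nonneg (by positivity) (by finiteness)
  have hf₂ : (embC (conj q) * K₂) ^ (1 / conj q) ≠ ⊤ :=
    ENNReal.rpow_ne_top_of_nonneg (by positivity) (by finiteness)
  refine ⟨fun hpq hbmo f hf hfp => ?_, fun hqp hsharp f hf hfp => ?_⟩
  · obtain ⟨Pf, hPf, hbound⟩ := exists_uncondConvLq hq hlam hf hfp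
      (ENNReal.mul_ne_top ENNReal.ofReal_ne_top
        (ENNReal.mul_ne_top (ENNReal.mul_ne_top hB.ne hbmo.ne) (ENNReal.mul_ne_top hf₁ hf₂)))
      ((sparseBound_of_bmo D hd hp hq hpq hμ hlam hν hμ' hK₁ hK₂).partialBound hd hp hq hμ hlam
        hμ' hb)
    refine ⟨Pf, hPf, (hbound _ ((sparseBound_of_bmo D hd hp hq hpq hμ hlam hν hμ' hA₁
      hA₂).partialBound hd hp hq hμ hlam hμ' hb)).trans ?_⟩
    gcongr ?_ * _
    have hC : C₀ ≤ ENNReal.ofReal (C₀.toReal + C₁.toReal + 1) := by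
      rw [← ENNReal.ofReal_toReal hC₀t]
      refine ENNReal.ofReal_le_ofReal ?_
      rw [ENNReal.ofReal_toReal hC₀t]
      linarith [ENNReal.toReal_nonneg (a := C₁)]
    refine le_trans (le_of_eq ?_) (show C₀ * BupperOn D.cubes p q (dualW p μ) lam ν *
      AinfCharOn D.cubes (dualW p μ) ^ (1 / p) * AinfCharOn D.cubes lam ^ (1 / conj q) *
      bmoNormOn D.cubes (1 / p + 1 / conj q) ν b ≤ _ by
        change _ ≤ ENNReal.ofReal (C₀.toReal + C₁.toReal + 1) *
          BupperOn D.cubes p q (dualW p μ) lam ν *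
          AinfCharOn D.cubes (dualW p μ) ^ (1 / p) * _ * _
        gcongr)
    rw [hC₀, ← mul_assoc (embC p), ← mul_assoc (embC (conj q)),
      ENNReal.mul_rpow_of_nonneg (embC p * 2) _ (by positivity),
      ENNReal.mul_rpow_of_nonneg (embC (conj q) * 2) _ (by positivity)]
    ring
  · have hr0 : 0 < r := by linarith [hr1 hqp]
    have he₃ : embC r ≠ ⊤ := embC_ne_top (hr1 hqp)
    have hf₃ : (embC r * K₃) ^ (1 / r) ≠ ⊤ :=
      ENNReal.rpow_ne_top_of_nonneg (by positivity) (by finiteness)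
    obtain ⟨Pf, hPf, hbound⟩ := exists_uncondConvLq hq hlam hf hfp
      (ENNReal.mul_ne_top ENNReal.ofReal_ne_top
        (ENNReal.mul_ne_top (ENNReal.mul_ne_top hB.ne hsharp.ne)
          (ENNReal.mul_ne_top (ENNReal.mul_ne_top hf₁ hf₂) hf₃)))
      ((sparseBound_of_sharp D hd hp hq hqp hr hμ hlam hν hμ' hK₁ hK₂ hK₃).partialBound hd hp hq
        hμ hlam hμ' hb)
    refine ⟨Pf, hPf, (hbound _ ((sparseBound_of_sharp D hd hp hq hqp hr hμ hlam hν hμ' hA₁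
      hA₂ hA₃).partialBound hd hp hq hμ hlam hμ' hb)).trans ?_⟩
    gcongr ?_ * _
    have hC : C₁ ≤ ENNReal.ofReal (C₀.toReal + C₁.toReal + 1) := by
      rw [← ENNReal.ofReal_toReal (hC₁t hqp)]
      refine ENNReal.ofReal_le_ofReal ?_
      rw [ENNReal.ofReal_toReal (hC₁t hqp)]
      linarith [ENNReal.toReal_nonneg (a := C₀)]
    refine le_trans (le_of_eq ?_) (show C₁ * BupperOn D.cubes p q (dualW p μ) lam ν *
      AinfCharOn D.cubes (dualW p μ) ^ (1 / p) * AinfCharOn D.cubes lam ^ (1 / conj q) *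
      AinfCharOn D.cubes ν ^ (1 / r) * sharpNormOn D.cubes r ν b ≤ _ by
        change _ ≤ ENNReal.ofReal (C₀.toReal + C₁.toReal + 1) *
          BupperOn D.cubes p q (dualW p μ) lam ν *
          AinfCharOn D.cubes (dualW p μ) ^ (1 / p) * _ * _ * _
        gcongr)
    rw [hC₁, hC₀, ← mul_assoc (embC p), ← mul_assoc (embC (conj q)), ← mul_assoc (embC r),
      ENNReal.mul_rpow_of_nonneg (embC p * 2) _ (by positivity),
      ENNReal.mul_rpow_of_nonneg (embC (conj q) * 2) _ (by positivity),
      ENNReal.mul_rpow_of_nonneg (embC r * 2) _ (by positivity)]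
    ring
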